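/- Let k be a positive integer and let p > k (so that p/k > 1). Then the operator norms of 𝓚 on ℓ^p(ℤ) and on ℓ^{p/k}(ℤ) satisfy ‖𝓚‖_p^k ≤ (Σ_{S ∈ 𝕊_k} C_p^S) · ‖𝓚‖_{p/k} + Σ_{j=1}^{k−1} (Σ_{S ∈ 𝕊_j} C_p^S) · ‖𝓚‖_p^{k−j−1}. -/

import Mathlib

open scoped BigOperators
open MeasureTheory

noncomputable section

/-- The ℓ^p norm of a doubly infinite complex sequence. -/
def lpNorm (p : ℝ) (a : ℤ → ℂ) : ℝ := (∑' n : ℤ, ‖a n‖ ^ p) ^ (1 / p)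

/-- Membership in ℓ^p(ℤ). -/
def MemLpZ (p : ℝ) (a : ℤ → ℂ) : Prop := Summable fun n : ℤ => ‖a n‖ ^ p

/-- The operator norm of an operator on ℓ^p(ℤ): the least admissible constant. -/
def opNormOn (p : ℝ) (T : (ℤ → ℂ) → ℤ → ℂ) : ℝ :=
  sInf {C : ℝ | 0 ≤ C ∧ ∀ a : ℤ → ℂ, MemLpZ p a → lpNorm p (T a) ≤ C * lpNorm p a}

/-- The Riesz–Titchmarsh operator: 𝓡 a_n = (1/π) Σ_{m ∈ ℤ} a_{n-m}/(m + 1/2). -/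
def RT (a : ℤ → ℂ) (n : ℤ) : ℂ :=
  (1 / (Real.pi : ℂ)) * ∑' m : ℤ, a (n - m) / ((m : ℂ) + 1 / 2)

/-- The Kak–Hilbert transform: 𝓚 a_n = (2/π) Σ_{m odd} a_{n-m}/m. -/
def KT (a : ℤ → ℂ) (n : ℤ) : ℂ :=
  (2 / (Real.pi : ℂ)) * ∑' m : {m : ℤ // Odd m}, a (n - (m : ℤ)) / ((m : ℤ) : ℂ)

/-- The discrete Hilbert transform: 𝓗₀ a_n = (1/π) Σ_{m ≠ 0} a_{n-m}/m. -/
def H0T (a : ℤ → ℂ) (n : ℤ) : ℂ :=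
  (1 / (Real.pi : ℂ)) * ∑' m : {m : ℤ // m ≠ 0}, a (n - (m : ℤ)) / ((m : ℤ) : ℂ)

/-- The operator 𝓗: 𝓗 a_n = (2/π) Σ_{m even, m ≠ 0} a_{n-m}/m. -/
def HT (a : ℤ → ℂ) (n : ℤ) : ℂ :=
  (2 / (Real.pi : ℂ)) *
    ∑' m : {m : ℤ // Even (m : ℤ) ∧ (m : ℤ) ≠ 0}, a (n - (m : ℤ)) / ((m : ℤ) : ℂ)

/-- The operator 𝓘: 𝓘 a_n = (4/π²) Σ_{m odd} a_{n-m}/m². -/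
def IT (a : ℤ → ℂ) (n : ℤ) : ℂ :=
  (4 / (Real.pi : ℂ) ^ 2) * ∑' m : {m : ℤ // Odd m}, a (n - (m : ℤ)) / ((m : ℤ) : ℂ) ^ 2

/-- p* = max(p, p/(p-1)). -/
def pstar (p : ℝ) : ℝ := max p (p / (p - 1))

/-- C_p = cot(π/(2 p*)). -/
def Cconst (p : ℝ) : ℝ := Real.cot (Real.pi / (2 * pstar p))


/-- Frames: every integer is a frame; every finite set of frames is a frame
(represented here as a list of frames). -/
inductive Frame : Type
  | int : ℤ → Frame
  | set : List Frame → Frame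

namespace Frame

/-- The size of a frame: the number of integers appearing in it. -/
def size : Frame → ℕ
  | .int _ => 1
  | .set l => (l.attach.map (fun x => size x.1)).sum
  decreasing_by simp only [Frame.set.sizeOf_spec]; have := List.sizeOf_lt_of_mem x.2; omega

/-- The building 𝓗^{{F}} a with frame {F}. -/
def build (a : ℤ → ℂ) : Frame → ℤ → ℂ
  | .int _ => a
  | .set l => HT (fun n => (l.attach.map (fun x => build a x.1 n)).prod)
  decreasing_by simp only [Frame.set.sizeOf_spec]; have := List.sizeOf_lt_of_mem x.2; omega

/-- The building 𝓗^F a for a set frame F: the product Π_{f ∈ F} 𝓗^{{f}} a. -/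
def buildProd (a : ℤ → ℂ) (F : Frame) : ℤ → ℂ :=
  match F with
  | .int _ => a
  | .set l => fun n => (l.map (fun f => build a f n)).prod

/-- The building norm C_p^{{F}}. -/
def frameNorm (p : ℝ) : Frame → ℝ
  | .int _ => 1
  | .set l => Cconst (p / (Frame.set l).size) * (l.attach.map (fun x => frameNorm p x.1)).prod
  decreasing_by simp only [Frame.set.sizeOf_spec]; have := List.sizeOf_lt_of_mem x.2; omega

/-- The building norm C_p^F for a set frame F: the product Π_{f ∈ F} C_p^{{f}}. -/
def setNorm (p : ℝ) (F : Frame) : ℝ :=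
  match F with
  | .int _ => 1
  | .set l => (l.map (frameNorm p)).prod

/-- Adjoin a new element to a set frame. -/
def addElem (F g : Frame) : Frame :=
  match F with
  | .int m => Frame.set [g, .int m]
  | .set l => Frame.set (g :: l)

end Frame

/-- The list of skeletons of size k: 𝕊₁ = {{1}},
𝕊_{k+1} = {{S, k+1} : S ∈ 𝕊_k} ∪ {S ∪ {{k+1}} : S ∈ 𝕊_k}. -/
def skeletons : ℕ → List Frame
  | 0 => []
  | 1 => [Frame.set [Frame.int 1]]
  | (k + 2) =>
      (skeletons (k + 1)).map (fun S => Frame.set [S, Frame.int ((k : ℤ) + 2)]) ++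
      (skeletons (k + 1)).map (fun S => S.addElem (Frame.set [Frame.int ((k : ℤ) + 2)]))


theorem sin_mul_div_rpow_monotoneOn {p : ℝ} (hp : 1 < p) (hp2 : p ≤ 2) :
    MonotoneOn (fun θ : ℝ => Real.sin ((p - 1) * θ) / Real.sin θ ^ (p - 1))
      (Set.Ioo 0 (Real.pi / 2)) := by
  have hpi := Real.pi_pos
  have hs : ∀ θ ∈ Set.Ioo 0 (Real.pi / 2), 0 < Real.sin θ := fun θ hθ =>
    Real.sin_pos_of_pos_of_lt_pi hθ.1 (by linarith [hθ.2])
  have hd : ∀ θ ∈ Set.Ioo 0 (Real.pi / 2),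
      HasDerivAt (fun θ : ℝ => Real.sin ((p - 1) * θ) / Real.sin θ ^ (p - 1))
        ((p - 1) * Real.sin ((2 - p) * θ) / Real.sin θ ^ p) θ := by
    intro θ hθ
    have h1 : HasDerivAt (fun θ : ℝ => Real.sin ((p - 1) * θ))
        (Real.cos ((p - 1) * θ) * (p - 1)) θ := by
      simpa using ((hasDerivAt_id θ).const_mul (p - 1)).sin
    have h2 := (Real.hasDerivAt_sin θ).rpow_const (p := p - 1) (Or.inl (hs θ hθ).ne')
    have h3 := h1.div h2 (Real.rpow_pos_of_pos (hs θ hθ) _).ne'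
    refine h3.congr_deriv ?_
    have e1 : Real.sin ((2 - p) * θ) =
        Real.sin θ * Real.cos ((p - 1) * θ) - Real.cos θ * Real.sin ((p - 1) * θ) := by
      rw [← Real.sin_sub]; ring_nf
    have e2 : Real.sin θ ^ (p - 1) = Real.sin θ ^ (p - 1 - 1) * Real.sin θ := by
      rw [← Real.rpow_add_one (hs θ hθ).ne']; ring_nf
    have e3 : Real.sin θ ^ p = Real.sin θ ^ (p - 1 - 1) * Real.sin θ ^ 2 := by
      rw [← Real.rpow_natCast, ← Real.rpow_add (hs θ hθ)]; ring_nf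
    have e4 := (Real.rpow_pos_of_pos (hs θ hθ) (p - 1 - 1)).ne'
    have e5 := (hs θ hθ).ne'
    rw [e1, e2, e3]
    field_simp
  refine monotoneOn_of_deriv_nonneg (convex_Ioo _ _)
    (fun θ hθ => (hd θ hθ).continuousAt.continuousWithinAt) ?_ ?_
  · intro θ hθ
    rw [interior_Ioo] at hθ
    exact (hd θ hθ).differentiableAt.differentiableWithinAt
  · intro θ hθ
    rw [interior_Ioo] at hθ
    rw [(hd θ hθ).deriv]
    have : 0 ≤ Real.sin ((2 - p) * θ) := Real.sin_nonneg_of_nonneg_of_le_pi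
      (mul_nonneg (by linarith) hθ.1.le) (by nlinarith [hθ.1, hθ.2])
    have := Real.rpow_pos_of_pos (hs θ hθ) p
    have : 0 < p - 1 := by linarith
    positivity

/-- Trigonometric form of the Pichorides inequality. -/
theorem pichorides_trig {p : ℝ} (hp : 1 < p) (hp2 : p ≤ 2) {θ : ℝ}
    (h0 : 0 ≤ θ) (h1 : θ < Real.pi / 2) :
    Real.sin θ ^ p ≤ Real.tan (Real.pi / (2 * p)) ^ p * Real.cos θ ^ p -
      Real.sin (Real.pi / (2 * p)) ^ (p - 1) / Real.cos (Real.pi / (2 * p)) *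
        Real.cos (p * θ) := by
  have hpi := Real.pi_pos
  set γ := Real.pi / (2 * p) with hγ
  have hγ0 : 0 < γ := by positivity
  have hγ1 : γ < Real.pi / 2 := by
    rw [hγ]; exact div_lt_div_of_pos_left hpi (by norm_num) (by linarith)
  have hγp : p * γ = Real.pi / 2 := by rw [hγ]; field_simp
  have hsγ : 0 < Real.sin γ := Real.sin_pos_of_pos_of_lt_pi hγ0 (by linarith)
  have hcγ : 0 < Real.cos γ := Real.cos_pos_of_mem_Ioo ⟨by linarith, hγ1⟩
  set D := Real.sin γ ^ (p - 1) / Real.cos γ with hD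
  have hDpos : 0 < D := div_pos (Real.rpow_pos_of_pos hsγ _) hcγ
  have hs : ∀ θ ∈ Set.Ioo 0 (Real.pi / 2), 0 < Real.sin θ := fun θ hθ =>
    Real.sin_pos_of_pos_of_lt_pi hθ.1 (by linarith [hθ.2])
  have hc : ∀ θ ∈ Set.Ioo 0 (Real.pi / 2), 0 < Real.cos θ := fun θ hθ =>
    Real.cos_pos_of_mem_Ioo ⟨by linarith [hθ.1], hθ.2⟩
  set b : ℝ → ℝ := fun θ => Real.tan γ ^ p - Real.tan θ ^ p - D * (Real.cos (p * θ) / Real.cos θ ^ p)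
    with hb
  have hd : ∀ θ ∈ Set.Ioo 0 (Real.pi / 2), HasDerivAt b
      (p / Real.cos θ ^ (p + 1) *
        (D * Real.sin ((p - 1) * θ) - Real.sin θ ^ (p - 1))) θ := by
    intro θ hθ
    have hc' := hc θ hθ
    have hs' := hs θ hθ
    have htan : 0 < Real.tan θ := Real.tan_pos_of_pos_of_lt_pi_div_two hθ.1 hθ.2
    have h1 := (Real.hasDerivAt_tan hc'.ne').rpow_const (p := p) (Or.inl htan.ne')
    have h2 : HasDerivAt (fun θ : ℝ => Real.cos (p * θ)) (-Real.sin (p * θ) * p) θ := by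
      simpa using ((hasDerivAt_id θ).const_mul p).cos
    have h3 := (Real.hasDerivAt_cos θ).rpow_const (p := p) (Or.inl hc'.ne')
    have h4 := ((h1.const_sub (Real.tan γ ^ p)).sub
      ((h2.div h3 (Real.rpow_pos_of_pos hc' _).ne').const_mul D))
    refine h4.congr_deriv ?_
    have e1 : Real.sin ((p - 1) * θ) =
        Real.sin (p * θ) * Real.cos θ - Real.cos (p * θ) * Real.sin θ := by
      rw [← Real.sin_sub]; ring_nf
    have e2 : Real.cos θ ^ p = Real.cos θ ^ (p - 1) * Real.cos θ := by
      rw [← Real.rpow_add_one hc'.ne']; ring_nf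
    have e3 : Real.cos θ ^ (p + 1) = Real.cos θ ^ (p - 1) * Real.cos θ ^ 2 := by
      rw [← Real.rpow_natCast, ← Real.rpow_add hc']; ring_nf
    have e4 := (Real.rpow_pos_of_pos hc' (p - 1)).ne'
    have e5 : Real.tan θ ^ (p - 1) = Real.sin θ ^ (p - 1) / Real.cos θ ^ (p - 1) := by
      rw [Real.tan_eq_sin_div_cos, Real.div_rpow hs'.le hc'.le]
    rw [e1, e2, e3, e5]
    field_simp
    ring
  have hbγ : b γ = 0 := by simp [hb, hγp]
  have hηγ : Real.sin ((p - 1) * γ) / Real.sin γ ^ (p - 1) = 1 / D := by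
    have : (p - 1) * γ = Real.pi / 2 - γ := by linarith
    rw [this, Real.sin_pi_div_two_sub, hD, one_div_div]
  have hmono := sin_mul_div_rpow_monotoneOn hp hp2
  have hγmem : γ ∈ Set.Ioo 0 (Real.pi / 2) := ⟨hγ0, hγ1⟩
  have hbpos : ∀ θ ∈ Set.Ioo 0 (Real.pi / 2), 0 ≤ b θ := by
    intro θ hθ
    rcases le_total θ γ with hle | hle
    · have : AntitoneOn b (Set.Ioc 0 γ) := by
        refine antitoneOn_of_deriv_nonpos (convex_Ioc _ _)
          (fun x hx => (hd x ⟨hx.1, by linarith [hx.2]⟩).continuousAt.continuousWithinAt) ?_ ?_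
        · intro x hx
          rw [interior_Ioc] at hx
          exact (hd x ⟨hx.1, by linarith [hx.2]⟩).differentiableAt.differentiableWithinAt
        · intro x hx
          rw [interior_Ioc] at hx
          have hx' : x ∈ Set.Ioo 0 (Real.pi / 2) := ⟨hx.1, by linarith [hx.2]⟩
          rw [(hd x hx').deriv]
          have h := hmono hx' hγmem hx.2.le
          simp only [hηγ] at h
          have hsp := Real.rpow_pos_of_pos (hs x hx') (p - 1)
          rw [div_le_div_iff₀ hsp hDpos] at h
          have hcp := Real.rpow_pos_of_pos (hc x hx') (p + 1)
          exact mul_nonpos_of_nonneg_of_nonpos (by positivity) (by linarith)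
      have := this ⟨hθ.1, hle⟩ ⟨hγ0, le_rfl⟩ hle
      rwa [hbγ] at this
    · have : MonotoneOn b (Set.Ico γ (Real.pi / 2)) := by
        refine monotoneOn_of_deriv_nonneg (convex_Ico _ _)
          (fun x hx => (hd x ⟨by linarith [hx.1], hx.2⟩).continuousAt.continuousWithinAt) ?_ ?_
        · intro x hx
          rw [interior_Ico] at hx
          exact (hd x ⟨by linarith [hx.1], hx.2⟩).differentiableAt.differentiableWithinAt
        · intro x hx
          rw [interior_Ico] at hx
          have hx' : x ∈ Set.Ioo 0 (Real.pi / 2) := ⟨by linarith [hx.1], hx.2⟩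
          rw [(hd x hx').deriv]
          have h := hmono hγmem hx' hx.1.le
          simp only [hηγ] at h
          have hsp := Real.rpow_pos_of_pos (hs x hx') (p - 1)
          rw [div_le_div_iff₀ hDpos hsp] at h
          have hcp := Real.rpow_pos_of_pos (hc x hx') (p + 1)
          exact mul_nonneg (by positivity) (by linarith)
      have := this ⟨le_rfl, hγ1⟩ ⟨hle, hθ.2⟩ hle
      rwa [hbγ] at this
  have hmain : ∀ θ ∈ Set.Ioo 0 (Real.pi / 2), 
      Real.sin θ ^ p ≤ Real.tan γ ^ p * Real.cos θ ^ p - D * Real.cos (p * θ) := by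
    intro θ hθ
    have h := hbpos θ hθ
    have hcp := Real.rpow_pos_of_pos (hc θ hθ) p
    have e5 : Real.tan θ ^ p = Real.sin θ ^ p / Real.cos θ ^ p := by
      rw [Real.tan_eq_sin_div_cos, Real.div_rpow (hs θ hθ).le (hc θ hθ).le]
    have := mul_nonneg h hcp.le
    simp only [hb, e5] at this
    have e : (Real.tan γ ^ p - Real.sin θ ^ p / Real.cos θ ^ p -
        D * (Real.cos (p * θ) / Real.cos θ ^ p)) * Real.cos θ ^ p =
        Real.tan γ ^ p * Real.cos θ ^ p - Real.sin θ ^ p - D * Real.cos (p * θ) := by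
      field_simp
    linarith
  rcases h0.eq_or_lt with rfl | h0
  · have hp0 : 0 ≤ p := by linarith
    have hcl : closure (Set.Ioo 0 (Real.pi / 2)) = Set.Icc 0 (Real.pi / 2) :=
      closure_Ioo (by positivity)
    refine le_on_closure (s := Set.Ioo 0 (Real.pi / 2)) hmain ?_ ?_ (x := 0) ?_
    · exact (Real.continuous_sin.rpow_const fun _ => Or.inr hp0).continuousOn
    · refine Continuous.continuousOn ?_
      have := Real.continuous_cos.rpow_const (p := p) fun _ => Or.inr hp0
      fun_prop
    · rw [hcl]; exact ⟨le_rfl, by positivity⟩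
  · exact hmain θ ⟨h0, h1⟩

/-- The Pichorides inequality in the right half-plane. -/
theorem pichorides_halfPlane {p : ℝ} (hp : 1 < p) (hp2 : p ≤ 2) {z : ℂ} (hz : 0 < z.re) :
    |z.im| ^ p ≤ Real.tan (Real.pi / (2 * p)) ^ p * z.re ^ p -
      Real.sin (Real.pi / (2 * p)) ^ (p - 1) / Real.cos (Real.pi / (2 * p)) *
        (z ^ (p : ℂ)).re := by
  have hθ : |z.arg| < Real.pi / 2 := Complex.abs_arg_lt_pi_div_two_iff.2 (Or.inl hz)
  have h := pichorides_trig hp hp2 (abs_nonneg _) hθ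
  have hn := norm_nonneg z
  have hr : z.re = ‖z‖ * Real.cos |z.arg| := by
    rw [Real.cos_abs, Complex.norm_mul_cos_arg]
  have hsin : 0 ≤ Real.sin |z.arg| := Real.sin_nonneg_of_nonneg_of_le_pi (abs_nonneg _)
      (by linarith [Real.pi_pos])
  have hi : |z.im| = ‖z‖ * Real.sin |z.arg| := by
    rw [← Complex.norm_mul_sin_arg z, abs_mul, abs_norm]
    congr 1
    rw [← abs_of_nonneg hsin]
    rcases abs_choice z.arg with h | h <;> rw [h]
    rw [Real.sin_neg, abs_neg]
  have hcos : 0 ≤ Real.cos |z.arg| := by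
    by_contra! hc
    nlinarith
  rw [hi, Complex.cpow_ofReal_re, hr, Real.mul_rpow hn hcos, Real.mul_rpow hn hsin]
  have e : Real.cos (z.arg * p) = Real.cos (p * |z.arg|) := by
    rcases abs_choice z.arg with h | h <;> rw [h]
    · ring_nf
    · rw [← Real.cos_neg]; ring_nf
  rw [e]
  have := mul_le_mul_of_nonneg_left h (Real.rpow_nonneg hn p)
  linarith

theorem mul_re_cpow_sub_one_le {α : ℝ} (h0 : 0 ≤ α) (h1 : α ≤ 1) {z : ℂ} (hz : 0 < z.re) :
    α * z.re * (z ^ ((α - 1 : ℝ) : ℂ)).re ≤ (z ^ (α : ℂ)).re := by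
  have hθ : |z.arg| < Real.pi / 2 := Complex.abs_arg_lt_pi_div_two_iff.2 (Or.inl hz)
  have hz0 : z ≠ 0 := by rintro rfl; simp at hz
  have hn := norm_pos_iff.2 hz0
  have hpi := Real.pi_pos
  rw [Complex.cpow_ofReal_re, Complex.cpow_ofReal_re, ← Complex.norm_mul_cos_arg z]
  have e : ‖z‖ ^ α = ‖z‖ * ‖z‖ ^ (α - 1) := by
    rw [Real.rpow_sub_one hn.ne']; field_simp
  rw [e]
  have ha : Real.cos (z.arg * α) = Real.cos (α * |z.arg|) := by
    rcases abs_choice z.arg with h | h <;> rw [h]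
    · ring_nf
    · rw [← Real.cos_neg]; ring_nf
  have hb : 2 * (Real.cos z.arg * Real.cos (z.arg * (α - 1))) =
      Real.cos ((2 - α) * |z.arg|) + Real.cos (α * |z.arg|) := by
    rw [← ha, ← mul_assoc, Real.two_mul_cos_mul_cos]
    congr 1
    · rcases abs_choice z.arg with h | h <;> rw [h]
      · ring_nf
      · rw [← Real.cos_neg]; ring_nf
    · ring_nf
  have hnn := abs_nonneg z.arg
  have hle : Real.cos ((2 - α) * |z.arg|) ≤ Real.cos (α * |z.arg|) :=
    Real.cos_le_cos_of_nonneg_of_le_pi (by positivity) (by nlinarith) (by nlinarith)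
  have hc : 0 ≤ Real.cos (α * |z.arg|) :=
    Real.cos_nonneg_of_mem_Icc ⟨by nlinarith, by nlinarith⟩
  have key : α * (Real.cos z.arg * Real.cos (z.arg * (α - 1))) ≤ Real.cos (z.arg * α) := by
    rw [ha]; nlinarith
  have hm : 0 ≤ ‖z‖ * ‖z‖ ^ (α - 1) := by positivity
  nlinarith [mul_le_mul_of_nonneg_left key hm]

/-- The real part of `w`, replaced by the smooth positive function `√(u ^ 2 + ε ^ 2)`. -/
def regRe (ε : ℝ) (w : ℂ) : ℝ := √(w.re ^ 2 + ε ^ 2)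

/-- A smooth approximation of `|Re w| + i Im w`, with values in the right half-plane. -/
def reg (ε : ℝ) (w : ℂ) : ℂ := (regRe ε w : ℂ) + (w.im : ℂ) * Complex.I

/-- First derivative of `reg ε` along a curve through `w` with velocity `d`. -/
def reg₁ (ε : ℝ) (w d : ℂ) : ℂ := ((w.re * d.re / regRe ε w : ℝ) : ℂ) + (d.im : ℂ) * Complex.I

/-- Second derivative of `reg ε` along a curve through `w` with velocity `d`, acceleration `e`. -/
def reg₂ (ε : ℝ) (w d e : ℂ) : ℂ :=
  (((d.re ^ 2 + w.re * e.re) / regRe ε w - (w.re * d.re) ^ 2 / regRe ε w ^ 3 : ℝ) : ℂ) +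
    (e.im : ℂ) * Complex.I

/-- A smooth approximation of the subharmonic function `Re ((|u| + i v) ^ p)`. -/
def regPow (p ε : ℝ) (w : ℂ) : ℝ := (reg ε w ^ (p : ℂ)).re

/-- First derivative of `regPow p ε` along a curve. -/
def regPow₁ (p ε : ℝ) (w d : ℂ) : ℝ :=
  ((p : ℂ) * reg ε w ^ ((p - 1 : ℝ) : ℂ) * reg₁ ε w d).re

/-- Second derivative of `regPow p ε` along a curve. -/
def regPow₂ (p ε : ℝ) (w d e : ℂ) : ℝ :=
  ((p : ℂ) * ((p - 1 : ℝ) : ℂ) * reg ε w ^ ((p - 2 : ℝ) : ℂ) * reg₁ ε w d ^ 2 +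
    (p : ℂ) * reg ε w ^ ((p - 1 : ℝ) : ℂ) * reg₂ ε w d e).re

section Regularisation

variable {p ε : ℝ}

theorem regRe_pos (hε : 0 < ε) (w : ℂ) : 0 < regRe ε w := Real.sqrt_pos.2 (by positivity)

theorem regRe_sq (ε : ℝ) (w : ℂ) : regRe ε w ^ 2 = w.re ^ 2 + ε ^ 2 :=
  Real.sq_sqrt (by positivity)

@[simp] theorem reg_re (ε : ℝ) (w : ℂ) : (reg ε w).re = regRe ε w := by simp [reg]

@[simp] theorem reg_im (ε : ℝ) (w : ℂ) : (reg ε w).im = w.im := by simp [reg]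

theorem reg_mem_slitPlane (hε : 0 < ε) (w : ℂ) : reg ε w ∈ Complex.slitPlane :=
  Or.inl (by simpa using regRe_pos hε w)

theorem HasDerivAt.complex_re {w : ℝ → ℂ} {w' : ℂ} {τ : ℝ} (h : HasDerivAt w w' τ) :
    HasDerivAt (fun τ => (w τ).re) w'.re τ :=
  Complex.reCLM.hasFDerivAt.comp_hasDerivAt τ h

theorem HasDerivAt.complex_im {w : ℝ → ℂ} {w' : ℂ} {τ : ℝ} (h : HasDerivAt w w' τ) :
    HasDerivAt (fun τ => (w τ).im) w'.im τ :=
  Complex.imCLM.hasFDerivAt.comp_hasDerivAt τ h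

theorem HasDerivAt.regRe (hε : 0 < ε) {w : ℝ → ℂ} {w' : ℂ} {τ : ℝ} (h : HasDerivAt w w' τ) :
    HasDerivAt (fun τ => regRe ε (w τ)) ((w τ).re * w'.re / regRe ε (w τ)) τ := by
  have h1 := ((h.complex_re.pow 2).add_const (ε ^ 2)).sqrt
    (by have := sq_nonneg (w τ).re; simp only [Pi.pow_apply]; positivity)
  refine h1.congr_deriv ?_
  have := (regRe_pos hε (w τ)).ne'
  rw [_root_.regRe] at *
  simp only [Pi.pow_apply]
  field_simp
  norm_num
  ring

theorem HasDerivAt.reg (hε : 0 < ε) {w : ℝ → ℂ} {w' : ℂ} {τ : ℝ} (h : HasDerivAt w w' τ) :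
    HasDerivAt (fun τ => reg ε (w τ)) (reg₁ ε (w τ) w') τ :=
  (h.regRe hε).ofReal_comp.add (h.complex_im.ofReal_comp.mul_const Complex.I)

theorem HasDerivAt.reg₁ (hε : 0 < ε) {w d : ℝ → ℂ} {e : ℂ} {τ : ℝ} (h : HasDerivAt w (d τ) τ)
    (h' : HasDerivAt d e τ) :
    HasDerivAt (fun τ => reg₁ ε (w τ) (d τ)) (reg₂ ε (w τ) (d τ) e) τ := by
  have hpos := (regRe_pos hε (w τ)).ne'
  refine HasDerivAt.add (HasDerivAt.ofReal_comp ?_) (h'.complex_im.ofReal_comp.mul_const Complex.I)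
  refine ((h.complex_re.mul h'.complex_re).div (h.regRe hε) hpos).congr_deriv ?_
  simp only [Pi.mul_apply]
  field_simp

theorem HasDerivAt.cpow_ofReal_curve {z : ℝ → ℂ} {z' : ℂ} {τ : ℝ} (c : ℝ)
    (h : HasDerivAt z z' τ) (hz : z τ ∈ Complex.slitPlane) :
    HasDerivAt (fun τ => z τ ^ (c : ℂ)) ((c : ℂ) * z τ ^ ((c - 1 : ℝ) : ℂ) * z') τ := by
  have h1 := ((hasDerivAt_id (z τ)).cpow_const (c := (c : ℂ)) hz).scomp τ h
  refine h1.congr_deriv ?_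
  simp [mul_comm]

theorem HasDerivAt.regPow (p : ℝ) (hε : 0 < ε) {w : ℝ → ℂ} {d : ℂ} {τ : ℝ}
    (h : HasDerivAt w d τ) :
    HasDerivAt (fun τ => regPow p ε (w τ)) (regPow₁ p ε (w τ) d) τ :=
  ((h.reg hε).cpow_ofReal_curve p (reg_mem_slitPlane hε _)).complex_re

theorem HasDerivAt.regPow₁ (p : ℝ) (hε : 0 < ε) {w d : ℝ → ℂ} {e : ℂ} {τ : ℝ}
    (h : HasDerivAt w (d τ) τ) (h' : HasDerivAt d e τ) :
    HasDerivAt (fun τ => regPow₁ p ε (w τ) (d τ)) (regPow₂ p ε (w τ) (d τ) e) τ := by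
  have h1 := (h.reg hε).cpow_ofReal_curve (p - 1) (reg_mem_slitPlane hε _)
  have h2 := ((h1.const_mul (p : ℂ)).mul (HasDerivAt.reg₁ hε h h')).complex_re
  refine h2.congr_deriv ?_
  rw [regPow₂, show p - 1 - 1 = p - 2 by ring]
  congr 1
  ring

theorem continuous_regRe (ε : ℝ) : Continuous (regRe ε) := by
  unfold regRe; fun_prop

theorem continuous_reg (ε : ℝ) : Continuous (reg ε) := by
  have := continuous_regRe ε
  unfold reg; fun_prop

theorem continuous_reg_cpow (hε : 0 < ε) (c : ℝ) : Continuous fun w => reg ε w ^ (c : ℂ) :=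
  (continuous_reg ε).cpow continuous_const (reg_mem_slitPlane hε)

theorem continuous_regPow (p : ℝ) (hε : 0 < ε) : Continuous (regPow p ε) :=
  Complex.continuous_re.comp (continuous_reg_cpow hε p)

theorem continuous_regPow₁ (p : ℝ) (hε : 0 < ε) :
    Continuous fun x : ℂ × ℂ => regPow₁ p ε x.1 x.2 := by
  have h1 := (continuous_reg_cpow hε (p - 1)).comp (continuous_fst (X := ℂ) (Y := ℂ))
  have h2 := (continuous_regRe ε).comp (continuous_fst (X := ℂ) (Y := ℂ))
  have h3 : Continuous fun x : ℂ × ℂ => x.1.re * x.2.re / regRe ε x.1 :=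
    Continuous.div (by fun_prop) h2 fun x => (regRe_pos hε _).ne'
  simp only [Function.comp_def] at h1
  unfold regPow₁ reg₁
  fun_prop

theorem continuous_regPow₂ (p : ℝ) (hε : 0 < ε) :
    Continuous fun x : ℂ × ℂ × ℂ => regPow₂ p ε x.1 x.2.1 x.2.2 := by
  have h1 := (continuous_reg_cpow hε (p - 1)).comp (continuous_fst (X := ℂ) (Y := ℂ × ℂ))
  have h1' := (continuous_reg_cpow hε (p - 2)).comp (continuous_fst (X := ℂ) (Y := ℂ × ℂ))
  have h2 := (continuous_regRe ε).comp (continuous_fst (X := ℂ) (Y := ℂ × ℂ))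
  have h3 : Continuous fun x : ℂ × ℂ × ℂ => x.1.re * x.2.1.re / regRe ε x.1 :=
    Continuous.div (by fun_prop) h2 fun x => (regRe_pos hε _).ne'
  have h4 : Continuous fun x : ℂ × ℂ × ℂ => (x.2.1.re ^ 2 + x.1.re * x.2.2.re) / regRe ε x.1 :=
    Continuous.div (by fun_prop) h2 fun x => (regRe_pos hε _).ne'
  have h5 : Continuous fun x : ℂ × ℂ × ℂ => (x.1.re * x.2.1.re) ^ 2 / regRe ε x.1 ^ 3 :=
    Continuous.div (by fun_prop) (h2.pow 3) fun x => pow_ne_zero _ (regRe_pos hε _).ne'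
  simp only [Function.comp_def] at h1 h1'
  unfold regPow₂ reg₁ reg₂
  fun_prop

/-- Subharmonicity of `regPow p ε` composed with a holomorphic function. -/
theorem regPow₂_add_nonneg (hε : 0 < ε) (hp : 1 ≤ p) (hp2 : p ≤ 2) (w d e : ℂ) :
    0 ≤ regPow₂ p ε w d e + regPow₂ p ε w (Complex.I * d) (-e) := by
  have hx := regRe_pos hε w
  have hsq := regRe_sq ε w
  set x := regRe ε w with hxdef
  have key := mul_re_cpow_sub_one_le (α := p - 1) (by linarith) (by linarith) (z := reg ε w)
    (by simpa using hx)
  rw [reg_re, show p - 1 - 1 = p - 2 by ring] at key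
  have e1 : reg₁ ε w d ^ 2 + reg₁ ε w (Complex.I * d) ^ 2 =
      ((-(ε ^ 2 / x ^ 2) * (d.re ^ 2 + d.im ^ 2) : ℝ) : ℂ) := by
    have : ε ^ 2 = x ^ 2 - w.re ^ 2 := by linarith
    rw [this]
    apply Complex.ext
    · simp only [reg₁, ← hxdef, pow_two, Complex.add_re, Complex.add_im, Complex.mul_re,
        Complex.mul_im, Complex.I_re, Complex.I_im, Complex.ofReal_re, Complex.ofReal_im]
      field_simp
      ring
    · simp only [reg₁, ← hxdef, pow_two, Complex.add_re, Complex.add_im, Complex.mul_re,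
        Complex.mul_im, Complex.I_re, Complex.I_im, Complex.ofReal_re, Complex.ofReal_im]
      ring
  have e2 : reg₂ ε w d e + reg₂ ε w (Complex.I * d) (-e) =
      ((ε ^ 2 / x ^ 3 * (d.re ^ 2 + d.im ^ 2) : ℝ) : ℂ) := by
    have : ε ^ 2 = x ^ 2 - w.re ^ 2 := by linarith
    rw [this]
    apply Complex.ext
    · simp only [reg₂, ← hxdef, Complex.add_re, Complex.ofReal_re, Complex.mul_re, Complex.I_re,
        Complex.I_im, Complex.ofReal_im, Complex.neg_re, Complex.neg_im]
      field_simp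
      ring
    · simp only [reg₂, ← hxdef, Complex.add_im, Complex.ofReal_re, Complex.mul_im, Complex.I_re,
        Complex.I_im, Complex.ofReal_im, Complex.neg_re, Complex.neg_im]
      ring
  have e3 : regPow₂ p ε w d e + regPow₂ p ε w (Complex.I * d) (-e) =
      p * (ε ^ 2 / x ^ 3 * (d.re ^ 2 + d.im ^ 2)) *
        ((reg ε w ^ ((p - 1 : ℝ) : ℂ)).re -
          (p - 1) * x * (reg ε w ^ ((p - 2 : ℝ) : ℂ)).re) := by
    have : regPow₂ p ε w d e + regPow₂ p ε w (Complex.I * d) (-e) =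
      ((p : ℂ) * ((p - 1 : ℝ) : ℂ) * reg ε w ^ ((p - 2 : ℝ) : ℂ) *
        (reg₁ ε w d ^ 2 + reg₁ ε w (Complex.I * d) ^ 2) +
      (p : ℂ) * reg ε w ^ ((p - 1 : ℝ) : ℂ) *
        (reg₂ ε w d e + reg₂ ε w (Complex.I * d) (-e))).re := by
      rw [regPow₂, regPow₂, ← Complex.add_re]
      congr 1
      ring
    rw [this, e1, e2]
    simp only [Complex.add_re, Complex.re_mul_ofReal, Complex.re_ofReal_mul, ← Complex.ofReal_mul]
    field_simp
    ring
  rw [e3]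
  have : 0 ≤ p := by linarith
  exact mul_nonneg (by positivity) (by linarith)

end Regularisation

theorem hasDerivAt_intervalIntegral_of_continuousOn {h h' : ℝ → ℝ → ℝ} {U : Set ℝ}
    (hU : IsOpen U) (hc : ContinuousOn (Function.uncurry h) (U ×ˢ Set.univ))
    (hc' : ContinuousOn (Function.uncurry h') (U ×ˢ Set.univ))
    (hd : ∀ s ∈ U, ∀ θ, HasDerivAt (fun s => h s θ) (h' s θ) s) (a b : ℝ) {s : ℝ} (hs : s ∈ U) :
    HasDerivAt (fun s => ∫ θ in a..b, h s θ) (∫ θ in a..b, h' s θ) s := by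
  have hslice : ∀ {g : ℝ → ℝ → ℝ}, ContinuousOn (Function.uncurry g) (U ×ˢ Set.univ) →
      ∀ s ∈ U, Continuous (g s) := fun hg s hs => by
    have := hg.comp (f := fun θ : ℝ => (s, θ)) (s := Set.univ) (by fun_prop)
      (fun θ _ => ⟨hs, trivial⟩)
    exact continuousOn_univ.1 this
  obtain ⟨δ, hδ, hball⟩ := Metric.isOpen_iff.1 hU s hs
  have hcb : Metric.closedBall s (δ / 2) ⊆ U :=
    (Metric.closedBall_subset_ball (by linarith)).trans hball
  obtain ⟨C, hC⟩ := ((isCompact_closedBall s (δ / 2)).prod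
    (isCompact_uIcc (a := a) (b := b))).exists_bound_of_continuousOn
      (hc'.mono (Set.prod_mono hcb (Set.subset_univ _)))
  refine (intervalIntegral.hasDerivAt_integral_of_dominated_loc_of_deriv_le
    (bound := fun _ => C) (Metric.closedBall_mem_nhds s (by positivity : 0 < δ / 2)) ?_
    ((hslice hc s hs).intervalIntegrable _ _) (hslice hc' s hs).aestronglyMeasurable ?_
    intervalIntegrable_const ?_).2
  · filter_upwards [hU.mem_nhds hs] with x hx using (hslice hc x hx).aestronglyMeasurable
  · exact Filter.Eventually.of_forall fun θ hθ x hx =>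
      hC (x, θ) ⟨hx, Set.uIoc_subset_uIcc hθ⟩
  · exact Filter.Eventually.of_forall fun θ _ x hx => hd x (hcb hx) θ

section Disc

variable {p ε : ℝ} {F : ℂ → ℂ}

set_option maxHeartbeats 400000 in
/-- The integral means of `regPow p ε` over circles are nonnegative. -/
theorem integral_regPow_nonneg (hε : 0 < ε) (hp : 1 < p) (hp2 : p ≤ 2)
    (hF : DifferentiableOn ℂ F (Metric.ball 0 1)) (h0 : (F 0).im = 0) {s : ℝ} (hs : s < 0) :
    0 ≤ ∫ θ in (0 : ℝ)..2 * Real.pi, regPow p ε (F (Complex.exp (s + θ * Complex.I))) := by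
  set H : Set ℂ := {z | z.re < 0} with hHdef
  have hH : IsOpen H := isOpen_lt Complex.continuous_re continuous_const
  obtain ⟨G, hG⟩ : ∃ G : ℂ → ℂ, G = fun z => F (Complex.exp z) := ⟨_, rfl⟩
  have hball : ∀ z ∈ H, Complex.exp z ∈ Metric.ball (0 : ℂ) 1 := fun z hz => by
    have : z.re < 0 := hz
    simpa [Complex.norm_exp] using this
  have hGd : DifferentiableOn ℂ G H := hG ▸ hF.comp Complex.differentiable_exp.differentiableOn hball
  obtain ⟨D, hD⟩ : ∃ D, D = deriv G := ⟨_, rfl⟩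
  have hDd : DifferentiableOn ℂ D H := hD ▸ hGd.deriv hH
  obtain ⟨E, hE⟩ : ∃ E, E = deriv D := ⟨_, rfl⟩
  have hEd : DifferentiableOn ℂ E H := hE ▸ hDd.deriv hH
  have hGper : ∀ z, G (z + 2 * Real.pi * Complex.I) = G z := fun z => by
    simp only [hG, Complex.exp_periodic z]
  have hDper : ∀ z, D (z + 2 * Real.pi * Complex.I) = D z := fun z => by
    rw [hD, ← deriv_comp_add_const]
    simp only [hGper]
  obtain ⟨U, hU⟩ : ∃ U : Set ℝ, U = Set.Iio 0 := ⟨_, rfl⟩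
  have hUo : IsOpen U := hU ▸ isOpen_Iio
  have hUc : Convex ℝ U := hU ▸ convex_Iio 0
  have hUi : interior U = U := hUo.interior_eq
  have hUlt : ∀ {s}, s ∈ U → s < 0 := fun h => by simpa [hU] using h
  have hUmem : ∀ {s}, s < 0 → s ∈ U := fun h => by simpa [hU] using h
  have hmem : ∀ s ∈ U, ∀ θ : ℝ, (s + θ * Complex.I : ℂ) ∈ H := fun s hs θ => by
    simpa [hHdef, hU] using hs
  have hcurve : ContinuousOn (fun x : ℝ × ℝ => (x.1 + x.2 * Complex.I : ℂ)) (U ×ˢ Set.univ) := by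
    fun_prop
  have hmaps : Set.MapsTo (fun x : ℝ × ℝ => (x.1 + x.2 * Complex.I : ℂ)) (U ×ˢ Set.univ) H :=
    fun x hx => hmem x.1 hx.1 x.2
  have cG : ContinuousOn (fun x : ℝ × ℝ => G (x.1 + x.2 * Complex.I)) (U ×ˢ Set.univ) :=
    hGd.continuousOn.comp hcurve hmaps
  have cD : ContinuousOn (fun x : ℝ × ℝ => D (x.1 + x.2 * Complex.I)) (U ×ˢ Set.univ) :=
    hDd.continuousOn.comp hcurve hmaps
  have cE : ContinuousOn (fun x : ℝ × ℝ => E (x.1 + x.2 * Complex.I)) (U ×ˢ Set.univ) :=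
    hEd.continuousOn.comp hcurve hmaps
  have c0 : ContinuousOn (Function.uncurry fun s θ : ℝ => regPow p ε (G (s + θ * Complex.I)))
      (U ×ˢ Set.univ) := by
    simpa only [Function.comp_def, Function.uncurry_def] using (continuous_regPow p hε).comp_continuousOn cG
  have c1 : ContinuousOn (Function.uncurry fun s θ : ℝ =>
      regPow₁ p ε (G (s + θ * Complex.I)) (D (s + θ * Complex.I))) (U ×ˢ Set.univ) :=
    by simpa only [Function.comp_def, Function.uncurry_def] using (continuous_regPow₁ p hε).comp_continuousOn (cG.prodMk cD)
  have c2 : ContinuousOn (Function.uncurry fun s θ : ℝ =>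
      regPow₂ p ε (G (s + θ * Complex.I)) (D (s + θ * Complex.I)) (E (s + θ * Complex.I)))
      (U ×ˢ Set.univ) :=
    by simpa only [Function.comp_def, Function.uncurry_def] using
      (continuous_regPow₂ p hε).comp_continuousOn (cG.prodMk (cD.prodMk cE))
  have c3 : ContinuousOn (Function.uncurry fun s θ : ℝ =>
      regPow₂ p ε (G (s + θ * Complex.I)) (Complex.I * D (s + θ * Complex.I))
        (-E (s + θ * Complex.I))) (U ×ˢ Set.univ) :=
    by simpa only [Function.comp_def, Function.uncurry_def, Pi.mul_apply, Pi.neg_apply] using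
      (continuous_regPow₂ p hε).comp_continuousOn (cG.prodMk ((continuousOn_const.mul cD).prodMk cE.neg))
  have slice : ∀ {g : ℝ → ℝ → ℝ}, ContinuousOn (Function.uncurry g) (U ×ˢ Set.univ) →
      ∀ s ∈ U, Continuous (g s) := fun hg s hs =>
    continuousOn_univ.1 (hg.comp (f := fun θ : ℝ => (s, θ)) (s := Set.univ) (by fun_prop)
      (fun θ _ => ⟨hs, trivial⟩))
  have dh : ∀ {K K' : ℂ → ℂ}, K' = deriv K → DifferentiableOn ℂ K H → ∀ s ∈ U, ∀ θ : ℝ,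
      HasDerivAt (fun s : ℝ => K (s + θ * Complex.I)) (K' (s + θ * Complex.I)) s := by
    rintro K _ rfl hK s hs θ
    have h1 := (hK.differentiableAt (hH.mem_nhds (hmem s hs θ))).hasDerivAt
    have h2 : HasDerivAt (fun s : ℝ => (s + θ * Complex.I : ℂ)) 1 s :=
      (Complex.ofRealCLM.hasDerivAt (x := s)).add_const _
    simpa [Function.comp_def] using h1.scomp s h2
  have dv : ∀ {K K' : ℂ → ℂ}, K' = deriv K → DifferentiableOn ℂ K H → ∀ s ∈ U, ∀ θ : ℝ,
      HasDerivAt (fun θ : ℝ => K (s + θ * Complex.I))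
        (Complex.I * K' (s + θ * Complex.I)) θ := by
    rintro K _ rfl hK s hs θ
    have h1 := (hK.differentiableAt (hH.mem_nhds (hmem s hs θ))).hasDerivAt
    have h2 : HasDerivAt (fun θ : ℝ => (s + θ * Complex.I : ℂ)) Complex.I θ := by
      simpa using ((Complex.ofRealCLM.hasDerivAt (x := θ)).mul_const Complex.I).const_add (s : ℂ)
    simpa [Function.comp_def] using h1.scomp θ h2
  obtain ⟨L, hLdef⟩ : ∃ L : ℝ → ℝ, L = fun s : ℝ => ∫ θ in (0 : ℝ)..2 * Real.pi,
    regPow p ε (G (s + θ * Complex.I)) := ⟨_, rfl⟩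
  obtain ⟨L₁, hL₁def⟩ : ∃ L₁ : ℝ → ℝ, L₁ = fun s : ℝ => ∫ θ in (0 : ℝ)..2 * Real.pi,
    regPow₁ p ε (G (s + θ * Complex.I)) (D (s + θ * Complex.I)) := ⟨_, rfl⟩
  have hL : ∀ s ∈ U, HasDerivAt L (L₁ s) s := fun s hs => by
    rw [hLdef, hL₁def]
    exact hasDerivAt_intervalIntegral_of_continuousOn hUo c0 c1
      (fun s hs θ => (dh hD hGd s hs θ).regPow p hε) _ _ hs
  have hL₁ : ∀ s ∈ U, HasDerivAt L₁ (∫ θ in (0 : ℝ)..2 * Real.pi,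
      regPow₂ p ε (G (s + θ * Complex.I)) (D (s + θ * Complex.I)) (E (s + θ * Complex.I))) s :=
    fun s hs => hL₁def ▸ hasDerivAt_intervalIntegral_of_continuousOn hUo c1 c2
      (fun s hs θ => (dh hD hGd s hs θ).regPow₁ p hε (dh hE hDd s hs θ)) _ _ hs
  have hzero : ∀ s ∈ U, ∫ θ in (0 : ℝ)..2 * Real.pi, regPow₂ p ε (G (s + θ * Complex.I))
      (Complex.I * D (s + θ * Complex.I)) (-E (s + θ * Complex.I)) = 0 := by
    intro s hs
    have hd : ∀ θ : ℝ, HasDerivAt (fun θ : ℝ =>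
        regPow₁ p ε (G (s + θ * Complex.I)) (Complex.I * D (s + θ * Complex.I)))
        (regPow₂ p ε (G (s + θ * Complex.I)) (Complex.I * D (s + θ * Complex.I))
          (-E (s + θ * Complex.I))) θ := fun θ => by
      have := (dv hE hDd s hs θ).const_mul Complex.I
      rw [← mul_assoc, Complex.I_mul_I, neg_one_mul] at this
      exact (dv hD hGd s hs θ).regPow₁ p hε this
    rw [intervalIntegral.integral_eq_sub_of_hasDerivAt (fun θ _ => hd θ)
      ((slice c3 s hs).intervalIntegrable _ _)]
    have := hGper (s + (0 : ℝ) * Complex.I)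
    have h' := hDper (s + (0 : ℝ) * Complex.I)
    simp only [Complex.ofReal_zero, zero_mul, add_zero] at this h'
    simp [this, h']
  have hL₂ : ∀ s ∈ U, 0 ≤ ∫ θ in (0 : ℝ)..2 * Real.pi,
      regPow₂ p ε (G (s + θ * Complex.I)) (D (s + θ * Complex.I)) (E (s + θ * Complex.I)) := by
    intro s hs
    have hsum := intervalIntegral.integral_add
      ((slice c2 s hs).intervalIntegrable (μ := volume) 0 (2 * Real.pi))
      ((slice c3 s hs).intervalIntegrable 0 (2 * Real.pi))
    rw [hzero s hs, add_zero] at hsum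
    rw [← hsum]
    exact intervalIntegral.integral_nonneg (by positivity) fun θ _ =>
      regPow₂_add_nonneg hε hp.le hp2 _ _ _
  have mono₁ : MonotoneOn L₁ U := monotoneOn_of_deriv_nonneg hUc
    (fun s hs => (hL₁ s hs).continuousAt.continuousWithinAt)
    (fun s hs => (hL₁ s (interior_subset hs)).differentiableAt.differentiableWithinAt)
    (fun s hs => by rw [(hL₁ s (interior_subset hs)).deriv]; exact hL₂ s (interior_subset hs))
  have bdd : ∀ s₀ ∈ U, ∃ M, ∀ s ≤ s₀, L s ≤ M := by
    intro s₀ hs₀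
    have hsub : Metric.closedBall (0 : ℂ) (Real.exp s₀) ⊆ Metric.ball 0 1 :=
      Metric.closedBall_subset_ball (by simpa using hUlt hs₀)
    obtain ⟨M, hM⟩ := (isCompact_closedBall (0 : ℂ) (Real.exp s₀)).exists_bound_of_continuousOn
      ((continuous_regPow p hε).comp_continuousOn (hF.continuousOn.mono hsub))
    have hM' : ∀ z ∈ Metric.closedBall (0 : ℂ) (Real.exp s₀), regPow p ε (F z) ≤ M :=
      fun z hz => (le_abs_self _).trans (hM z hz)
    refine ⟨∫ θ in (0 : ℝ)..2 * Real.pi, M, fun s hs => ?_⟩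
    have h_int := (slice c0 s (hUmem (hs.trans_lt (hUlt hs₀)))).intervalIntegrable (μ := volume)
      0 (2 * Real.pi)
    simp only [hLdef]
    refine intervalIntegral.integral_mono_on (by positivity) h_int intervalIntegrable_const
      fun θ _ => ?_
    rw [hG]
    refine hM' _ ?_
    simpa [Complex.norm_exp] using hs
  have hL₁nn : ∀ s ∈ U, 0 ≤ L₁ s := by
    intro s₀ hs₀
    by_contra! hneg
    obtain ⟨M, hM⟩ := bdd s₀ hs₀
    have key : ∀ s < s₀, L s₀ + L₁ s₀ * (s - s₀) ≤ L s := by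
      intro s hs
      obtain ⟨c, hc, hc'⟩ := exists_hasDerivAt_eq_slope L L₁ hs
        (fun x hx => (hL x (hUmem (hx.2.trans_lt (hUlt hs₀)))).continuousAt.continuousWithinAt)
        (fun x hx => hL x (hUmem (hx.2.trans (hUlt hs₀))))
      have := mono₁ (hUmem (hc.2.trans (hUlt hs₀))) hs₀ hc.2.le
      rw [hc', div_le_iff₀ (by linarith)] at this
      linarith
    set T := |M - L s₀| + 1 with hT
    have h1 := key (s₀ + T / L₁ s₀) (by
      have : T / L₁ s₀ < 0 := div_neg_of_pos_of_neg (by positivity) hneg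
      linarith)
    have h2 := hM (s₀ + T / L₁ s₀) (by
      have : T / L₁ s₀ < 0 := div_neg_of_pos_of_neg (by positivity) hneg
      linarith)
    have h3 : L₁ s₀ * (s₀ + T / L₁ s₀ - s₀) = T := by
      field_simp [hneg.ne]; ring
    rw [h3] at h1
    have := le_abs_self (M - L s₀)
    linarith
  have mono : MonotoneOn L U := monotoneOn_of_deriv_nonneg hUc
    (fun s hs => (hL s hs).continuousAt.continuousWithinAt)
    (fun s hs => (hL s (interior_subset hs)).differentiableAt.differentiableWithinAt)
    (fun s hs => by rw [(hL s (interior_subset hs)).deriv]; exact hL₁nn s (interior_subset hs))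
  have hpos0 : 0 < regPow p ε (F 0) := by
    have : reg ε (F 0) = (regRe ε (F 0) : ℂ) := by simp [reg, h0]
    rw [regPow, this, ← Complex.ofReal_cpow (regRe_pos hε _).le, Complex.ofReal_re]
    exact Real.rpow_pos_of_pos (regRe_pos hε _) _
  have hcont : ContinuousAt (fun z => regPow p ε (F z)) 0 :=
    ContinuousAt.comp (g := regPow p ε) (f := F) (continuous_regPow p hε).continuousAt
      (hF.continuousOn.continuousAt (Metric.isOpen_ball.mem_nhds (by simp)))
  obtain ⟨δ, hδ, hδ'⟩ := Metric.eventually_nhds_iff_ball.1 (hcont.eventually (lt_mem_nhds hpos0))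
  set s' := min s (Real.log (δ / 2))
  have hs' : s' ∈ U := hUmem ((min_le_left _ _).trans_lt hs)
  have hLs : L s = ∫ θ in (0 : ℝ)..2 * Real.pi,
      regPow p ε (F (Complex.exp (s + θ * Complex.I))) := by rw [hLdef, hG]
  rw [← hLs]
  refine le_trans ?_ (mono hs' (hUmem hs) (min_le_left _ _))
  rw [hLdef, hG]
  refine intervalIntegral.integral_nonneg (by positivity) fun θ _ => (hδ' _ ?_).le
  have h1 : Real.exp s' ≤ δ / 2 :=
    (Real.exp_le_exp.2 (min_le_right _ _)).trans_eq (Real.exp_log (by positivity))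
  simp only [Metric.mem_ball, dist_zero_right, Complex.norm_exp]
  simp
  linarith

/-- Pichorides' inequality on the circle of radius `exp s`. -/
theorem integral_abs_im_rpow_le (hp : 1 < p) (hp2 : p ≤ 2)
    (hF : DifferentiableOn ℂ F (Metric.ball 0 1)) (h0 : (F 0).im = 0) {s : ℝ} (hs : s < 0) :
    ∫ θ in (0 : ℝ)..2 * Real.pi, |(F (Complex.exp (s + θ * Complex.I))).im| ^ p ≤
      Real.tan (Real.pi / (2 * p)) ^ p *
        ∫ θ in (0 : ℝ)..2 * Real.pi, |(F (Complex.exp (s + θ * Complex.I))).re| ^ p := by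
  have hp0 : 0 ≤ p := by linarith
  set w : ℝ → ℂ := fun θ => F (Complex.exp (s + θ * Complex.I)) with hw
  have hwc : Continuous w := by
    refine continuousOn_univ.1 (hF.continuousOn.comp (s := Set.univ)
      (f := fun θ : ℝ => Complex.exp (s + θ * Complex.I)) (by fun_prop) fun θ _ => ?_)
    simp only [Metric.mem_ball, dist_zero_right, Complex.norm_exp]
    simpa using hs
  have hre : Continuous fun θ => (w θ).re := Complex.continuous_re.comp hwc
  have him : Continuous fun θ => (w θ).im := Complex.continuous_im.comp hwc
  have cim : Continuous fun θ => |(w θ).im| ^ p :=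
    him.abs.rpow_const fun _ => Or.inr hp0
  set c := Real.tan (Real.pi / (2 * p)) ^ p
  set b := Real.sin (Real.pi / (2 * p)) ^ (p - 1) / Real.cos (Real.pi / (2 * p)) with hb
  have hang : 0 < Real.pi / (2 * p) := by positivity
  have hang' : Real.pi / (2 * p) < Real.pi / 2 := by
    gcongr; linarith
  have hb0 : 0 ≤ b := div_nonneg
    (Real.rpow_nonneg (Real.sin_nonneg_of_nonneg_of_le_pi hang.le (by linarith [Real.pi_pos])) _)
    (Real.cos_nonneg_of_neg_pi_div_two_le_of_le (by linarith) hang'.le)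
  have step : ∀ ε > 0, ∫ θ in (0 : ℝ)..2 * Real.pi, |(w θ).im| ^ p ≤
      c * ∫ θ in (0 : ℝ)..2 * Real.pi, regRe ε (w θ) ^ p := by
    intro ε hε
    have cre : Continuous fun θ => regRe ε (w θ) ^ p :=
      ((continuous_regRe ε).comp hwc).rpow_const fun _ => Or.inr hp0
    have creg : Continuous fun θ => regPow p ε (w θ) := (continuous_regPow p hε).comp hwc
    have h1 : ∫ θ in (0 : ℝ)..2 * Real.pi, |(w θ).im| ^ p ≤
        ∫ θ in (0 : ℝ)..2 * Real.pi, (c * regRe ε (w θ) ^ p - b * regPow p ε (w θ)) := by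
      refine intervalIntegral.integral_mono_on (by positivity) (cim.intervalIntegrable _ _)
        (((cre.const_mul c).sub (creg.const_mul b)).intervalIntegrable _ _) fun θ _ => ?_
      have := pichorides_halfPlane hp hp2 (z := reg ε (w θ)) (by simpa using regRe_pos hε _)
      rw [reg_re, reg_im] at this
      exact this
    rw [intervalIntegral.integral_sub ((cre.const_mul c).intervalIntegrable _ _)
      ((creg.const_mul b).intervalIntegrable _ _), intervalIntegral.integral_const_mul,
      intervalIntegral.integral_const_mul] at h1
    have h2 := mul_nonneg hb0 (integral_regPow_nonneg hε hp hp2 hF h0 hs)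
    simp only [hw] at h1 ⊢
    linarith
  have hcont : Continuous fun ε : ℝ => c * ∫ θ in (0 : ℝ)..2 * Real.pi, regRe ε (w θ) ^ p := by
    refine continuous_const.mul
      (intervalIntegral.continuous_parametric_intervalIntegral_of_continuous' ?_ _ _)
    have : Continuous fun x : ℝ × ℝ => regRe x.1 (w x.2) := by
      unfold regRe
      have := hre.comp (continuous_snd (X := ℝ) (Y := ℝ))
      simp only [Function.comp_def] at this
      fun_prop
    exact this.rpow_const fun _ => Or.inr hp0
  have hlim := ge_of_tendsto (hcont.continuousWithinAt (s := Set.Ioi 0) (x := 0)).tendsto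
    (eventually_mem_nhdsWithin.mono fun ε hε => step ε hε)
  simpa [regRe, Real.sqrt_sq_eq_abs] using hlim

end Disc

section BernoulliWeight

open Filter Topology

/-- The function `t / (1 - e⁻ᵗ)`. -/
def bern (t : ℝ) : ℝ := t / (1 - Real.exp (-t))

/-- The derivative of `bern`. -/
def bern₁ (t : ℝ) : ℝ :=
  (1 - Real.exp (-t) - t * Real.exp (-t)) / (1 - Real.exp (-t)) ^ 2

/-- The second derivative of `bern`. -/
def bern₂ (t : ℝ) : ℝ :=
  Real.exp (-t) * (t * (1 + Real.exp (-t)) - 2 * (1 - Real.exp (-t))) / (1 - Real.exp (-t)) ^ 3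

theorem one_sub_exp_neg_pos {t : ℝ} (ht : 0 < t) : 0 < 1 - Real.exp (-t) := by
  have : Real.exp (-t) < 1 := by simpa using ht
  linarith

theorem hasDerivAt_exp_neg (t : ℝ) : HasDerivAt (fun t => Real.exp (-t)) (-Real.exp (-t)) t := by
  simpa using (hasDerivAt_neg t).exp

theorem hasDerivAt_bern {t : ℝ} (ht : 0 < t) : HasDerivAt bern (bern₁ t) t := by
  have h := one_sub_exp_neg_pos ht
  refine ((hasDerivAt_id t).div ((hasDerivAt_exp_neg t).const_sub 1) h.ne').congr_deriv ?_
  rw [bern₁]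
  simp

theorem hasDerivAt_bern₁ {t : ℝ} (ht : 0 < t) : HasDerivAt bern₁ (bern₂ t) t := by
  have h := one_sub_exp_neg_pos ht
  have h1 := (hasDerivAt_exp_neg t).const_sub 1
  refine ((h1.sub ((hasDerivAt_id t).mul (hasDerivAt_exp_neg t))).div (h1.pow 2)
    (pow_pos h 2).ne').congr_deriv ?_
  rw [bern₂]
  simp only [Pi.mul_apply, Pi.sub_apply, Pi.pow_apply, id]
  have := h.ne'
  field_simp
  push_cast
  ring

theorem bern₂_nonneg {t : ℝ} (ht : 0 < t) : 0 ≤ bern₂ t := by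
  have h := one_sub_exp_neg_pos ht
  refine div_nonneg (mul_nonneg (Real.exp_pos _).le ?_) (by positivity)
  have hd : ∀ t : ℝ, HasDerivAt
      (fun t => t * (1 + Real.exp (-t)) - 2 * (1 - Real.exp (-t)))
      (1 - Real.exp (-t) - t * Real.exp (-t)) t := fun t => by
    refine (((hasDerivAt_id t).mul ((hasDerivAt_exp_neg t).const_add 1)).sub
      (((hasDerivAt_exp_neg t).const_sub 1).const_mul 2)).congr_deriv ?_
    simp only [id]
    ring
  have hmono : MonotoneOn (fun t : ℝ => t * (1 + Real.exp (-t)) - 2 * (1 - Real.exp (-t)))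
      (Set.Ici 0) := by
    refine monotoneOn_of_deriv_nonneg (convex_Ici 0)
      (fun t _ => (hd t).continuousAt.continuousWithinAt)
      (fun t _ => (hd t).differentiableAt.differentiableWithinAt) fun t _ => ?_
    rw [(hd t).deriv]
    have h1 := mul_le_mul_of_nonneg_right (Real.add_one_le_exp t) (Real.exp_pos (-t)).le
    rw [← Real.exp_add, add_neg_cancel, Real.exp_zero] at h1
    linarith
  simpa using hmono Set.self_mem_Ici ht.le ht.le

theorem bern_le {t : ℝ} (ht : 0 < t) : bern t ≤ 1 + t := by
  rw [bern, div_le_iff₀ (one_sub_exp_neg_pos ht)]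
  have h1 := mul_le_mul_of_nonneg_right (Real.add_one_le_exp t) (Real.exp_pos (-t)).le
  rw [← Real.exp_add, add_neg_cancel, Real.exp_zero] at h1
  linarith

theorem bern_nonneg {t : ℝ} (ht : 0 < t) : 0 ≤ bern t :=
  div_nonneg ht.le (one_sub_exp_neg_pos ht).le

theorem tendsto_one_sub_exp_neg_div :
    Tendsto (fun t : ℝ => (1 - Real.exp (-t)) / t) (𝓝[>] 0) (𝓝 1) := by
  have h := (hasDerivAt_exp_neg 0).const_sub 1
  rw [hasDerivAt_iff_tendsto_slope] at h
  have := h.mono_left (nhdsWithin_mono 0 fun x (hx : x ∈ Set.Ioi 0) => ne_of_gt hx)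
  refine (this.congr fun t => ?_).trans (by simp)
  simp [slope_def_field]

theorem tendsto_bern_zero : Tendsto bern (𝓝[>] 0) (𝓝 1) := by
  have := tendsto_one_sub_exp_neg_div.inv₀ one_ne_zero
  unfold bern
  simpa using this

theorem tendsto_bern₁_zero : Tendsto bern₁ (𝓝[>] 0) (𝓝 (1 / 2)) := by
  have h1 : Tendsto (fun t : ℝ => (1 - Real.exp (-t) - t * Real.exp (-t)) / t ^ 2) (𝓝[>] 0)
      (𝓝 (1 / 2)) := by
    have key : ∀ᶠ t : ℝ in 𝓝[>] 0,
        |(1 - Real.exp (-t) - t * Real.exp (-t)) / t ^ 2 - 1 / 2| ≤ 2 * t := by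
      filter_upwards [Ioo_mem_nhdsGT (zero_lt_one (α := ℝ))] with t ht
      have hb := Real.exp_bound (x := -t) (by rw [abs_neg, abs_of_pos ht.1]; exact ht.2.le)
        (n := 3) (by norm_num)
      simp only [Finset.sum_range_succ, Finset.sum_range_zero] at hb
      norm_num [Nat.factorial, abs_of_pos ht.1] at hb
      have ht0 := ht.1
      obtain ⟨e, he⟩ : ∃ e, e = Real.exp (-t) - (1 + -t + t ^ 2 / 2) := ⟨_, rfl⟩
      rw [← he] at hb
      have hE : Real.exp (-t) = 1 + -t + t ^ 2 / 2 + e := by rw [he]; ring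
      rw [hE]
      have : (1 - (1 + -t + t ^ 2 / 2 + e) - t * (1 + -t + t ^ 2 / 2 + e)) / t ^ 2 - 1 / 2 =
          -(t / 2 + (1 + t) * e / t ^ 2) := by
        field_simp
        ring
      rw [this, abs_neg]
      refine (abs_add_le _ _).trans ?_
      rw [abs_div, abs_div, abs_mul, abs_of_pos ht0, abs_of_pos (by linarith : 0 < 1 + t),
        abs_of_pos (by positivity : 0 < t ^ 2), abs_of_pos (zero_lt_two (α := ℝ))]
      have : (1 + t) * |e| / t ^ 2 ≤ t := by
        rw [div_le_iff₀ (by positivity)]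
        have : (1 + t) * |e| ≤ 2 * (t ^ 3 * (2 / 9)) := by
          gcongr
          linarith [ht.2]
        nlinarith [pow_pos ht0 3]
      linarith
    rw [tendsto_iff_norm_sub_tendsto_zero]
    refine squeeze_zero' (Eventually.of_forall fun _ => norm_nonneg _) key ?_
    have : Tendsto (fun t : ℝ => 2 * t) (𝓝 0) (𝓝 (2 * 0)) := tendsto_id.const_mul 2
    rw [mul_zero] at this
    exact this.mono_left nhdsWithin_le_nhds
  have h2 := h1.div (tendsto_one_sub_exp_neg_div.pow 2) (by norm_num)
  simp only [one_pow, div_one] at h2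
  refine h2.congr' ?_
  filter_upwards [self_mem_nhdsWithin] with t ht
  have ht0 : t ≠ 0 := ne_of_gt ht
  have := (one_sub_exp_neg_pos ht).ne'
  simp only [Pi.div_apply, bern₁]
  field_simp

theorem tendsto_mul_exp_neg_mul {y : ℝ} (hy : 0 < y) :
    Tendsto (fun t : ℝ => t * Real.exp (-(y * t))) atTop (𝓝 0) := by
  have h := (Real.tendsto_pow_mul_exp_neg_atTop_nhds_zero 1).comp
    (tendsto_id.const_mul_atTop hy)
  have := h.const_mul y⁻¹
  simp only [mul_zero] at this
  refine this.congr fun t => ?_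
  simp only [Function.comp, id, pow_one]
  field_simp

theorem tendsto_exp_neg_mul {y : ℝ} (hy : 0 < y) :
    Tendsto (fun t : ℝ => Real.exp (-(y * t))) atTop (𝓝 0) :=
  Real.tendsto_exp_neg_atTop_nhds_zero.comp (tendsto_id.const_mul_atTop hy)

theorem tendsto_bern₁_atTop : Tendsto bern₁ atTop (𝓝 1) := by
  have h1 : Tendsto (fun t : ℝ => Real.exp (-t)) atTop (𝓝 0) :=
    Real.tendsto_exp_neg_atTop_nhds_zero
  have h2 : Tendsto (fun t : ℝ => t * Real.exp (-t)) atTop (𝓝 0) := by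
    simpa using tendsto_mul_exp_neg_mul one_pos
  have h3 := h1.const_sub 1
  have := (h3.sub h2).div (h3.pow 2) (by norm_num)
  unfold bern₁
  simpa [Pi.div_def] using this

theorem hasDerivAt_exp_neg_mul (y t : ℝ) :
    HasDerivAt (fun t => Real.exp (-(y * t))) (-y * Real.exp (-(y * t))) t := by
  have := (((hasDerivAt_id t).const_mul y).neg).exp
  simp only [id, mul_one] at this
  rw [mul_comm] at this
  exact this

theorem integrableOn_mul_exp_neg_mul {y : ℝ} (hy : 0 < y) :
    IntegrableOn (fun t : ℝ => t * Real.exp (-(y * t))) (Set.Ioi 0) ∧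
      ∫ t in Set.Ioi 0, t * Real.exp (-(y * t)) = 1 / y ^ 2 := by
  have hd : ∀ t ∈ Set.Ici (0 : ℝ), HasDerivAt
      (fun t => -(1 / y) * (t * Real.exp (-(y * t))) - 1 / y ^ 2 * Real.exp (-(y * t)))
      (t * Real.exp (-(y * t))) t := fun t _ => by
    refine ((((hasDerivAt_id t).mul (hasDerivAt_exp_neg_mul y t)).const_mul _).sub
      ((hasDerivAt_exp_neg_mul y t).const_mul _)).congr_deriv ?_
    simp only [id]
    field_simp
    ring
  have hlim := ((tendsto_mul_exp_neg_mul hy).const_mul (-(1 / y))).sub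
    ((tendsto_exp_neg_mul hy).const_mul (1 / y ^ 2))
  simp only [mul_zero, sub_zero] at hlim
  have hpos : ∀ t ∈ Set.Ioi (0 : ℝ), 0 ≤ t * Real.exp (-(y * t)) := fun t ht =>
    mul_nonneg (le_of_lt ht) (Real.exp_pos _).le
  refine ⟨integrableOn_Ioi_deriv_of_nonneg' hd hpos hlim, ?_⟩
  rw [integral_Ioi_of_hasDerivAt_of_nonneg' hd hpos hlim]
  simp

theorem integral_Ioi_of_tendsto {g g' : ℝ → ℝ} {l m : ℝ}
    (hg : ∀ t, 0 < t → HasDerivAt g (g' t) t) (hl : Tendsto g (𝓝[>] 0) (𝓝 l))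
    (hm : Tendsto g atTop (𝓝 m)) :
    ((∀ t, 0 < t → 0 ≤ g' t) → IntegrableOn g' (Set.Ioi 0)) ∧
      (IntegrableOn g' (Set.Ioi 0) → ∫ t in Set.Ioi 0, g' t = m - l) := by
  have hc : ContinuousWithinAt (Function.update g 0 l) (Set.Ici 0) 0 := by
    rw [continuousWithinAt_update_same]
    simpa using hl
  have hd : ∀ t ∈ Set.Ioi (0 : ℝ), HasDerivAt (Function.update g 0 l) (g' t) t := fun t ht =>
    (hg t ht).congr_of_eventuallyEq ((eventually_ne_nhds (ne_of_gt ht)).mono fun s hs =>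
      Function.update_of_ne hs _ _)
  have hm' : Tendsto (Function.update g 0 l) atTop (𝓝 m) :=
    hm.congr' ((eventually_ne_atTop 0).mono fun s hs => (Function.update_of_ne hs _ _).symm)
  refine ⟨fun h => integrableOn_Ioi_deriv_of_nonneg hc hd h hm', fun h => ?_⟩
  rw [integral_Ioi_of_hasDerivAt_of_tendsto hc hd h hm', Function.update_self]

theorem integrableOn_bern₂ : IntegrableOn bern₂ (Set.Ioi 0) :=
  (integral_Ioi_of_tendsto (fun _ ht => hasDerivAt_bern₁ ht) tendsto_bern₁_zero
    tendsto_bern₁_atTop).1 fun _ ht => bern₂_nonneg ht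

theorem integral_bern₂ : ∫ t in Set.Ioi 0, bern₂ t = 1 / 2 := by
  rw [(integral_Ioi_of_tendsto (fun _ ht => hasDerivAt_bern₁ ht) tendsto_bern₁_zero
    tendsto_bern₁_atTop).2 integrableOn_bern₂]
  norm_num

/-- The trigamma function `∑ 1 / (y + i) ^ 2`, as the Laplace transform of `bern`. -/
def trigamma (y : ℝ) : ℝ := ∫ t in Set.Ioi 0, bern t * Real.exp (-(y * t))

theorem integrableOn_bern_mul_exp {y : ℝ} (hy : 0 < y) :
    IntegrableOn (fun t => bern t * Real.exp (-(y * t))) (Set.Ioi 0) := by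
  have h1 : IntegrableOn (fun t : ℝ => (1 + t) * Real.exp (-(y * t))) (Set.Ioi 0) := by
    have := (exp_neg_integrableOn_Ioi 0 hy).add (integrableOn_mul_exp_neg_mul hy).1
    refine this.congr_fun (fun t _ => ?_) measurableSet_Ioi
    simp only [Pi.add_apply, neg_mul]
    ring
  refine Integrable.mono' h1 ?_ ?_
  · have : Measurable bern := by unfold bern; fun_prop
    exact (by fun_prop : Measurable fun t => bern t * Real.exp (-(y * t))).aestronglyMeasurable
  · refine (ae_restrict_mem measurableSet_Ioi).mono fun t ht => ?_
    rw [Real.norm_of_nonneg (mul_nonneg (bern_nonneg ht) (Real.exp_pos _).le)]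
    exact mul_le_mul_of_nonneg_right (bern_le ht) (Real.exp_pos _).le

theorem integrableOn_bern₂_mul_exp {y : ℝ} (hy : 0 < y) :
    IntegrableOn (fun t => bern₂ t * Real.exp (-(y * t))) (Set.Ioi 0) := by
  refine Integrable.mono integrableOn_bern₂ ?_ ?_
  · have : Measurable bern₂ := by unfold bern₂; fun_prop
    exact (by fun_prop : Measurable fun t => bern₂ t * Real.exp (-(y * t))).aestronglyMeasurable
  · refine (ae_restrict_mem measurableSet_Ioi).mono fun t ht => ?_
    rw [norm_mul, Real.norm_of_nonneg (Real.exp_pos _).le]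
    refine mul_le_of_le_one_right (norm_nonneg _) ?_
    have : 0 < y * t := mul_pos hy ht
    simpa using this.le

theorem integral_bern₂_mul_exp {y : ℝ} (hy : 0 < y) :
    ∫ t in Set.Ioi 0, bern₂ t * Real.exp (-(y * t)) = y ^ 2 * trigamma y - 1 / 2 - y := by
  have hd : ∀ t, 0 < t → HasDerivAt (fun t => (bern₁ t + y * bern t) * Real.exp (-(y * t)))
      (bern₂ t * Real.exp (-(y * t)) - y ^ 2 * (bern t * Real.exp (-(y * t)))) t := by
    intro t ht
    refine (((hasDerivAt_bern₁ ht).add ((hasDerivAt_bern ht).const_mul y)).mul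
      (hasDerivAt_exp_neg_mul y t)).congr_deriv ?_
    simp only [Pi.add_apply]
    ring
  have hexp0 : Tendsto (fun t : ℝ => Real.exp (-(y * t))) (𝓝[>] 0) (𝓝 1) := by
    have : Continuous fun t : ℝ => Real.exp (-(y * t)) := by fun_prop
    have := (this.tendsto 0).mono_left (nhdsWithin_le_nhds (s := Set.Ioi 0))
    simpa using this
  have h0 := (tendsto_bern₁_zero.add (tendsto_bern_zero.const_mul y)).mul hexp0
  have hinf : Tendsto (fun t => (bern₁ t + y * bern t) * Real.exp (-(y * t))) atTop (𝓝 0) := by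
    have h1 := tendsto_bern₁_atTop.mul (tendsto_exp_neg_mul hy)
    have h2 : Tendsto (fun t => bern t * Real.exp (-(y * t))) atTop (𝓝 0) := by
      have h3 := (Real.tendsto_exp_neg_atTop_nhds_zero.const_sub 1).inv₀ (by norm_num)
      have := (tendsto_mul_exp_neg_mul hy).mul h3
      simp only [zero_mul] at this
      refine this.congr fun t => ?_
      rw [bern]
      ring
    have := h1.add (h2.const_mul y)
    simp only [mul_zero, add_zero] at this
    exact this.congr fun t => by ring
  have hi1 := integrableOn_bern₂_mul_exp hy
  have hi2 := (integrableOn_bern_mul_exp hy).const_mul (y ^ 2)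
  have := (integral_Ioi_of_tendsto hd h0 hinf).2 (hi1.sub hi2)
  rw [integral_sub hi1 hi2, integral_const_mul] at this
  rw [trigamma]
  linarith

theorem trigamma_sub {y : ℝ} (hy : 0 < y) : trigamma y - trigamma (y + 1) = 1 / y ^ 2 := by
  rw [trigamma, trigamma, ← integral_sub (integrableOn_bern_mul_exp hy)
    (integrableOn_bern_mul_exp (by linarith)), ← (integrableOn_mul_exp_neg_mul hy).2]
  refine setIntegral_congr_fun measurableSet_Ioi fun t ht => ?_
  have := (one_sub_exp_neg_pos ht).ne'
  simp only [bern]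
  rw [show -((y + 1) * t) = -(y * t) + -t by ring, Real.exp_add]
  field_simp

theorem integral_bern₂_mul_exp_mem {y : ℝ} (hy : 0 < y) :
    y ^ 2 * trigamma y - 1 / 2 - y ∈ Set.Icc (0 : ℝ) (1 / 2) := by
  rw [← integral_bern₂_mul_exp hy]
  constructor
  · exact setIntegral_nonneg measurableSet_Ioi fun t ht =>
      mul_nonneg (bern₂_nonneg ht) (Real.exp_pos _).le
  · rw [← integral_bern₂]
    refine setIntegral_mono_on (integrableOn_bern₂_mul_exp hy) integrableOn_bern₂
      measurableSet_Ioi fun t ht => mul_le_of_le_one_right (bern₂_nonneg ht) ?_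
    have : 0 < y * t := mul_pos hy ht
    simpa using this.le

theorem tendsto_trigamma_atTop : Tendsto trigamma atTop (𝓝 0) := by
  have h : Tendsto (fun y : ℝ => (1 + y) / y ^ 2) atTop (𝓝 0) := by
    have h1 : Tendsto (fun y : ℝ => y⁻¹) atTop (𝓝 0) := tendsto_inv_atTop_zero
    have := (h1.pow 2).add h1
    simp only [ne_eq, OfNat.ofNat_ne_zero, not_false_eq_true, zero_pow, add_zero] at this
    refine this.congr' ((eventually_ne_atTop 0).mono fun y hy => ?_)
    field_simp
  refine squeeze_zero' ?_ ?_ h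
  · exact (eventually_gt_atTop 0).mono fun y _ => setIntegral_nonneg measurableSet_Ioi
      fun t ht => mul_nonneg (bern_nonneg ht) (Real.exp_pos _).le
  · refine (eventually_gt_atTop 0).mono fun y hy => ?_
    rw [le_div_iff₀ (by positivity)]
    linarith [(integral_bern₂_mul_exp_mem hy).2]

theorem hasSum_trigamma {y : ℝ} (hy : 0 < y) :
    HasSum (fun i : ℕ => 1 / (y + i) ^ 2) (trigamma y) := by
  rw [hasSum_iff_tendsto_nat_of_nonneg fun i => by positivity]
  have hs : ∀ n : ℕ, ∑ i ∈ Finset.range n, 1 / (y + i) ^ 2 = trigamma y - trigamma (y + n) := by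
    intro n
    induction n with
    | zero => simp
    | succ n ih =>
      rw [Finset.sum_range_succ, ih, ← trigamma_sub (by positivity)]
      push_cast
      rw [add_assoc]
      ring
  have := (tendsto_trigamma_atTop.comp
    (tendsto_atTop_add_const_left _ y tendsto_natCast_atTop_atTop)).const_sub (trigamma y)
  rw [sub_zero] at this
  exact this.congr fun n => (hs n).symm

end BernoulliWeight

theorem trigamma_reflection {x : ℝ} (h0 : 0 < x) (h1 : x < 1) :
    trigamma x + trigamma (1 - x) = Real.pi ^ 2 / Real.sin (Real.pi * x) ^ 2 := by
  have hsin : 0 < Real.sin (Real.pi * x) :=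
    Real.sin_pos_of_pos_of_lt_pi (by positivity) (by nlinarith [Real.pi_pos])
  have hne : ∀ n : ℤ, x - n ≠ 0 := fun n h => by
    have hx : x = n := by linarith
    rw [hx] at h0 h1
    have h0' : 0 < n := by exact_mod_cast h0
    have h1' : n < 1 := by exact_mod_cast h1
    omega
  have hcont : Continuous fun t : ℝ => Complex.exp (2 * Real.pi * x * Complex.I * t) := by fun_prop
  have hL2 : MemLp (fun t : ℝ => Complex.exp (2 * Real.pi * x * Complex.I * t)) 2
      (volume.restrict (Set.Ioc 0 1)) := by
    refine MemLp.of_bound hcont.aestronglyMeasurable 1 (Filter.Eventually.of_forall fun t => ?_)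
    simp [Complex.norm_exp]
  have hP := hasSum_sq_fourierCoeffOn zero_lt_one hL2
  have hcoef : ∀ n : ℤ, ‖fourierCoeffOn zero_lt_one
      (fun t : ℝ => Complex.exp (2 * Real.pi * x * Complex.I * t)) n‖ ^ 2 =
      Real.sin (Real.pi * x) ^ 2 / Real.pi ^ 2 * (1 / (x - n) ^ 2) := by
    intro n
    have hc : (2 * Real.pi * (x - n) * Complex.I : ℂ) ≠ 0 := by
      have : ((x - n : ℝ) : ℂ) ≠ 0 := Complex.ofReal_ne_zero.2 (hne n)
      push_cast at this
      simp [this, Real.pi_ne_zero]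
    have h_int : fourierCoeffOn zero_lt_one
        (fun t : ℝ => Complex.exp (2 * Real.pi * x * Complex.I * t)) n =
        (Complex.exp (2 * Real.pi * (x - n) * Complex.I) - 1) /
          (2 * Real.pi * (x - n) * Complex.I) := by
      rw [fourierCoeffOn_eq_integral]
      have : ∀ t : ℝ, fourier (-n) (t : AddCircle ((1 : ℝ) - 0)) •
          Complex.exp (2 * Real.pi * x * Complex.I * t) =
          Complex.exp (2 * Real.pi * (x - n) * Complex.I * t) := fun t => by
        rw [fourier_coe_apply, smul_eq_mul, ← Complex.exp_add]
        congr 1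
        push_cast
        ring
      simp only [this]
      rw [integral_exp_mul_complex hc]
      simp
    have hexp : Complex.exp (2 * Real.pi * (x - n) * Complex.I) =
        Complex.exp (Complex.I * ((2 * (Real.pi * x) : ℝ) : ℂ)) := by
      rw [Complex.exp_eq_exp_iff_exists_int]
      exact ⟨-n, by push_cast; ring⟩
    rw [h_int, hexp, norm_div, Complex.norm_exp_I_mul_ofReal_sub_one,
      mul_div_cancel_left₀ _ (two_ne_zero' ℝ), div_pow, Real.norm_eq_abs, sq_abs]
    have : ‖(2 * Real.pi * (x - n) * Complex.I : ℂ)‖ ^ 2 = 4 * Real.pi ^ 2 * (x - n) ^ 2 := by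
      have : (2 * Real.pi * (x - n) * Complex.I : ℂ) =
          ((2 * Real.pi * (x - n) : ℝ) : ℂ) * Complex.I := by push_cast; ring
      rw [this, norm_mul, Complex.norm_I, mul_one, Complex.norm_real, Real.norm_eq_abs, sq_abs]
      ring
    rw [this]
    have := hne n
    field_simp
    ring
  simp only [hcoef] at hP
  have hval : ((1 : ℝ) - 0)⁻¹ • ∫ t in (0 : ℝ)..1,
      ‖Complex.exp (2 * Real.pi * x * Complex.I * t)‖ ^ 2 = 1 := by
    simp [Complex.norm_exp]
  rw [hval] at hP
  have hA : HasSum (fun n : ℕ => 1 / (x - ((-n : ℤ) : ℝ)) ^ 2) (trigamma x) := by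
    simpa using hasSum_trigamma h0
  have hB : HasSum (fun n : ℕ => 1 / (x - ((-(-((n : ℤ) + 1)) : ℤ) : ℝ)) ^ 2)
      (trigamma (1 - x)) := by
    refine (hasSum_trigamma (by linarith : 0 < 1 - x)).congr_fun fun n => ?_
    push_cast
    ring_nf
  have hZ := HasSum.of_nat_of_neg_add_one (f := fun n : ℤ => 1 / (x - ((-n : ℤ) : ℝ)) ^ 2) hA hB
  have hZ' := ((Equiv.neg ℤ).hasSum_iff (f := fun n : ℤ => 1 / (x - (n : ℝ)) ^ 2)).1 hZ
  have := (hZ'.mul_left (Real.sin (Real.pi * x) ^ 2 / Real.pi ^ 2)).unique hP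
  field_simp at this ⊢
  linarith

/-- The holomorphic function on the unit disc whose real part is the harmonic extension of the
indicator of the arc between the angles `a` and `b`. -/
def arcKernel (a b : ℝ) (z : ℂ) : ℂ :=
  (((b - a) / (2 * Real.pi) : ℝ) : ℂ) +
    (Complex.log (1 - z * Complex.exp (-(b * Complex.I))) -
      Complex.log (1 - z * Complex.exp (-(a * Complex.I)))) / (Real.pi * Complex.I)

theorem norm_mul_exp_neg_mul_I (z : ℂ) (φ : ℝ) :
    ‖z * Complex.exp (-(φ * Complex.I))‖ = ‖z‖ := by
  rw [norm_mul, Complex.norm_exp]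
  simp

theorem one_sub_mul_exp_mem_slitPlane {z : ℂ} (hz : ‖z‖ < 1) (φ : ℝ) :
    1 - z * Complex.exp (-(φ * Complex.I)) ∈ Complex.slitPlane := by
  left
  have h := Complex.re_le_norm (z * Complex.exp (-(φ * Complex.I)))
  rw [norm_mul_exp_neg_mul_I] at h
  rw [Complex.sub_re, Complex.one_re]
  linarith

theorem differentiableOn_arcKernel (a b : ℝ) :
    DifferentiableOn ℂ (arcKernel a b) (Metric.ball 0 1) := by
  intro z hz
  have hz' : ‖z‖ < 1 := by simpa using hz
  have h : ∀ φ : ℝ, DifferentiableAt ℂ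
      (fun z => Complex.log (1 - z * Complex.exp (-(φ * Complex.I)))) z := fun φ =>
    DifferentiableAt.clog (by fun_prop) (one_sub_mul_exp_mem_slitPlane hz' φ)
  exact ((((h b).sub (h a)).div_const _).const_add _).differentiableWithinAt

theorem arcKernel_zero (a b : ℝ) : arcKernel a b 0 = (((b - a) / (2 * Real.pi) : ℝ) : ℂ) := by
  simp [arcKernel]

theorem arcKernel_add (a b c : ℝ) (z : ℂ) :
    arcKernel a b z + arcKernel b c z = arcKernel a c z := by
  simp only [arcKernel]
  push_cast
  ring

theorem arcKernel_two_pi (z : ℂ) : arcKernel 0 (2 * Real.pi) z = 1 := by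
  have h : Complex.exp (-(((2 * Real.pi : ℝ) : ℂ) * Complex.I)) = 1 := by
    rw [Complex.exp_neg]
    push_cast
    rw [Complex.exp_two_pi_mul_I, inv_one]
  rw [arcKernel, h]
  simp [Real.pi_ne_zero]

theorem arcKernel_eq_integral {z : ℂ} (hz : ‖z‖ < 1) (a b : ℝ) :
    arcKernel a b z = ∫ φ in a..b, (1 + z * Complex.exp (-(φ * Complex.I))) /
      (1 - z * Complex.exp (-(φ * Complex.I))) / (2 * Real.pi) := by
  have hne : ∀ φ : ℝ, 1 - z * Complex.exp (-(φ * Complex.I)) ≠ 0 := fun φ =>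
    Complex.slitPlane_ne_zero (one_sub_mul_exp_mem_slitPlane hz φ)
  have hder : ∀ φ : ℝ, HasDerivAt (fun φ : ℝ => ((φ / (2 * Real.pi) : ℝ) : ℂ) +
      Complex.log (1 - z * Complex.exp (-(φ * Complex.I))) / (Real.pi * Complex.I))
      ((1 + z * Complex.exp (-(φ * Complex.I))) /
      (1 - z * Complex.exp (-(φ * Complex.I))) / (2 * Real.pi)) φ := by
    intro φ
    have h1 : HasDerivAt (fun φ : ℝ => ((φ / (2 * Real.pi) : ℝ) : ℂ))
        ((1 / (2 * Real.pi) : ℝ) : ℂ) φ := ((hasDerivAt_id φ).div_const _).ofReal_comp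
    have h2 : HasDerivAt (fun φ : ℝ => -((φ : ℂ) * Complex.I)) (-(1 * Complex.I)) φ :=
      (((hasDerivAt_id φ).ofReal_comp).mul_const Complex.I).neg
    have h3 := (((h2.cexp.const_mul z).const_sub 1).clog_real
      (one_sub_mul_exp_mem_slitPlane hz φ)).div_const (Real.pi * Complex.I)
    refine (h1.add h3).congr_deriv ?_
    have := hne φ
    have hpi : (Real.pi : ℂ) ≠ 0 := by simp [Real.pi_ne_zero]
    have hI := Complex.I_ne_zero
    push_cast
    field_simp
    ring
  rw [intervalIntegral.integral_eq_sub_of_hasDerivAt (fun φ _ => hder φ)]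
  · rw [arcKernel]
    push_cast
    ring
  · refine (Continuous.div_const (Continuous.div (by fun_prop) (by fun_prop) hne)
      _).intervalIntegrable _ _

theorem arcKernel_re_nonneg {z : ℂ} (hz : ‖z‖ < 1) {a b : ℝ} (hab : a ≤ b) :
    0 ≤ (arcKernel a b z).re := by
  have hne : ∀ φ : ℝ, 1 - z * Complex.exp (-(φ * Complex.I)) ≠ 0 := fun φ =>
    Complex.slitPlane_ne_zero (one_sub_mul_exp_mem_slitPlane hz φ)
  rw [arcKernel_eq_integral hz, ← Complex.reCLM_apply,
    ← ContinuousLinearMap.intervalIntegral_comp_comm]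
  · refine intervalIntegral.integral_nonneg hab fun φ _ => ?_
    have hn := norm_mul_exp_neg_mul_I z φ
    obtain ⟨w, hw⟩ : ∃ w, w = z * Complex.exp (-(φ * Complex.I)) := ⟨_, rfl⟩
    rw [← hw] at hn ⊢
    rw [Complex.reCLM_apply]
    have : (1 + w) / (1 - w) / (2 * Real.pi) = ((1 + w) / (1 - w)) / ((2 * Real.pi : ℝ) : ℂ) := by
      push_cast; rfl
    rw [this, Complex.div_ofReal_re]
    refine div_nonneg ?_ (by positivity)
    rw [Complex.div_re, ← add_div]
    refine div_nonneg ?_ (Complex.normSq_nonneg _)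
    have h2 : ‖w‖ ^ 2 < 1 := by
      rw [hn]
      exact pow_lt_one₀ (norm_nonneg _) hz two_ne_zero
    rw [Complex.sq_norm, Complex.normSq_apply] at h2
    simp
    nlinarith
  · exact (Continuous.div_const (Continuous.div (by fun_prop) (by fun_prop) hne)
      _).intervalIntegrable _ _

theorem norm_exp_add_mul_I_lt_one {s : ℝ} (hs : s < 0) (θ : ℝ) :
    ‖Complex.exp (s + θ * Complex.I)‖ < 1 := by
  rw [Complex.norm_exp]
  simpa using hs

theorem continuous_comp_exp {F : ℂ → ℂ} (hF : DifferentiableOn ℂ F (Metric.ball 0 1)) {s : ℝ}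
    (hs : s < 0) : Continuous fun θ : ℝ => F (Complex.exp (s + θ * Complex.I)) :=
  hF.continuousOn.comp_continuous (by fun_prop) fun θ => by
    simpa using norm_exp_add_mul_I_lt_one hs θ

theorem integral_arcKernel_re (a b : ℝ) {s : ℝ} (hs : s < 0) :
    ∫ θ in (0 : ℝ)..2 * Real.pi, (arcKernel a b (Complex.exp (s + θ * Complex.I))).re = b - a := by
  have hr : 0 < Real.exp s := Real.exp_pos s
  have hcl : DiffContOnCl ℂ (arcKernel a b) (Metric.ball 0 |Real.exp s|) := by
    refine ((differentiableOn_arcKernel a b).mono ?_).diffContOnCl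
    rw [abs_of_pos hr]
    exact Metric.closure_ball_subset_closedBall.trans
      (Metric.closedBall_subset_ball (Real.exp_lt_one_iff.2 hs))
  have h := hcl.circleAverage
  rw [Real.circleAverage_def, arcKernel_zero] at h
  have hc := (continuous_comp_exp (differentiableOn_arcKernel a b) hs)
  have hcm : ∀ θ : ℝ, circleMap 0 (Real.exp s) θ = Complex.exp (s + θ * Complex.I) := fun θ => by
    rw [circleMap, Complex.exp_add]
    simp
  simp only [hcm] at h
  have h' := congrArg Complex.re h
  rw [Complex.real_smul, Complex.re_ofReal_mul, Complex.ofReal_re, ← Complex.reCLM_apply,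
    ← ContinuousLinearMap.intervalIntegral_comp_comm _ (hc.intervalIntegrable _ _)] at h'
  simp only [Complex.reCLM_apply] at h'
  have := Real.pi_ne_zero
  field_simp at h'
  exact h'

theorem hasSum_neg_log_re {s : ℝ} (hs : s < 0) (θ φ : ℝ) :
    HasSum (fun l : ℕ => Real.exp (s * l) / l * Real.cos (l * (θ - φ)))
      (-(Complex.log (1 - Complex.exp (s + θ * Complex.I) *
        Complex.exp (-(φ * Complex.I)))).re) := by
  have hz := norm_mul_exp_neg_mul_I (Complex.exp (s + θ * Complex.I)) φ
  have h := Complex.hasSum_re (Complex.hasSum_taylorSeries_neg_log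
    (hz.trans_lt (norm_exp_add_mul_I_lt_one hs θ)))
  rw [Complex.neg_re] at h
  refine h.congr_fun fun l => ?_
  rw [← Complex.exp_add, ← Complex.exp_nat_mul]
  have : (l : ℂ) * (s + θ * Complex.I + -(φ * Complex.I)) =
      ((s * l : ℝ) : ℂ) + ((l * (θ - φ) : ℝ) : ℂ) * Complex.I := by push_cast; ring
  rw [this, Complex.exp_add, ← Complex.ofReal_exp, Complex.div_natCast_re, Complex.re_ofReal_mul,
    Complex.exp_ofReal_mul_I_re]
  ring

theorem arcKernel_im (a b : ℝ) (z : ℂ) : (arcKernel a b z).im =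
    (Complex.log (1 - z * Complex.exp (-(a * Complex.I)))).re / Real.pi -
      (Complex.log (1 - z * Complex.exp (-(b * Complex.I)))).re / Real.pi := by
  have : ∀ w : ℂ, (w / (Real.pi * Complex.I)).im = -w.re / Real.pi := fun w => by
    rw [mul_comm, ← div_div, Complex.div_I, Complex.div_ofReal_im]
    simp
  rw [arcKernel, Complex.add_im, Complex.ofReal_im, this]
  simp
  ring

theorem hasSum_integral_log_re {s : ℝ} (hs : s < 0) (φ c d : ℝ) :
    HasSum (fun l : ℕ => Real.exp (s * l) / l ^ 2 *
      (Real.sin (l * (d - φ)) - Real.sin (l * (c - φ))))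
      (∫ θ in c..d, -(Complex.log (1 - Complex.exp (s + θ * Complex.I) *
        Complex.exp (-(φ * Complex.I)))).re) := by
  have hsum : Summable fun l : ℕ => Real.exp (s * l) := by
    simpa [← Real.exp_nat_mul, mul_comm] using
      summable_geometric_of_lt_one (Real.exp_pos s).le (Real.exp_lt_one_iff.2 hs)
  have hb : ∀ (l : ℕ) (θ : ℝ), ‖Real.exp (s * l) / l * Real.cos (l * (θ - φ))‖ ≤
      Real.exp (s * l) := by
    intro l θ
    rw [norm_mul, Real.norm_eq_abs, Real.norm_eq_abs, abs_of_nonneg (by positivity)]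
    refine (mul_le_of_le_one_right (by positivity) (Real.abs_cos_le_one _)).trans ?_
    rcases Nat.eq_zero_or_pos l with rfl | hl
    · simp
    · exact div_le_self (Real.exp_pos _).le (by exact_mod_cast hl)
  have h := intervalIntegral.hasSum_integral_of_dominated_convergence (μ := volume) (a := c)
    (b := d)
    (F := fun (l : ℕ) (θ : ℝ) => Real.exp (s * l) / l * Real.cos (l * (θ - φ)))
    (f := fun θ : ℝ => -(Complex.log (1 - Complex.exp (s + θ * Complex.I) *
        Complex.exp (-(φ * Complex.I)))).re)
    (fun l _ => Real.exp (s * l)) (fun l => (by fun_prop : Continuous _).aestronglyMeasurable)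
    (fun l => Filter.Eventually.of_forall fun θ _ => hb l θ)
    (Filter.Eventually.of_forall fun θ _ => hsum)
    intervalIntegrable_const
    (Filter.Eventually.of_forall fun θ _ => hasSum_neg_log_re hs θ φ)
  refine h.congr_fun fun l => ?_
  rw [intervalIntegral.integral_const_mul]
  rcases Nat.eq_zero_or_pos l with rfl | hl
  · simp
  have hl' : (l : ℝ) ≠ 0 := by positivity
  have hder : ∀ θ : ℝ, HasDerivAt (fun θ : ℝ => Real.sin (l * (θ - φ)) / l)
      (Real.cos (l * (θ - φ))) θ := fun θ => by
    refine (((((hasDerivAt_id θ).sub_const φ).const_mul (l : ℝ)).sin).div_const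
      (l : ℝ)).congr_deriv ?_
    simp only [id]
    field_simp
  rw [intervalIntegral.integral_eq_sub_of_hasDerivAt (fun θ _ => hder θ)
    ((by fun_prop : Continuous _).intervalIntegrable _ _)]
  field_simp

theorem hasSum_integral_arcKernel_im {s : ℝ} (hs : s < 0) (a b c d : ℝ) :
    HasSum (fun l : ℕ => Real.exp (s * l) / (Real.pi * l ^ 2) *
      ((Real.sin (l * (d - b)) - Real.sin (l * (c - b))) -
        (Real.sin (l * (d - a)) - Real.sin (l * (c - a)))))
      (∫ θ in c..d, (arcKernel a b (Complex.exp (s + θ * Complex.I))).im) := by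
  have h := ((hasSum_integral_log_re hs b c d).sub (hasSum_integral_log_re hs a c d)).div_const
    Real.pi
  have hcont : ∀ φ : ℝ, Continuous fun θ : ℝ => -(Complex.log (1 - Complex.exp (s + θ * Complex.I) *
        Complex.exp (-(φ * Complex.I)))).re := fun φ =>
    (Complex.continuous_re.comp (Continuous.clog (by fun_prop) fun θ =>
      one_sub_mul_exp_mem_slitPlane (norm_exp_add_mul_I_lt_one hs θ) φ)).neg
  rw [← intervalIntegral.integral_sub ((hcont b).intervalIntegrable _ _)
    ((hcont a).intervalIntegrable _ _), ← intervalIntegral.integral_div] at h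
  have e : ∀ θ : ℝ, (arcKernel a b (Complex.exp (s + θ * Complex.I))).im =
      (-(Complex.log (1 - Complex.exp (s + θ * Complex.I) *
        Complex.exp (-(b * Complex.I)))).re - -(Complex.log (1 - Complex.exp (s + θ * Complex.I) *
        Complex.exp (-(a * Complex.I)))).re) / Real.pi := fun θ => by
    rw [arcKernel_im]
    ring
  simp only [e]
  refine h.congr_fun fun l => ?_
  ring

theorem tendsto_one_sub_two_mul_trigamma (y : ℝ) (hy : 0 < y) :
    Filter.Tendsto (fun Q : ℕ => (1 - 2 * (y + Q)) * trigamma (y + Q)) Filter.atTop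
      (nhds (-2)) := by
  have hv : Filter.Tendsto (fun Q : ℕ => y + (Q : ℝ)) Filter.atTop Filter.atTop :=
    Filter.tendsto_atTop_add_const_left _ _ tendsto_natCast_atTop_atTop
  have hinv : Filter.Tendsto (fun Q : ℕ => (y + (Q : ℝ))⁻¹) Filter.atTop (nhds 0) :=
    tendsto_inv_atTop_zero.comp hv
  rw [tendsto_iff_norm_sub_tendsto_zero]
  have hlim : Filter.Tendsto
      (fun Q : ℕ => (y + (Q : ℝ))⁻¹ ^ 2 + (y + (Q : ℝ))⁻¹) Filter.atTop (nhds 0) := by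
    simpa using (hinv.pow 2).add hinv
  refine squeeze_zero (fun _ => norm_nonneg _) (fun Q => ?_) hlim
  have hu : 0 < y + (Q : ℝ) := by positivity
  obtain ⟨u, hu'⟩ : ∃ u, u = y + (Q : ℝ) := ⟨_, rfl⟩
  rw [← hu'] at hu ⊢
  have hm := integral_bern₂_mul_exp_mem hu
  obtain ⟨m, hm'⟩ : ∃ m, m = u ^ 2 * trigamma u - 1 / 2 - u := ⟨_, rfl⟩
  rw [← hm'] at hm
  have hT : trigamma u = (m + 1 / 2 + u) / u ^ 2 := by
    rw [hm']
    field_simp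
    ring
  have : (1 - 2 * u) * trigamma u - -2 = (1 / 2 + m * (1 - 2 * u)) / u ^ 2 := by
    rw [hT]
    field_simp
    ring
  rw [this, Real.norm_eq_abs, abs_div, abs_of_pos (by positivity : 0 < u ^ 2),
    div_le_iff₀ (by positivity)]
  have : (u⁻¹ ^ 2 + u⁻¹) * u ^ 2 = 1 + u := by
    field_simp
  rw [this, abs_le]
  obtain ⟨hm0, hm1⟩ := hm
  constructor <;> nlinarith [mul_nonneg hm0 hu.le, mul_nonneg (sub_nonneg.2 hm1) hu.le]

theorem two_mul_trigamma_sub {y : ℝ} (hy : 0 < y) :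
    2 * trigamma y - (1 + 2 * y) / y ^ 2 =
      (1 - 2 * y) * trigamma y - (1 - 2 * (y + 1)) * trigamma (y + 1) := by
  have h : trigamma (y + 1) = trigamma y - 1 / y ^ 2 := by
    rw [← trigamma_sub hy]
    ring
  rw [h]
  field_simp
  ring

theorem sum_range_mul_trigamma {N : ℕ} (hN : 0 < N) {h : ℕ → ℝ} (h0 : h 0 = 0)
    (hper : h.Periodic N) (Q : ℕ) :
    ∑ l ∈ Finset.range (N * Q),
      (2 * trigamma (l / N) - (1 + 2 * (l / N : ℝ)) / (l / N : ℝ) ^ 2) * h l =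
    ∑ j ∈ Finset.range N, ((1 - 2 * (j / N : ℝ)) * trigamma (j / N) -
      (1 - 2 * (j / N + Q : ℝ)) * trigamma (j / N + Q)) * h j := by
  have hN' : (0 : ℝ) < N := by exact_mod_cast hN
  induction Q with
  | zero => simp
  | succ Q ih =>
    rw [Nat.mul_succ, Finset.sum_range_add, ih, ← Finset.sum_add_distrib]
    refine Finset.sum_congr rfl fun j _ => ?_
    have hp : h (N * Q + j) = h j := by
      rw [add_comm, mul_comm]
      exact hper.nat_mul Q j
    rw [hp]
    rcases Nat.eq_zero_or_pos j with rfl | hj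
    · simp [h0]
    have hc : (((N * Q + j : ℕ) : ℝ) / N) = j / N + Q := by
      push_cast
      field_simp
      ring
    rw [hc, two_mul_trigamma_sub (by positivity)]
    push_cast
    rw [← add_assoc]
    ring

theorem tendsto_sum_trigamma {N : ℕ} (hN : 0 < N) {h : ℕ → ℝ} (h0 : h 0 = 0)
    (hper : h.Periodic N) :
    Filter.Tendsto (fun Q : ℕ => ∑ l ∈ Finset.range (N * Q),
      (2 * trigamma (l / N) - (1 + 2 * (l / N : ℝ)) / (l / N : ℝ) ^ 2) * h l) Filter.atTop
      (nhds (∑ j ∈ Finset.range N, ((1 - 2 * (j / N : ℝ)) * trigamma (j / N) + 2) * h j)) := by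
  simp only [sum_range_mul_trigamma hN h0 hper]
  refine tendsto_finsetSum _ fun j _ => ?_
  rcases Nat.eq_zero_or_pos j with rfl | hj
  · simp [h0]
  have hN' : (0 : ℝ) < N := by exact_mod_cast hN
  have := (tendsto_one_sub_two_mul_trigamma ((j : ℝ) / N) (by positivity)).const_sub
    ((1 - 2 * (j / N : ℝ)) * trigamma (j / N))
  rw [sub_neg_eq_add] at this
  exact this.mul_const _

/-- Summation of the trigamma values against an odd periodic sequence by reflection. -/
theorem sum_trigamma_of_odd {N : ℕ} (hN : 0 < N) {f : ℕ → ℝ} (f0 : f 0 = 0)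
    (hodd : ∀ j ≤ N, f (N - j) = -f j) :
    ∑ j ∈ Finset.range N, ((1 - 2 * (j / N : ℝ)) * trigamma (j / N) + 2) *
      (Real.sin (Real.pi * (j / N)) ^ 2 * f j) =
    Real.pi ^ 2 / 2 * ∑ j ∈ Finset.range N, (1 - 2 * (j / N : ℝ)) * f j := by
  obtain ⟨M, rfl⟩ : ∃ M, N = M + 1 := ⟨N - 1, by omega⟩
  have hN' : (0 : ℝ) < ((M + 1 : ℕ) : ℝ) := by positivity
  rw [Finset.sum_range_succ', Finset.sum_range_succ', f0]
  simp only [mul_zero, add_zero]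
  obtain ⟨g, hg⟩ : ∃ g : ℕ → ℝ, g = fun j => ((1 - 2 * (((j + 1 : ℕ) : ℝ) / ((M + 1 : ℕ) : ℝ))) *
    trigamma (((j + 1 : ℕ) : ℝ) / ((M + 1 : ℕ) : ℝ)) + 2) *
      (Real.sin (Real.pi * (((j + 1 : ℕ) : ℝ) / ((M + 1 : ℕ) : ℝ))) ^ 2 * f (j + 1)) := ⟨_, rfl⟩
  have hrefl := Finset.sum_range_reflect g M
  have hsum : ∑ j ∈ Finset.range M, (g j + g (M - 1 - j)) =
      Real.pi ^ 2 * ∑ j ∈ Finset.range M,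
        (1 - 2 * (((j + 1 : ℕ) : ℝ) / ((M + 1 : ℕ) : ℝ))) * f (j + 1) := by
    rw [Finset.mul_sum]
    refine Finset.sum_congr rfl fun j hj => ?_
    have hjM : j < M := Finset.mem_range.1 hj
    obtain ⟨x, hx⟩ : ∃ x : ℝ, x = ((j + 1 : ℕ) : ℝ) / ((M + 1 : ℕ) : ℝ) := ⟨_, rfl⟩
    have hx0 : 0 < x := hx ▸ by positivity
    have hx1 : x < 1 := by
      rw [hx, div_lt_one hN']
      exact_mod_cast (by omega)
    have e1 : ((M - 1 - j + 1 : ℕ) : ℝ) / ((M + 1 : ℕ) : ℝ) = 1 - x := by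
      rw [hx, show M - 1 - j + 1 = M + 1 - (j + 1) by omega, Nat.cast_sub (by omega)]
      field_simp
    have e2 : f (M - 1 - j + 1) = -f (j + 1) := by
      rw [← hodd (j + 1) (by omega)]
      congr 1
      omega
    have e3 : Real.sin (Real.pi * (1 - x)) = Real.sin (Real.pi * x) := by
      rw [mul_sub, mul_one, Real.sin_pi_sub]
    have hs : Real.sin (Real.pi * x) ≠ 0 :=
      (Real.sin_pos_of_pos_of_lt_pi (by positivity) (by nlinarith [Real.pi_pos])).ne'
    have hr := trigamma_reflection hx0 hx1
    have hr' : (trigamma x + trigamma (1 - x)) * Real.sin (Real.pi * x) ^ 2 = Real.pi ^ 2 := by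
      rw [hr]
      field_simp
    simp only [hg]
    rw [e1, e2, e3, ← hx, ← hr']
    ring
  rw [Finset.sum_add_distrib, hrefl] at hsum
  have : ∑ j ∈ Finset.range M, g j = Real.pi ^ 2 / 2 * ∑ j ∈ Finset.range M,
        (1 - 2 * (((j + 1 : ℕ) : ℝ) / ((M + 1 : ℕ) : ℝ))) * f (j + 1) := by linarith
  rw [← this, hg]

/-- The average over the `n`-th of `N` arcs of the conjugate harmonic extension of the indicator of
the `m`-th arc, on the circle of radius `exp (-t / N)`. -/
def arcAverage (N : ℕ) (n m : ℕ) (t : ℝ) : ℝ :=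
  N / (2 * Real.pi) * ∫ θ in (2 * Real.pi * n / N)..(2 * Real.pi * (n + 1) / N),
    (arcKernel (2 * Real.pi * m / N) (2 * Real.pi * (m + 1) / N)
      (Complex.exp ((-t / N : ℝ) + θ * Complex.I))).im

theorem hasSum_arcAverage {N : ℕ} (hN : 0 < N) (n m : ℕ) {t : ℝ} (ht : 0 < t) :
    HasSum (fun l : ℕ => 2 * N / (Real.pi ^ 2 * l ^ 2) * Real.exp (-(l / N * t)) *
      (Real.sin (Real.pi * (l / N)) ^ 2 * Real.sin (2 * Real.pi * l * (n - m) / N)))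
      (arcAverage N n m t) := by
  have hN' : (0 : ℝ) < N := by exact_mod_cast hN
  have h := (hasSum_integral_arcKernel_im (s := -t / N) (div_neg_of_neg_of_pos (by linarith) hN')
    (2 * Real.pi * m / N) (2 * Real.pi * (m + 1) / N) (2 * Real.pi * n / N)
    (2 * Real.pi * (n + 1) / N)).mul_left (N / (2 * Real.pi))
  refine h.congr_fun fun l => ?_
  obtain ⟨D, hD⟩ : ∃ D, D = 2 * Real.pi * l * (n - m) / N := ⟨_, rfl⟩
  obtain ⟨α, hα⟩ : ∃ α, α = Real.pi * (l / N) := ⟨_, rfl⟩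
  have e1 : (l : ℝ) * (2 * Real.pi * (n + 1) / N - 2 * Real.pi * (m + 1) / N) = D := by
    rw [hD]; ring
  have e2 : (l : ℝ) * (2 * Real.pi * n / N - 2 * Real.pi * (m + 1) / N) = D - 2 * α := by
    rw [hD, hα]; ring
  have e3 : (l : ℝ) * (2 * Real.pi * (n + 1) / N - 2 * Real.pi * m / N) = D + 2 * α := by
    rw [hD, hα]; ring
  have e4 : (l : ℝ) * (2 * Real.pi * n / N - 2 * Real.pi * m / N) = D := by
    rw [hD]; ring
  have e5 : -t / N * (l : ℝ) = -(l / N * t) := by ring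
  rw [e1, e2, e3, e4, e5, ← hD, ← hα, Real.sin_sub, Real.sin_add, Real.cos_two_mul, Real.cos_sq']
  rcases Nat.eq_zero_or_pos l with rfl | hl
  · simp
  have hl' : (l : ℝ) ≠ 0 := by positivity
  field_simp
  ring

theorem integrableOn_arcAverage_and_integral {N : ℕ} (hN : 0 < N) (n m : ℕ) :
    IntegrableOn (fun t => 2 * bern₂ t * arcAverage N n m t) (Set.Ioi 0) ∧
    ∫ t in Set.Ioi 0, 2 * bern₂ t * arcAverage N n m t =
      1 / N * ∑ j ∈ Finset.range N, (1 - 2 * (j / N : ℝ)) *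
        Real.sin (2 * Real.pi * j * (n - m) / N) := by
  have hN' : (0 : ℝ) < N := by exact_mod_cast hN
  obtain ⟨f, hf⟩ : ∃ f : ℕ → ℝ, f = fun l : ℕ => Real.sin (2 * Real.pi * l * (n - m) / N) := ⟨_, rfl⟩
  obtain ⟨h, hh⟩ : ∃ h : ℕ → ℝ, h = fun l : ℕ => Real.sin (Real.pi * (l / N)) ^ 2 * f l := ⟨_, rfl⟩
  have hh1 : ∀ l, |h l| ≤ 1 := fun l => by
    rw [hh, abs_mul, abs_pow, hf]
    exact mul_le_one₀ (pow_le_one₀ (abs_nonneg _) (Real.abs_sin_le_one _)) (abs_nonneg _)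
      (Real.abs_sin_le_one _)
  obtain ⟨G, hG⟩ : ∃ G : ℕ → ℝ → ℝ, G = fun (l : ℕ) t => (4 * N / (Real.pi ^ 2 * l ^ 2) * h l) *
    (bern₂ t * Real.exp (-(l / N * t))) := ⟨_, rfl⟩
  have hGsum : ∀ t ∈ Set.Ioi (0 : ℝ), HasSum (fun l => G l t)
      (2 * bern₂ t * arcAverage N n m t) := fun t ht => by
    refine ((hasSum_arcAverage hN n m ht).mul_left (2 * bern₂ t)).congr_fun fun l => ?_
    simp only [hG, hh, hf]
    ring
  have hGint : ∀ l, IntegrableOn (G l) (Set.Ioi 0) := fun l => by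
    rcases Nat.eq_zero_or_pos l with rfl | hl
    · simp [hG]
    · rw [hG]
      exact (integrableOn_bern₂_mul_exp (by positivity : 0 < (l : ℝ) / N)).const_mul _
  have hGnorm : ∀ l, ∀ t ∈ Set.Ioi (0 : ℝ), ‖G l t‖ ≤
      4 * N / Real.pi ^ 2 * (1 / (l : ℝ) ^ 2) * bern₂ t := by
    intro l t ht
    have hb := bern₂_nonneg ht
    have ht' : (0 : ℝ) < t := ht
    simp only [hG]
    rw [norm_mul, norm_mul, norm_mul, Real.norm_eq_abs, Real.norm_eq_abs, Real.norm_eq_abs,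
      Real.norm_eq_abs, abs_of_nonneg hb, Real.abs_exp, abs_of_nonneg (by positivity)]
    have he : Real.exp (-(l / N * t)) ≤ 1 := by
      rw [Real.exp_le_one_iff, neg_nonpos]
      positivity
    calc _ ≤ 4 * N / (Real.pi ^ 2 * l ^ 2) * 1 * (bern₂ t * 1) := by
          gcongr
          exact hh1 l
      _ = _ := by
          rw [mul_one, mul_one, ← div_div, div_eq_mul_one_div (4 * (N : ℝ) / Real.pi ^ 2)]
  have hsummable : Summable fun l : ℕ => 4 * N / Real.pi ^ 2 * (1 / (l : ℝ) ^ 2) :=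
    (Real.summable_one_div_nat_pow.2 one_lt_two).mul_left _
  have hbint : IntegrableOn (fun t => ∑' l : ℕ, 4 * N / Real.pi ^ 2 * (1 / (l : ℝ) ^ 2) * bern₂ t)
      (Set.Ioi 0) := by
    simp only [tsum_mul_right]
    exact integrableOn_bern₂.const_mul _
  have hGmeas : ∀ l, AEStronglyMeasurable (G l) (volume.restrict (Set.Ioi 0)) := fun l =>
    (hGint l).aestronglyMeasurable
  constructor
  · refine Integrable.mono' hbint (aestronglyMeasurable_of_tendsto_ae Filter.atTop
      (fun Q : ℕ => Finset.aestronglyMeasurable_fun_sum (Finset.range Q) fun l _ => hGmeas l) ?_) ?_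
    · filter_upwards [ae_restrict_mem measurableSet_Ioi] with t ht
      exact (hGsum t ht).tendsto_sum_nat
    · filter_upwards [ae_restrict_mem measurableSet_Ioi] with t ht
      have hs := hsummable.mul_right (bern₂ t)
      rw [← (hGsum t ht).tsum_eq]
      refine (norm_tsum_le_tsum_norm (hs.of_nonneg_of_le (fun _ => norm_nonneg _)
        fun l => hGnorm l t ht)).trans ?_
      exact Summable.tsum_le_tsum (fun l => hGnorm l t ht)
        (hs.of_nonneg_of_le (fun _ => norm_nonneg _) fun l => hGnorm l t ht) hs
  · have hS : HasSum (fun l => ∫ t in Set.Ioi 0, G l t)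
        (∫ t in Set.Ioi 0, 2 * bern₂ t * arcAverage N n m t) := by
      refine hasSum_integral_of_dominated_convergence
        (fun (l : ℕ) t => 4 * N / Real.pi ^ 2 * (1 / (l : ℝ) ^ 2) * bern₂ t) hGmeas (fun l => ?_)
        (Filter.Eventually.of_forall fun t => hsummable.mul_right _) hbint ?_
      · filter_upwards [ae_restrict_mem measurableSet_Ioi] with t ht using hGnorm l t ht
      · filter_upwards [ae_restrict_mem measurableSet_Ioi] with t ht using hGsum t ht
    have hval : ∀ l, ∫ t in Set.Ioi 0, G l t = 2 / (N * Real.pi ^ 2) *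
        ((2 * trigamma (l / N) - (1 + 2 * (l / N : ℝ)) / (l / N : ℝ) ^ 2) * h l) := fun l => by
      rcases Nat.eq_zero_or_pos l with rfl | hl
      · simp [hG, hh, hf]
      simp only [hG]
      rw [integral_const_mul, integral_bern₂_mul_exp (by positivity)]
      have hl' : (l : ℝ) ≠ 0 := by positivity
      field_simp
      ring
    simp only [hval] at hS
    have h0 : h 0 = 0 := by simp [hh]
    have hper : h.Periodic N := fun l => by
      simp only [hh, hf]
      have e1 : Real.pi * (((l + N : ℕ) : ℝ) / N) = Real.pi * (l / N) + Real.pi := by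
        push_cast
        field_simp
      have e2 : 2 * Real.pi * ((l + N : ℕ) : ℝ) * (n - m) / N =
          2 * Real.pi * l * (n - m) / N + ((n - m : ℤ) : ℝ) * (2 * Real.pi) := by
        push_cast
        field_simp
      rw [e1, e2, Real.sin_add_pi, Real.sin_add_int_mul_two_pi, neg_sq]
    have hlim := (tendsto_sum_trigamma hN h0 hper).const_mul (2 / (N * Real.pi ^ 2))
    have hlim' := hS.tendsto_sum_nat.comp
      (Filter.tendsto_id.const_mul_atTop' hN : Filter.Tendsto (fun Q : ℕ => N * Q) _ _)
    simp only [Function.comp_def, ← Finset.mul_sum] at hlim'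
    rw [tendsto_nhds_unique hlim' hlim]
    have hodd : ∀ j ≤ N, f (N - j) = -f j := fun j hj => by
      simp only [hf]
      have e : 2 * Real.pi * ((N - j : ℕ) : ℝ) * (n - m) / N =
          -(2 * Real.pi * j * (n - m) / N) + ((n - m : ℤ) : ℝ) * (2 * Real.pi) := by
        rw [Nat.cast_sub hj]
        push_cast
        field_simp
        ring
      rw [e, Real.sin_add_int_mul_two_pi, Real.sin_neg]
    have := sum_trigamma_of_odd hN (by simp [hf]) hodd
    rw [hh, this, hf]
    have hpi := Real.pi_ne_zero
    rw [← mul_assoc]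
    congr 1
    field_simp

theorem exists_subgradient_abs_rpow {p : ℝ} (hp : 1 < p) (c : ℝ) :
    ∃ l : ℝ, ∀ x : ℝ, |c| ^ p + l * (x - c) ≤ |x| ^ p := by
  rcases eq_or_ne c 0 with rfl | hc
  · refine ⟨0, fun x => ?_⟩
    rw [abs_zero, Real.zero_rpow (by linarith)]
    simpa using Real.rpow_nonneg (abs_nonneg x) p
  refine ⟨p * |c| ^ p / c, fun x => ?_⟩
  obtain ⟨s, hs⟩ : ∃ s, s = (x - c) / c := ⟨_, rfl⟩
  have hx : x = c * (1 + s) := by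
    rw [hs]
    field_simp
    ring
  have hcp : 0 ≤ |c| ^ p := Real.rpow_nonneg (abs_nonneg c) p
  have e : |c| ^ p + p * |c| ^ p / c * (x - c) = |c| ^ p * (1 + p * s) := by
    rw [hs]
    field_simp
  rw [e, hx, abs_mul, Real.mul_rpow (abs_nonneg _) (abs_nonneg _)]
  refine mul_le_mul_of_nonneg_left ?_ hcp
  rcases le_or_gt (-1) s with h | h
  · rw [abs_of_nonneg (by linarith)]
    exact one_add_mul_self_le_rpow_one_add h hp.le
  · have := Real.rpow_nonneg (abs_nonneg (1 + s)) p
    nlinarith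

theorem abs_average_rpow_le {p : ℝ} (hp : 1 < p) {u : ℝ → ℝ} (hu : Continuous u) {a b : ℝ}
    (hab : a < b) :
    |(b - a)⁻¹ * ∫ x in a..b, u x| ^ p ≤ (b - a)⁻¹ * ∫ x in a..b, |u x| ^ p := by
  obtain ⟨c, hc⟩ : ∃ c, c = (b - a)⁻¹ * ∫ x in a..b, u x := ⟨_, rfl⟩
  obtain ⟨l, hl⟩ := exists_subgradient_abs_rpow hp c
  have hba : 0 < b - a := sub_pos.2 hab
  have hup : Continuous fun x => |u x| ^ p :=
    hu.abs.rpow_const fun _ => Or.inr (by linarith)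
  have hmono := intervalIntegral.integral_mono_on hab.le
    ((by fun_prop : Continuous fun x => |c| ^ p + l * (u x - c)).intervalIntegrable (μ := volume) a b)
    (hup.intervalIntegrable a b) fun x _ => hl (u x)
  rw [intervalIntegral.integral_add (by simp)
    ((by fun_prop : Continuous fun x => l * (u x - c)).intervalIntegrable _ _),
    intervalIntegral.integral_const_mul, intervalIntegral.integral_sub
    (hu.intervalIntegrable _ _) (by simp), intervalIntegral.integral_const,
    intervalIntegral.integral_const, smul_eq_mul, smul_eq_mul] at hmono
  have e : ∫ x in a..b, u x = (b - a) * c := by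
    rw [hc]
    field_simp
  rw [e] at hmono
  rw [← hc, inv_mul_eq_div, le_div_iff₀ hba]
  linarith

theorem sum_abs_arcAverage_rpow_le {p : ℝ} (hp : 1 < p) (hp2 : p ≤ 2) {N : ℕ} (hN : 0 < N)
    (a : ℕ → ℝ) {t : ℝ} (ht : 0 < t) :
    ∑ n ∈ Finset.range N, |∑ m ∈ Finset.range N, a m * arcAverage N n m t| ^ p ≤
      Real.tan (Real.pi / (2 * p)) ^ p * ∑ m ∈ Finset.range N, |a m| ^ p := by
  have hN' : (0 : ℝ) < N := by exact_mod_cast hN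
  have hpi := Real.pi_pos
  obtain ⟨s, hs⟩ : ∃ s : ℝ, s = -t / N := ⟨_, rfl⟩
  have hs0 : s < 0 := hs ▸ div_neg_of_neg_of_pos (by linarith) hN'
  obtain ⟨K, hK⟩ : ∃ K : ℕ → ℂ → ℂ, K = fun m : ℕ =>
    arcKernel (2 * Real.pi * m / N) (2 * Real.pi * (m + 1) / N) := ⟨_, rfl⟩
  have hKd : ∀ m, DifferentiableOn ℂ (K m) (Metric.ball 0 1) := fun m => by
    rw [hK]
    exact differentiableOn_arcKernel _ _
  obtain ⟨F, hF⟩ : ∃ F : ℂ → ℂ, F = fun z => ∑ m ∈ Finset.range N, (a m : ℂ) * K m z := ⟨_, rfl⟩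
  have hFd : DifferentiableOn ℂ F (Metric.ball 0 1) := by
    rw [hF]
    exact DifferentiableOn.fun_sum fun m _ => (hKd m).const_mul _
  have hFre : ∀ z, (F z).re = ∑ m ∈ Finset.range N, a m * (K m z).re := fun z => by
    simp [hF, Complex.re_sum]
  have hFim : ∀ z, (F z).im = ∑ m ∈ Finset.range N, a m * (K m z).im := fun z => by
    simp [hF, Complex.im_sum]
  have hF0 : (F 0).im = 0 := by
    rw [hFim]
    refine Finset.sum_eq_zero fun m _ => ?_
    rw [hK]
    simp only [arcKernel_zero, Complex.ofReal_im, mul_zero]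
  have hKsum : ∀ z, ∑ m ∈ Finset.range N, K m z = 1 := by
    intro z
    have : ∀ M : ℕ, ∑ m ∈ Finset.range M, K m z = arcKernel 0 (2 * Real.pi * M / N) z := by
      intro M
      induction M with
      | zero => simp [arcKernel]
      | succ M ih =>
        rw [Finset.sum_range_succ, ih, hK]
        simp only [arcKernel_add]
        push_cast
        rfl
    rw [this, mul_div_cancel_right₀ _ hN'.ne', arcKernel_two_pi]
  have hKre : ∀ m z, ‖z‖ < 1 → 0 ≤ (K m z).re := fun m z hz => by
    rw [hK]
    refine arcKernel_re_nonneg hz ?_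
    gcongr
    linarith
  have hmain := integral_abs_im_rpow_le hp hp2 hFd hF0 hs0
  have hcre : Continuous fun θ : ℝ => |(F (Complex.exp (s + θ * Complex.I))).re| ^ p :=
    (Complex.continuous_re.comp (continuous_comp_exp hFd hs0)).abs.rpow_const
      fun _ => Or.inr (by linarith)
  have hcim : Continuous fun θ : ℝ => (F (Complex.exp (s + θ * Complex.I))).im :=
    Complex.continuous_im.comp (continuous_comp_exp hFd hs0)
  have hcimp : Continuous fun θ : ℝ => |(F (Complex.exp (s + θ * Complex.I))).im| ^ p :=
    hcim.abs.rpow_const fun _ => Or.inr (by linarith)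
  have hcK : ∀ m, Continuous fun θ : ℝ => (K m (Complex.exp (s + θ * Complex.I))).re := fun m =>
    Complex.continuous_re.comp (continuous_comp_exp (hKd m) hs0)
  have hcKi : ∀ m, Continuous fun θ : ℝ => (K m (Complex.exp (s + θ * Complex.I))).im := fun m =>
    Complex.continuous_im.comp (continuous_comp_exp (hKd m) hs0)
  have hR : ∫ θ in (0 : ℝ)..2 * Real.pi, |(F (Complex.exp (s + θ * Complex.I))).re| ^ p ≤
      2 * Real.pi / N * ∑ m ∈ Finset.range N, |a m| ^ p := by
    have hpt : ∀ θ : ℝ, |(F (Complex.exp (s + θ * Complex.I))).re| ^ p ≤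
        ∑ m ∈ Finset.range N, (K m (Complex.exp (s + θ * Complex.I))).re * |a m| ^ p := fun θ => by
      have hz := norm_exp_add_mul_I_lt_one hs0 θ
      obtain ⟨z, hz'⟩ : ∃ z, z = Complex.exp (s + θ * Complex.I) := ⟨_, rfl⟩
      rw [← hz'] at hz ⊢
      have h1 := congrArg Complex.re (hKsum z)
      rw [Complex.re_sum, Complex.one_re] at h1
      refine le_trans ?_ (Real.rpow_arith_mean_le_arith_mean_rpow (Finset.range N)
        (fun m => (K m z).re) (fun m => |a m|) (fun m _ => hKre m z hz) h1
        (fun m _ => abs_nonneg _) hp.le)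
      refine Real.rpow_le_rpow (abs_nonneg _) ?_ (by linarith)
      rw [hFre]
      refine (Finset.abs_sum_le_sum_abs _ _).trans (Finset.sum_le_sum fun m _ => ?_)
      rw [abs_mul, abs_of_nonneg (hKre m z hz), mul_comm]
    refine (intervalIntegral.integral_mono_on (by positivity) (hcre.intervalIntegrable _ _)
      ((continuous_finsetSum _ fun m _ => (hcK m).mul_const _).intervalIntegrable _ _)
      fun θ _ => hpt θ).trans_eq ?_
    rw [intervalIntegral.integral_finsetSum fun m _ =>
      ((hcK m).mul_const _).intervalIntegrable _ _, Finset.mul_sum]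
    refine Finset.sum_congr rfl fun m _ => ?_
    rw [intervalIntegral.integral_mul_const, hK, integral_arcKernel_re _ _ hs0]
    ring
  have hA : ∀ n : ℕ, ∑ m ∈ Finset.range N, a m * arcAverage N n m t =
      (2 * Real.pi * (n + 1) / N - 2 * Real.pi * n / N)⁻¹ *
        ∫ θ in (2 * Real.pi * n / N)..(2 * Real.pi * (n + 1) / N),
          (F (Complex.exp (s + θ * Complex.I))).im := fun n => by
    have e : (2 * Real.pi * (n + 1) / N - 2 * Real.pi * n / N)⁻¹ = N / (2 * Real.pi) := by
      rw [← sub_div, inv_div]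
      congr 1
      ring
    simp only [hFim]
    rw [intervalIntegral.integral_finsetSum fun m _ =>
      ((hcKi m).const_mul _).intervalIntegrable _ _, e, Finset.mul_sum]
    refine Finset.sum_congr rfl fun m _ => ?_
    rw [intervalIntegral.integral_const_mul, arcAverage, hK, hs]
    ring
  have hL : ∑ n ∈ Finset.range N, |∑ m ∈ Finset.range N, a m * arcAverage N n m t| ^ p ≤
      N / (2 * Real.pi) *
        ∫ θ in (0 : ℝ)..2 * Real.pi, |(F (Complex.exp (s + θ * Complex.I))).im| ^ p := by
    have hadj := intervalIntegral.sum_integral_adjacent_intervals (μ := volume)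
      (f := fun θ : ℝ => |(F (Complex.exp (s + θ * Complex.I))).im| ^ p)
      (a := fun n : ℕ => 2 * Real.pi * n / N) (n := N)
      fun k _ => hcimp.intervalIntegrable _ _
    have e0 : 2 * Real.pi * ((0 : ℕ) : ℝ) / N = 0 := by simp
    rw [mul_div_cancel_right₀ _ hN'.ne', e0] at hadj
    rw [← hadj, Finset.mul_sum]
    refine Finset.sum_le_sum fun n _ => ?_
    have e : (2 * Real.pi * (n + 1) / N - 2 * Real.pi * n / N)⁻¹ = N / (2 * Real.pi) := by
      rw [← sub_div, inv_div]
      congr 1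
      ring
    rw [hA, Nat.cast_succ]
    refine (abs_average_rpow_le hp hcim ?_).trans_eq (by rw [e])
    gcongr
    linarith
  have ht0 : 0 ≤ Real.tan (Real.pi / (2 * p)) ^ p := by
    refine Real.rpow_nonneg (Real.tan_nonneg_of_nonneg_of_le_pi_div_two (by positivity) ?_) _
    gcongr
    linarith
  calc _ ≤ _ := hL
    _ ≤ N / (2 * Real.pi) * (Real.tan (Real.pi / (2 * p)) ^ p *
        (2 * Real.pi / N * ∑ m ∈ Finset.range N, |a m| ^ p)) := by
      gcongr
      exact hmain.trans (mul_le_mul_of_nonneg_left hR ht0)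
    _ = _ := by field_simp

/-- The periodic discrete Hilbert kernel, in spectral form. -/
def cyclicKernel (N : ℕ) (x : ℝ) : ℝ :=
  1 / N * ∑ j ∈ Finset.range N, (1 - 2 * (j / N : ℝ)) * Real.sin (2 * Real.pi * j * x / N)

theorem sum_abs_cyclicKernel_rpow_le {p : ℝ} (hp : 1 < p) (hp2 : p ≤ 2) {N : ℕ} (hN : 0 < N)
    (a : ℕ → ℝ) :
    ∑ n ∈ Finset.range N, |∑ m ∈ Finset.range N, a m * cyclicKernel N (n - m)| ^ p ≤
      Real.tan (Real.pi / (2 * p)) ^ p * ∑ m ∈ Finset.range N, |a m| ^ p := by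
  obtain ⟨c, hc⟩ : ∃ c : ℕ → ℝ, c = fun n : ℕ =>
    ∑ m ∈ Finset.range N, a m * cyclicKernel N (n - m) := ⟨_, rfl⟩
  obtain ⟨B, hB⟩ : ∃ B, B = Real.tan (Real.pi / (2 * p)) ^ p * ∑ m ∈ Finset.range N, |a m| ^ p :=
    ⟨_, rfl⟩
  choose l hl using fun n => exists_subgradient_abs_rpow hp (c n)
  obtain ⟨V, hV⟩ : ∃ V : ℕ → ℝ → ℝ, V = fun n t =>
    ∑ m ∈ Finset.range N, a m * (2 * bern₂ t * arcAverage N n m t) := ⟨_, rfl⟩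
  have hVint : ∀ n, IntegrableOn (V n) (Set.Ioi 0) := fun n => by
    rw [hV]
    exact integrable_finsetSum _ fun m _ =>
      (integrableOn_arcAverage_and_integral hN n m).1.const_mul _
  have hVval : ∀ n, ∫ t in Set.Ioi 0, V n t = c n := fun n => by
    rw [hV, hc]
    simp only
    rw [integral_finsetSum _ fun m _ =>
      (integrableOn_arcAverage_and_integral hN n m).1.const_mul _]
    refine Finset.sum_congr rfl fun m _ => ?_
    rw [integral_const_mul, (integrableOn_arcAverage_and_integral hN n m).2, cyclicKernel]
  have hpt : ∀ t ∈ Set.Ioi (0 : ℝ), ∑ n ∈ Finset.range N,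
      (|c n| ^ p * (2 * bern₂ t) + l n * (V n t - c n * (2 * bern₂ t))) ≤ B * (2 * bern₂ t) := by
    intro t ht
    have h := sum_abs_arcAverage_rpow_le hp hp2 hN a ht
    rw [← hB] at h
    refine le_trans ?_ (mul_le_mul_of_nonneg_right h
      (mul_nonneg zero_le_two (bern₂_nonneg ht)))
    rw [Finset.sum_mul]
    refine Finset.sum_le_sum fun n _ => ?_
    have := mul_le_mul_of_nonneg_right (hl n (∑ m ∈ Finset.range N, a m * arcAverage N n m t))
      (mul_nonneg zero_le_two (bern₂_nonneg ht))
    refine le_trans (le_of_eq ?_) this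
    have e : V n t = (∑ m ∈ Finset.range N, a m * arcAverage N n m t) * (2 * bern₂ t) := by
      rw [hV, Finset.sum_mul]
      exact Finset.sum_congr rfl fun m _ => by ring
    rw [e]
    ring
  have hw : IntegrableOn (fun t => 2 * bern₂ t) (Set.Ioi 0) := integrableOn_bern₂.const_mul 2
  have hw1 : ∫ t in Set.Ioi 0, 2 * bern₂ t = 1 := by
    rw [integral_const_mul, integral_bern₂]
    norm_num
  have hterm : ∀ n, IntegrableOn (fun t =>
      |c n| ^ p * (2 * bern₂ t) + l n * (V n t - c n * (2 * bern₂ t))) (Set.Ioi 0) := fun n =>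
    (hw.const_mul _).add (((hVint n).sub (hw.const_mul _)).const_mul _)
  have hI := setIntegral_mono_on (integrable_finsetSum _ fun n _ => hterm n) (hw.const_mul B)
    measurableSet_Ioi hpt
  rw [integral_const_mul, hw1, mul_one, integral_finsetSum _ fun n _ => hterm n] at hI
  rw [← hB]
  refine le_trans (le_of_eq (Finset.sum_congr rfl fun n _ => ?_)) hI
  have hd : IntegrableOn (fun t => V n t - c n * (2 * bern₂ t)) (Set.Ioi 0) :=
    (hVint n).sub (hw.const_mul _)
  rw [integral_add (hw.const_mul _) (hd.const_mul _), integral_const_mul (|c n| ^ p),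
    integral_const_mul (l n), integral_sub (hVint n) (hw.const_mul _), integral_const_mul (c n),
    hw1, hVval, hc]
  ring

theorem sum_range_mul_sin (α : ℝ) (n : ℕ) :
    4 * Real.sin (α / 2) ^ 2 * ∑ j ∈ Finset.range n, (j : ℝ) * Real.sin (j * α) =
      Real.sin ((n - 1) * α) - 2 * Real.sin (α / 2) * ((n - 1) * Real.cos ((n - 1 / 2) * α))
        - 2 * Real.sin (α / 2) * Real.cos (α / 2) + Real.sin α := by
  induction n with
  | zero =>
    have e1 : ((0 : ℕ) - 1 : ℝ) * α = -α := by simp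
    have e2 : ((0 : ℕ) - 1 / 2 : ℝ) * α = -(α / 2) := by push_cast; ring
    rw [e1, e2, Real.sin_neg, Real.cos_neg]
    simp
  | succ n ih =>
    rw [Finset.sum_range_succ, mul_add, ih]
    obtain ⟨β, hβ⟩ : ∃ β, β = α / 2 := ⟨_, rfl⟩
    have hα : α = 2 * β := by rw [hβ]; ring
    have e1 : ((n : ℝ) - 1) * α = n * α - 2 * β := by rw [hα]; ring
    have e2 : ((n : ℝ) - 1 / 2) * α = n * α - β := by rw [hα]; ring
    have e3 : (((n + 1 : ℕ) : ℝ) - 1) * α = n * α := by push_cast; ring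
    have e4 : (((n + 1 : ℕ) : ℝ) - 1 / 2) * α = n * α + β := by rw [hα]; push_cast; ring
    rw [e1, e2, e3, e4, ← hβ, Real.sin_sub, Real.cos_sub, Real.cos_add, Real.cos_two_mul,
      Real.sin_two_mul]
    have h := Real.sin_sq_add_cos_sq β
    have h2 : Real.cos β ^ 2 = 1 - Real.sin β ^ 2 := by linarith
    rw [h2]
    push_cast
    ring

theorem sum_range_sin (α : ℝ) (n : ℕ) :
    2 * Real.sin (α / 2) * ∑ j ∈ Finset.range n, Real.sin (j * α) =
      Real.cos (α / 2) - Real.cos ((n - 1 / 2) * α) := by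
  induction n with
  | zero =>
    have e2 : ((0 : ℕ) - 1 / 2 : ℝ) * α = -(α / 2) := by push_cast; ring
    rw [e2, Real.cos_neg]
    simp
  | succ n ih =>
    rw [Finset.sum_range_succ, mul_add, ih]
    obtain ⟨β, hβ⟩ : ∃ β, β = α / 2 := ⟨_, rfl⟩
    have hα : α = 2 * β := by rw [hβ]; ring
    have e2 : ((n : ℝ) - 1 / 2) * α = n * α - β := by rw [hα]; ring
    have e4 : (((n + 1 : ℕ) : ℝ) - 1 / 2) * α = n * α + β := by rw [hα]; push_cast; ring
    rw [e2, e4, ← hβ, Real.cos_sub, Real.cos_add]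
    ring

theorem cyclicKernel_eq {N : ℕ} (hN : 0 < N) {d : ℤ} (hd : Real.sin (Real.pi * d / N) ≠ 0) :
    cyclicKernel N d = Real.cos (Real.pi * d / N) / (N * Real.sin (Real.pi * d / N)) := by
  have hN' : (N : ℝ) ≠ 0 := by positivity
  obtain ⟨β, hβ⟩ : ∃ β, β = Real.pi * d / N := ⟨_, rfl⟩
  have hα : (2 * β) / 2 = β := by ring
  have h1 := sum_range_mul_sin (2 * β) N
  have h2 := sum_range_sin (2 * β) N
  have hNβ : (N : ℝ) * (2 * β) = (d : ℝ) * (2 * Real.pi) := by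
    rw [hβ]
    field_simp
  have e1 : ((N : ℝ) - 1) * (2 * β) = -(2 * β) + (d : ℝ) * (2 * Real.pi) := by
    rw [← hNβ]; ring
  have e2 : ((N : ℝ) - 1 / 2) * (2 * β) = -β + (d : ℝ) * (2 * Real.pi) := by
    rw [← hNβ]; ring
  rw [e1, e2, hα, Real.sin_add_int_mul_two_pi, Real.cos_add_int_mul_two_pi, Real.sin_neg,
    Real.cos_neg, Real.sin_two_mul] at h1
  rw [e2, hα, Real.cos_add_int_mul_two_pi, Real.cos_neg, sub_self] at h2
  rw [← hβ] at hd ⊢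
  have hs0 : ∑ j ∈ Finset.range N, Real.sin (j * (2 * β)) = 0 := by simpa [hd] using h2
  have hs1 : ∑ j ∈ Finset.range N, (j : ℝ) * Real.sin (j * (2 * β)) =
      -(N * Real.cos β) / (2 * Real.sin β) := by
    rw [eq_div_iff (by simpa using hd)]
    have : Real.sin β * (2 * (Real.sin β * ∑ j ∈ Finset.range N,
        (j : ℝ) * Real.sin (j * (2 * β)))) = Real.sin β * -(N * Real.cos β) := by linarith
    have := mul_left_cancel₀ hd this
    linarith
  have hk : cyclicKernel N d = 1 / N * (∑ j ∈ Finset.range N, Real.sin (j * (2 * β)) -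
      2 / N * ∑ j ∈ Finset.range N, (j : ℝ) * Real.sin (j * (2 * β))) := by
    rw [cyclicKernel, Finset.mul_sum (a := 2 / (N : ℝ)), ← Finset.sum_sub_distrib]
    congr 1
    refine Finset.sum_congr rfl fun j _ => ?_
    have : 2 * Real.pi * j * d / N = j * (2 * β) := by rw [hβ]; ring
    rw [this]
    ring
  rw [hk, hs0, hs1]
  field_simp
  ring

theorem tendsto_cyclicKernel (d : ℤ) :
    Filter.Tendsto (fun N : ℕ => cyclicKernel N d) Filter.atTop (nhds (1 / (Real.pi * d))) := by
  rcases eq_or_ne d 0 with rfl | hd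
  · simp [cyclicKernel]
  have hd' : (d : ℝ) ≠ 0 := by exact_mod_cast hd
  have hx : Real.pi * (d : ℝ) ≠ 0 := mul_ne_zero Real.pi_ne_zero hd'
  obtain ⟨x, hxd⟩ : ∃ x, x = Real.pi * (d : ℝ) := ⟨_, rfl⟩
  rw [← hxd] at hx ⊢
  have hN : Filter.Tendsto (fun N : ℕ => x / (N : ℝ)) Filter.atTop (nhds 0) :=
    tendsto_const_div_atTop_nhds_zero_nat x
  have hN' : Filter.Tendsto (fun N : ℕ => x / (N : ℝ)) Filter.atTop (nhdsWithin 0 {0}ᶜ) := by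
    refine tendsto_nhdsWithin_iff.2 ⟨hN, ?_⟩
    filter_upwards [Filter.eventually_gt_atTop 0] with N hN
    have : (N : ℝ) ≠ 0 := by positivity
    simp [hx, this]
  have hsinc : Filter.Tendsto (fun N : ℕ => Real.sinc (x / N)) Filter.atTop (nhds 1) := by
    have := (Real.continuous_sinc.tendsto 0).comp hN
    simpa [Function.comp_def] using this
  have hcos : Filter.Tendsto (fun N : ℕ => Real.cos (x / N)) Filter.atTop (nhds 1) := by
    have := (Real.continuous_cos.tendsto 0).comp hN
    simpa [Function.comp_def] using this
  have hlim := (hcos.div hsinc one_ne_zero).const_mul (1 / x)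
  rw [div_one, mul_one] at hlim
  refine hlim.congr' ?_
  filter_upwards [Filter.eventually_gt_atTop 0, hsinc.eventually_ne one_ne_zero] with N h0 h1
  have hNr : (N : ℝ) ≠ 0 := by positivity
  have hxN : x / N ≠ 0 := div_ne_zero hx hNr
  rw [Real.sinc_of_ne_zero hxN] at h1
  have hs : Real.sin (x / N) ≠ 0 := fun h => h1 (by rw [h, zero_div])
  rw [hxd] at hs
  rw [cyclicKernel_eq h0 hs, ← hxd, Pi.div_apply, Real.sinc_of_ne_zero hxN]
  rw [← hxd] at hs
  field_simp

theorem sum_range_abs_hilbert_rpow_le {p : ℝ} (hp : 1 < p) (hp2 : p ≤ 2) (M : ℕ) (a : ℕ → ℝ) :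
    ∑ n ∈ Finset.range M,
      |∑ m ∈ Finset.range M, a m * (1 / (Real.pi * ((n : ℝ) - m)))| ^ p ≤
      Real.tan (Real.pi / (2 * p)) ^ p * ∑ m ∈ Finset.range M, |a m| ^ p := by
  have hlim : Filter.Tendsto (fun N : ℕ => ∑ n ∈ Finset.range M,
      |∑ m ∈ Finset.range M, a m * cyclicKernel N (n - m)| ^ p) Filter.atTop
      (nhds (∑ n ∈ Finset.range M,
      |∑ m ∈ Finset.range M, a m * (1 / (Real.pi * ((n : ℝ) - m)))| ^ p)) := by
    refine tendsto_finsetSum _ fun n _ => ?_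
    refine Filter.Tendsto.rpow_const ?_ (Or.inr (by linarith))
    refine Filter.Tendsto.abs (tendsto_finsetSum _ fun m _ => Filter.Tendsto.const_mul _ ?_)
    simpa using tendsto_cyclicKernel ((n : ℤ) - m)
  refine le_of_tendsto hlim ?_
  filter_upwards [Filter.eventually_gt_atTop M] with N hN
  have hsub : Finset.range M ⊆ Finset.range N := Finset.range_subset_range.2 hN.le
  have h := sum_abs_cyclicKernel_rpow_le hp hp2 (M.zero_le.trans_lt hN)
    (fun m => if m ∈ Finset.range M then a m else 0)
  have e1 : ∀ n, ∑ m ∈ Finset.range N,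
      (if m ∈ Finset.range M then a m else 0) * cyclicKernel N (n - m) =
      ∑ m ∈ Finset.range M, a m * cyclicKernel N (n - m) := fun n => by
    rw [← Finset.sum_subset hsub]
    · exact Finset.sum_congr rfl fun m hm => by rw [if_pos hm]
    · intro m _ hm
      rw [if_neg hm, zero_mul]
  have e2 : ∑ m ∈ Finset.range N, |if m ∈ Finset.range M then a m else 0| ^ p =
      ∑ m ∈ Finset.range M, |a m| ^ p := by
    rw [← Finset.sum_subset hsub]
    · exact Finset.sum_congr rfl fun m hm => by rw [if_pos hm]
    · intro m _ hm
      rw [if_neg hm, abs_zero, Real.zero_rpow (by linarith)]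
  rw [e2] at h
  refine le_trans ?_ h
  simp only [e1]
  exact Finset.sum_le_sum_of_subset_of_nonneg hsub fun n _ _ => Real.rpow_nonneg (abs_nonneg _) _

theorem sum_Ico_neg_eq_sum_range {E : Type*} [AddCommMonoid E] (L : ℕ) (f : ℤ → E) :
    ∑ k ∈ Finset.Ico (-(L : ℤ)) L, f k = ∑ j ∈ Finset.range (2 * L), f ((j : ℤ) - L) := by
  symm
  refine Finset.sum_nbij (fun j : ℕ => (j : ℤ) - L) (fun j hj => ?_) (fun i _ j _ h => ?_)
    (fun k hk => ?_) fun _ _ => rfl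
  · have := Finset.mem_range.1 hj
    exact Finset.mem_Ico.2 (by omega)
  · simp only at h
    omega
  · have := Finset.mem_Ico.1 (Finset.mem_coe.1 hk)
    exact ⟨(k + L).toNat, Finset.mem_coe.2 (Finset.mem_range.2 (by omega)), by
      simp only; omega⟩

theorem sum_abs_hilbert_rpow_le_of_le_two {p : ℝ} (hp : 1 < p) (hp2 : p ≤ 2) (s : Finset ℤ)
    (a : ℤ → ℝ) :
    ∑ n ∈ s, |∑ m ∈ s, a m * (1 / (Real.pi * ((n : ℝ) - m)))| ^ p ≤
      Real.tan (Real.pi / (2 * p)) ^ p * ∑ m ∈ s, |a m| ^ p := by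
  obtain ⟨L, hL⟩ : ∃ L : ℕ, s ⊆ Finset.Ico (-(L : ℤ)) L := by
    refine ⟨s.sup Int.natAbs + 1, fun x hx => ?_⟩
    have : x.natAbs ≤ s.sup Int.natAbs := Finset.le_sup hx
    exact Finset.mem_Ico.2 (by omega)
  have h := sum_range_abs_hilbert_rpow_le hp hp2 (2 * L)
    (fun j => if (j : ℤ) - L ∈ s then a ((j : ℤ) - L) else 0)
  have e1 : ∀ n : ℤ, ∑ j ∈ Finset.range (2 * L), (if (j : ℤ) - L ∈ s then a ((j : ℤ) - L) else 0) *
      (1 / (Real.pi * ((n : ℝ) - (((j : ℤ) - L : ℤ) : ℝ)))) =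
      ∑ m ∈ s, a m * (1 / (Real.pi * ((n : ℝ) - m))) := fun n => by
    rw [← sum_Ico_neg_eq_sum_range L fun m : ℤ => (if m ∈ s then a m else 0) *
      (1 / (Real.pi * ((n : ℝ) - m))), ← Finset.sum_subset hL]
    · exact Finset.sum_congr rfl fun m hm => by rw [if_pos hm]
    · intro m _ hm
      rw [if_neg hm, zero_mul]
  have e2 : ∑ j ∈ Finset.range (2 * L), |if (j : ℤ) - L ∈ s then a ((j : ℤ) - L) else 0| ^ p =
      ∑ m ∈ s, |a m| ^ p := by
    rw [← sum_Ico_neg_eq_sum_range L fun m : ℤ => |if m ∈ s then a m else 0| ^ p,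
      ← Finset.sum_subset hL]
    · exact Finset.sum_congr rfl fun m hm => by rw [if_pos hm]
    · intro m _ hm
      rw [if_neg hm, abs_zero, Real.zero_rpow (by linarith)]
  have e3 : ∀ i j : ℕ, (i : ℝ) - j = (((i : ℤ) - L : ℤ) : ℝ) - (((j : ℤ) - L : ℤ) : ℝ) :=
    fun i j => by push_cast; ring
  simp only [e3, e1] at h
  rw [e2, ← sum_Ico_neg_eq_sum_range L fun n : ℤ =>
    |∑ m ∈ s, a m * (1 / (Real.pi * ((n : ℝ) - m)))| ^ p] at h
  exact (Finset.sum_le_sum_of_subset_of_nonneg hL fun n _ _ =>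
    Real.rpow_nonneg (abs_nonneg _) _).trans h

/-- Duality on a finite set: an antisymmetric kernel has the same bound for conjugate exponents. -/
theorem sum_abs_rpow_le_of_holderConjugate {ι : Type*} {p q C : ℝ} (hpq : p.HolderConjugate q)
    (hC : 0 ≤ C) (s : Finset ι) (k : ι → ι → ℝ) (hk : ∀ i j, k i j = -k j i)
    (H : ∀ a : ι → ℝ, ∑ n ∈ s, |∑ m ∈ s, a m * k n m| ^ p ≤ C ^ p * ∑ m ∈ s, |a m| ^ p)
    (b : ι → ℝ) :
    ∑ n ∈ s, |∑ m ∈ s, b m * k n m| ^ q ≤ C ^ q * ∑ m ∈ s, |b m| ^ q := by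
  obtain ⟨c, hc⟩ : ∃ c : ι → ℝ, c = fun n => ∑ m ∈ s, b m * k n m := ⟨_, rfl⟩
  obtain ⟨g, hg⟩ : ∃ g : ι → ℝ, g = fun n =>
    if 0 ≤ c n then |c n| ^ (q - 1) else -|c n| ^ (q - 1) := ⟨_, rfl⟩
  have hp1 := hpq.lt
  have hq1 := hpq.symm.lt
  have hgabs : ∀ n, |g n| = |c n| ^ (q - 1) := fun n => by
    have := Real.rpow_nonneg (abs_nonneg (c n)) (q - 1)
    simp only [hg]
    split_ifs
    · exact abs_of_nonneg this
    · rw [abs_neg, abs_of_nonneg this]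
  have hgp : ∀ n, |g n| ^ p = |c n| ^ q := fun n => by
    rw [hgabs, ← Real.rpow_mul (abs_nonneg _), hpq.symm.sub_one_mul_conj]
  have hgc : ∀ n, g n * c n = |c n| ^ q := fun n => by
    have h1 : |c n| ^ (q - 1) * |c n| = |c n| ^ q := by
      rw [← Real.rpow_add_one' (abs_nonneg _) (by linarith), sub_add_cancel]
    rw [← h1]
    simp only [hg]
    split_ifs with h
    · rw [abs_of_nonneg h]
    · rw [abs_of_neg (not_le.1 h)]
      ring
  obtain ⟨X, hX⟩ : ∃ X, X = ∑ n ∈ s, |c n| ^ q := ⟨_, rfl⟩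
  obtain ⟨B, hB⟩ : ∃ B, B = ∑ m ∈ s, |b m| ^ q := ⟨_, rfl⟩
  have hX0 : 0 ≤ X := hX ▸ Finset.sum_nonneg fun n _ => Real.rpow_nonneg (abs_nonneg _) _
  have hB0 : 0 ≤ B := hB ▸ Finset.sum_nonneg fun n _ => Real.rpow_nonneg (abs_nonneg _) _
  have hXeq : X = ∑ m ∈ s, b m * -∑ n ∈ s, g n * k m n := by
    rw [hX, Finset.sum_congr rfl fun n _ => (hgc n).symm]
    simp only [hc, Finset.mul_sum, ← Finset.sum_neg_distrib]
    rw [Finset.sum_comm]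
    refine Finset.sum_congr rfl fun m _ => Finset.sum_congr rfl fun n _ => ?_
    rw [hk n m]
    ring
  have hHg := H g
  simp only [hgp] at hHg
  rw [← hX] at hHg
  have hXle : X ≤ B ^ (1 / q) * (C * X ^ (1 / p)) := by
    have h1 := Real.inner_le_Lp_mul_Lq s b (fun m => -∑ n ∈ s, g n * k m n) hpq.symm
    rw [← hXeq, ← hB] at h1
    simp only [abs_neg] at h1
    refine h1.trans (mul_le_mul_of_nonneg_left ?_ (Real.rpow_nonneg hB0 _))
    have hp0 : (0 : ℝ) ≤ 1 / p := by positivity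
    refine (Real.rpow_le_rpow (Finset.sum_nonneg fun n _ => Real.rpow_nonneg (abs_nonneg _) _)
      hHg hp0).trans_eq ?_
    rw [Real.mul_rpow (Real.rpow_nonneg hC _) hX0, ← Real.rpow_mul hC,
      mul_one_div_cancel (by linarith), Real.rpow_one]
  change ∑ n ∈ s, |(fun n => ∑ m ∈ s, b m * k n m) n| ^ q ≤ _
  rw [← hc, ← hX, ← hB]
  rcases hX0.eq_or_lt with h0 | hXpos
  · rw [← h0]
    exact mul_nonneg (Real.rpow_nonneg hC _) hB0
  have hXp : 0 < X ^ (1 / p) := Real.rpow_pos_of_pos hXpos _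
  have hsplit : X = X ^ (1 / q) * X ^ (1 / p) := by
    rw [← Real.rpow_add hXpos, one_div, one_div, hpq.symm.inv_add_inv_eq_one, Real.rpow_one]
  have hfin : X ^ (1 / q) ≤ C * B ^ (1 / q) := by
    refine le_of_mul_le_mul_right ?_ hXp
    rw [← hsplit]
    linarith
  have := Real.rpow_le_rpow (Real.rpow_nonneg hX0 _) hfin (by linarith : 0 ≤ q)
  rwa [Real.mul_rpow hC (Real.rpow_nonneg hB0 _), ← Real.rpow_mul hX0, ← Real.rpow_mul hB0,
    one_div_mul_cancel (by linarith), Real.rpow_one, Real.rpow_one] at this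

theorem integral_abs_re_exp_mul_rpow (p : ℝ) (z : ℂ) :
    ∫ θ in (0 : ℝ)..2 * Real.pi, |(Complex.exp (θ * Complex.I) * z).re| ^ p =
      ‖z‖ ^ p * ∫ θ in (0 : ℝ)..2 * Real.pi, |Real.cos θ| ^ p := by
  have e : ∀ θ : ℝ, |(Complex.exp (θ * Complex.I) * z).re| ^ p =
      ‖z‖ ^ p * |Real.cos (θ + z.arg)| ^ p := fun θ => by
    conv_lhs => rw [← Complex.norm_mul_exp_arg_mul_I z]
    rw [mul_left_comm, ← Complex.exp_add, ← add_mul, Complex.re_ofReal_mul, ← Complex.ofReal_add,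
      Complex.exp_ofReal_mul_I_re, abs_mul, abs_of_nonneg (norm_nonneg z),
      Real.mul_rpow (norm_nonneg z) (abs_nonneg _)]
  simp only [e]
  rw [intervalIntegral.integral_const_mul,
    intervalIntegral.integral_comp_add_right (fun θ => |Real.cos θ| ^ p)]
  have hper : Function.Periodic (fun θ => |Real.cos θ| ^ p) (2 * Real.pi) := fun θ => by
    simp only [Real.cos_add_two_pi]
  have := hper.intervalIntegral_add_eq (0 + z.arg) 0
  rw [zero_add (2 * Real.pi)] at this
  rw [← this]
  congr 2
  ring

theorem integral_abs_cos_rpow_pos {p : ℝ} (hp : 0 < p) :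
    0 < ∫ θ in (0 : ℝ)..2 * Real.pi, |Real.cos θ| ^ p := by
  refine intervalIntegral.integral_pos (by positivity)
    (Real.continuous_cos.abs.rpow_const fun _ => Or.inr hp.le).continuousOn
    (fun θ _ => Real.rpow_nonneg (abs_nonneg _) _) ⟨0, ⟨le_rfl, by positivity⟩, ?_⟩
  simp

/-- A real kernel has the same `ℓ^p` bound on complex sequences as on real ones. -/
theorem sum_norm_rpow_le_of_real {ι : Type*} {p C : ℝ} (hp : 0 < p) (s : Finset ι)
    (k : ι → ι → ℝ)
    (H : ∀ a : ι → ℝ, ∑ n ∈ s, |∑ m ∈ s, a m * k n m| ^ p ≤ C * ∑ m ∈ s, |a m| ^ p)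
    (a : ι → ℂ) :
    ∑ n ∈ s, ‖∑ m ∈ s, a m * (k n m : ℂ)‖ ^ p ≤ C * ∑ m ∈ s, ‖a m‖ ^ p := by
  have hcont : ∀ z : ℂ, Continuous fun θ : ℝ => |(Complex.exp (θ * Complex.I) * z).re| ^ p :=
    fun z => Continuous.rpow_const (by fun_prop) fun _ => Or.inr hp.le
  have hpt : ∀ θ : ℝ, ∑ n ∈ s,
      |(Complex.exp (θ * Complex.I) * ∑ m ∈ s, a m * (k n m : ℂ)).re| ^ p ≤
      C * ∑ m ∈ s, |(Complex.exp (θ * Complex.I) * a m).re| ^ p := fun θ => by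
    refine le_trans (le_of_eq (Finset.sum_congr rfl fun n _ => ?_))
      (H fun m => (Complex.exp (θ * Complex.I) * a m).re)
    rw [Finset.mul_sum, Complex.re_sum]
    congr 2
    refine Finset.sum_congr rfl fun m _ => ?_
    rw [← mul_assoc, Complex.re_mul_ofReal]
  have hI := intervalIntegral.integral_mono_on (by positivity : (0 : ℝ) ≤ 2 * Real.pi)
    ((continuous_finsetSum s fun n _ => hcont _).intervalIntegrable (μ := volume) _ _)
    (((continuous_finsetSum s fun m _ => hcont _).const_mul C).intervalIntegrable (μ := volume) _ _)
    fun θ _ => hpt θ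
  rw [intervalIntegral.integral_const_mul,
    intervalIntegral.integral_finsetSum fun n _ => (hcont _).intervalIntegrable _ _,
    intervalIntegral.integral_finsetSum fun n _ => (hcont _).intervalIntegrable _ _] at hI
  simp only [integral_abs_re_exp_mul_rpow p] at hI
  rw [← Finset.sum_mul, ← Finset.sum_mul, ← mul_assoc] at hI
  exact le_of_mul_le_mul_right hI (integral_abs_cos_rpow_pos hp)

theorem Cconst_of_le_two {p : ℝ} (hp : 1 < p) (hp2 : p ≤ 2) :
    Cconst p = Real.tan (Real.pi / (2 * p)) := by
  have h1 : 0 < p - 1 := by linarith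
  have : pstar p = p / (p - 1) := by
    rw [pstar, max_eq_right]
    rw [le_div_iff₀ h1]
    nlinarith
  have harg : Real.pi / (2 * (p / (p - 1))) = Real.pi / 2 - Real.pi / (2 * p) := by
    field_simp
  rw [Cconst, this, harg, Real.cot_eq_cos_div_sin, Real.cos_pi_div_two_sub,
    Real.sin_pi_div_two_sub, Real.tan_eq_sin_div_cos]

theorem Cconst_conj {p q : ℝ} (hpq : p.HolderConjugate q) : Cconst p = Cconst q := by
  have h1 := hpq.lt
  have h2 := hpq.symm.lt
  have : pstar p = pstar q := by
    rw [pstar, pstar, ← hpq.conjugate_eq, ← hpq.symm.conjugate_eq, max_comm]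
  rw [Cconst, Cconst, this]

theorem Cconst_nonneg {p : ℝ} (hp : 1 < p) : 0 ≤ Cconst p := by
  have h2 : 2 ≤ pstar p := by
    rw [pstar, le_max_iff]
    by_contra! h
    rw [div_lt_iff₀ (by linarith)] at h
    linarith [h.1, h.2]
  rw [Cconst, Real.cot_eq_cos_div_sin]
  have hle : Real.pi / (2 * pstar p) ≤ Real.pi / 2 := by
    gcongr
    linarith
  have hpi := Real.pi_pos
  have h0 : 0 ≤ Real.pi / (2 * pstar p) := by positivity
  exact div_nonneg (Real.cos_nonneg_of_mem_Icc ⟨by linarith, hle⟩)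
    (Real.sin_nonneg_of_nonneg_of_le_pi h0 (by linarith))

theorem sum_norm_hilbert_rpow_le {q : ℝ} (hq : 1 < q) (s : Finset ℤ) (a : ℤ → ℂ) :
    ∑ n ∈ s, ‖∑ m ∈ s, a m * ((1 / (Real.pi * ((n : ℝ) - m)) : ℝ) : ℂ)‖ ^ q ≤
      Cconst q ^ q * ∑ m ∈ s, ‖a m‖ ^ q := by
  refine sum_norm_rpow_le_of_real (by linarith) s
    (fun n m : ℤ => 1 / (Real.pi * ((n : ℝ) - m))) (fun b => ?_) a
  rcases le_total q 2 with h2 | h2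
  · rw [Cconst_of_le_two hq h2]
    exact sum_abs_hilbert_rpow_le_of_le_two hq h2 s b
  · have hpq := (Real.HolderConjugate.conjExponent hq).symm
    have hp2 : q.conjExponent ≤ 2 := by
      rw [Real.conjExponent, div_le_iff₀ (by linarith)]
      linarith
    refine sum_abs_rpow_le_of_holderConjugate hpq (Cconst_nonneg hq) s
      (fun n m : ℤ => 1 / (Real.pi * ((n : ℝ) - m))) (fun i j => ?_) (fun c => ?_) b
    · rw [← neg_sub (j : ℝ), mul_neg, one_div, one_div, inv_neg]
    · rw [← Cconst_conj hpq, Cconst_of_le_two hpq.lt hp2]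
      exact sum_abs_hilbert_rpow_le_of_le_two hpq.lt hp2 s c

/-! ### Kernel operators on finite windows -/

/-- The `ℓ^q` norm over a finite window. -/
def finNorm (q : ℝ) (s : Finset ℤ) (f : ℤ → ℂ) : ℝ := (∑ n ∈ s, ‖f n‖ ^ q) ^ (1 / q)

/-- The convolution with the kernel `k`, restricted to inputs in a finite window. -/
def finConv (k : ℤ → ℝ) (s : Finset ℤ) (a : ℤ → ℂ) (n : ℤ) : ℂ := ∑ m ∈ s, a m * (k (n - m) : ℂ)

/-- The convolution with `k` has norm at most `C` on `ℓ^q` of every finite window. -/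
def KernelBound (k : ℤ → ℝ) (q C : ℝ) : Prop :=
  ∀ (s : Finset ℤ) (a : ℤ → ℂ), finNorm q s (finConv k s a) ≤ C * finNorm q s a

theorem sum_norm_rpow_nonneg (q : ℝ) (s : Finset ℤ) (f : ℤ → ℂ) : 0 ≤ ∑ n ∈ s, ‖f n‖ ^ q :=
  Finset.sum_nonneg fun _ _ => Real.rpow_nonneg (norm_nonneg _) _

theorem finNorm_nonneg (q : ℝ) (s : Finset ℤ) (f : ℤ → ℂ) : 0 ≤ finNorm q s f :=
  Real.rpow_nonneg (sum_norm_rpow_nonneg q s f) _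

theorem finNorm_rpow {q : ℝ} (hq : 0 < q) (s : Finset ℤ) (f : ℤ → ℂ) :
    finNorm q s f ^ q = ∑ n ∈ s, ‖f n‖ ^ q := by
  rw [finNorm, ← Real.rpow_mul (sum_norm_rpow_nonneg q s f), one_div_mul_cancel hq.ne',
    Real.rpow_one]

theorem finNorm_le_mul_iff {q C : ℝ} (hq : 0 < q) (hC : 0 ≤ C) (s : Finset ℤ) (f g : ℤ → ℂ) :
    finNorm q s f ≤ C * finNorm q s g ↔
      ∑ n ∈ s, ‖f n‖ ^ q ≤ C ^ q * ∑ n ∈ s, ‖g n‖ ^ q := by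
  rw [← finNorm_rpow hq, ← finNorm_rpow hq, ← Real.mul_rpow hC (finNorm_nonneg _ _ _),
    Real.rpow_le_rpow_iff (finNorm_nonneg _ _ _) (mul_nonneg hC (finNorm_nonneg _ _ _)) hq]

theorem finNorm_congr {q : ℝ} {s : Finset ℤ} {f g : ℤ → ℂ} (h : ∀ n ∈ s, ‖f n‖ = ‖g n‖) :
    finNorm q s f = finNorm q s g := by
  rw [finNorm, finNorm, Finset.sum_congr rfl fun n hn => by rw [h n hn]]

theorem finNorm_add_le {q : ℝ} (hq : 1 ≤ q) (s : Finset ℤ) (f g : ℤ → ℂ) :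
    finNorm q s (fun n => f n + g n) ≤ finNorm q s f + finNorm q s g := by
  refine le_trans ?_ (Real.Lp_add_le_of_nonneg s hq (fun n _ => norm_nonneg (f n))
    fun n _ => norm_nonneg (g n))
  refine Real.rpow_le_rpow (sum_norm_rpow_nonneg q s _) (Finset.sum_le_sum fun n _ =>
    Real.rpow_le_rpow (norm_nonneg _) (norm_add_le _ _) (by linarith)) (by positivity)

theorem finNorm_sum_le {ι : Type*} {q : ℝ} (hq : 1 ≤ q) (s : Finset ℤ) (t : Finset ι)
    (f : ι → ℤ → ℂ) :
    finNorm q s (fun n => ∑ i ∈ t, f i n) ≤ ∑ i ∈ t, finNorm q s (f i) := by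
  classical
  induction t using Finset.induction_on with
  | empty =>
    have hq0 : q ≠ 0 := by linarith
    simp [finNorm, Real.zero_rpow hq0, Real.zero_rpow (inv_ne_zero hq0)]
  | insert i t hi ih =>
    simp only [Finset.sum_insert hi]
    exact (finNorm_add_le hq s (f i) fun n => ∑ i ∈ t, f i n).trans (by gcongr)

theorem finNorm_mul_le {p q r : ℝ} (h : p.HolderTriple q r) (s : Finset ℤ) (f g : ℤ → ℂ) :
    finNorm r s (fun n => f n * g n) ≤ finNorm p s f * finNorm q s g := by
  have h1 := Real.Lr_rpow_le_Lp_mul_Lq_of_nonneg s h (fun n _ => norm_nonneg (f n))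
    fun n _ => norm_nonneg (g n)
  have hr : 0 < r := h.pos'
  simp only [← norm_mul] at h1
  have h2 := Real.rpow_le_rpow (sum_norm_rpow_nonneg r s _) h1 (by positivity : 0 ≤ 1 / r)
  rw [Real.mul_rpow (Real.rpow_nonneg (sum_norm_rpow_nonneg _ _ _) _)
    (Real.rpow_nonneg (sum_norm_rpow_nonneg _ _ _) _),
    ← Real.rpow_mul (sum_norm_rpow_nonneg _ _ _), ← Real.rpow_mul (sum_norm_rpow_nonneg _ _ _)]
    at h2
  have e : ∀ x : ℝ, r / x * (1 / r) = 1 / x := fun x => by field_simp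
  rwa [e, e] at h2

theorem finNorm_pow {q : ℝ} (s : Finset ℤ) (f : ℤ → ℂ) {k : ℕ} (hk : 1 ≤ k) :
    finNorm (q / k) s (fun n => f n ^ k) = finNorm q s f ^ k := by
  have hk0 : (k : ℝ) ≠ 0 := by positivity
  simp only [finNorm, norm_pow, ← Real.rpow_natCast]
  simp only [← Real.rpow_mul (norm_nonneg _)]
  rw [← Real.rpow_mul (sum_norm_rpow_nonneg q s f), mul_div_cancel₀ q hk0, one_div_div]
  congr 1
  ring

/-- The kernel of `H0T`. -/
def kerH0 (d : ℤ) : ℝ := 1 / (Real.pi * d)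

/-- The kernel of `HT`. -/
def kerH (d : ℤ) : ℝ := if Even d then 2 / (Real.pi * d) else 0

/-- The kernel of `KT`. -/
def kerK (d : ℤ) : ℝ := if Odd d then 2 / (Real.pi * d) else 0

/-- The kernel of `IT`. -/
def kerI (d : ℤ) : ℝ := if Odd d then 4 / (Real.pi ^ 2 * d ^ 2) else 0

theorem kerK_eq (d : ℤ) : kerK d = 2 * kerH0 d - kerH d := by
  rcases Int.even_or_odd d with h | h
  · rw [kerK, kerH, kerH0, if_pos h, if_neg (Int.not_odd_iff_even.2 h)]
    ring
  · rw [kerK, kerH, kerH0, if_pos h, if_neg (Int.not_even_iff_odd.2 h)]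
    ring

theorem kernelBound_kerH0 {q : ℝ} (hq : 1 < q) : KernelBound kerH0 q (Cconst q) := fun s a => by
  rw [finNorm_le_mul_iff (by linarith) (Cconst_nonneg hq)]
  simpa only [finConv, kerH0, Int.cast_sub] using sum_norm_hilbert_rpow_le hq s a

theorem two_mul_injective : Function.Injective fun j : ℤ => 2 * j := fun i j h => by
  simpa using h

theorem two_mul_add_one_injective : Function.Injective fun j : ℤ => 2 * j + 1 := fun i j h => by
  simpa using h

theorem sum_eq_even_add_odd {M : Type*} [AddCommMonoid M] (s : Finset ℤ) (f : ℤ → M) :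
    ∑ n ∈ s, f n =
      ∑ j ∈ s.preimage (fun j => 2 * j) two_mul_injective.injOn, f (2 * j) +
      ∑ j ∈ s.preimage (fun j => 2 * j + 1) two_mul_add_one_injective.injOn, f (2 * j + 1) := by
  classical
  rw [Finset.sum_preimage' (fun j : ℤ => 2 * j) s two_mul_injective.injOn f,
    Finset.sum_preimage' (fun j : ℤ => 2 * j + 1) s two_mul_add_one_injective.injOn f,
    ← Finset.sum_filter_add_sum_filter_not s fun n => n ∈ Set.range fun j : ℤ => 2 * j]
  congr 2
  ext n
  simp only [Finset.mem_filter, Set.mem_range]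
  refine and_congr_right fun _ => ⟨fun h => ?_, ?_⟩
  · rcases Int.even_or_odd' n with ⟨j, hj | hj⟩
    · exact absurd ⟨j, hj.symm⟩ h
    · exact ⟨j, hj.symm⟩
  · rintro ⟨j, rfl⟩ ⟨i, hi⟩
    omega

theorem kerH_two_mul (d : ℤ) : kerH (2 * d) = kerH0 d := by
  rw [kerH, kerH0, if_pos (even_two_mul d)]
  push_cast
  rw [mul_left_comm, ← mul_div_mul_left 1 (Real.pi * (d : ℝ)) (two_ne_zero' ℝ), mul_one]

theorem kerH_of_odd {d : ℤ} (h : Odd d) : kerH d = 0 := if_neg (Int.not_even_iff_odd.2 h)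

theorem kernelBound_kerH {q : ℝ} (hq : 1 < q) : KernelBound kerH q (Cconst q) := fun s a => by
  rw [finNorm_le_mul_iff (by linarith) (Cconst_nonneg hq)]
  have h0 := kernelBound_kerH0 hq (s.preimage (fun j => 2 * j) two_mul_injective.injOn)
    fun j => a (2 * j)
  have h1 := kernelBound_kerH0 hq
    (s.preimage (fun j => 2 * j + 1) two_mul_add_one_injective.injOn) fun j => a (2 * j + 1)
  rw [finNorm_le_mul_iff (by linarith) (Cconst_nonneg hq)] at h0 h1
  rw [sum_eq_even_add_odd s, sum_eq_even_add_odd s, mul_add]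
  refine add_le_add (le_trans (le_of_eq ?_) h0) (le_trans (le_of_eq ?_) h1)
  · refine Finset.sum_congr rfl fun i _ => ?_
    congr 2
    rw [finConv, sum_eq_even_add_odd s, finConv]
    rw [Finset.sum_eq_zero (s := s.preimage (fun j : ℤ => 2 * j + 1) _), add_zero]
    · refine Finset.sum_congr rfl fun j _ => ?_
      rw [← mul_sub, kerH_two_mul]
    · intro j _
      rw [kerH_of_odd ⟨i - j - 1, by ring⟩, Complex.ofReal_zero, mul_zero]
  · refine Finset.sum_congr rfl fun i _ => ?_
    congr 2
    rw [finConv, sum_eq_even_add_odd s, finConv]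
    rw [Finset.sum_eq_zero (s := s.preimage (fun j : ℤ => 2 * j) _), zero_add]
    · refine Finset.sum_congr rfl fun j _ => ?_
      rw [add_sub_add_right_eq_sub, ← mul_sub, kerH_two_mul]
    · intro j _
      rw [kerH_of_odd ⟨i - j, by ring⟩, Complex.ofReal_zero, mul_zero]

theorem kernelBound_kerK {q : ℝ} (hq : 1 < q) : KernelBound kerK q (3 * Cconst q) := fun s a => by
  have h0 := kernelBound_kerH0 hq s a
  have h1 := kernelBound_kerH hq s a
  have e : ∀ n, finConv kerK s a n =
      finConv kerH0 s a n + (finConv kerH0 s a n + -finConv kerH s a n) := fun n => by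
    simp only [finConv, ← Finset.sum_neg_distrib, ← Finset.sum_add_distrib]
    refine Finset.sum_congr rfl fun m _ => ?_
    rw [kerK_eq]
    push_cast
    ring
  have h2 := finNorm_add_le hq.le s (finConv kerH0 s a) fun n =>
    finConv kerH0 s a n + -finConv kerH s a n
  have h3 := finNorm_add_le hq.le s (finConv kerH0 s a) fun n => -finConv kerH s a n
  rw [finNorm_congr (g := finConv kerH s a) (fun n _ => norm_neg _)] at h3
  rw [finNorm_congr fun n _ => congrArg norm (e n)]
  linarith

theorem kerI_nonneg (d : ℤ) : 0 ≤ kerI d := by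
  rw [kerI]
  split_ifs
  · positivity
  · exact le_rfl

theorem hasSum_kerI_odd : HasSum (fun j : ℤ => kerI (2 * j + 1)) 1 := by
  have hval : ∀ j : ℤ, kerI (2 * j + 1) = 1 / Real.pi ^ 2 * (1 / (1 / 2 + (j : ℝ)) ^ 2) := fun j => by
    have hne : (2 * (j : ℝ) + 1) ≠ 0 := by
      exact_mod_cast (by omega : 2 * j + 1 ≠ 0)
    rw [kerI, if_pos ⟨j, rfl⟩]
    push_cast
    rw [show (1 / 2 + (j : ℝ)) = (2 * j + 1) / 2 by ring]
    field_simp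
    norm_num
  have htri : trigamma (1 / 2) = Real.pi ^ 2 / 2 := by
    have := trigamma_reflection (x := 1 / 2) (by norm_num) (by norm_num)
    rw [show (1 : ℝ) - 1 / 2 = 1 / 2 by norm_num, mul_one_div, Real.sin_pi_div_two] at this
    linarith
  have h := (hasSum_trigamma (y := 1 / 2) (by norm_num)).mul_left (1 / Real.pi ^ 2)
  rw [htri, show 1 / Real.pi ^ 2 * (Real.pi ^ 2 / 2) = 1 / 2 by field_simp] at h
  have hA : HasSum (fun n : ℕ => kerI (2 * (n : ℤ) + 1)) (1 / 2) := by
    refine h.congr_fun fun n => ?_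
    rw [hval]
    simp
  have hB : HasSum (fun n : ℕ => kerI (2 * (-((n : ℤ) + 1)) + 1)) (1 / 2) := by
    refine h.congr_fun fun n => ?_
    rw [hval]
    push_cast
    rw [show (1 / 2 + (-((n : ℝ) + 1))) = -(1 / 2 + n) by ring, neg_sq]
  have := HasSum.of_nat_of_neg_add_one (f := fun j : ℤ => kerI (2 * j + 1)) hA hB
  rwa [add_halves] at this

theorem sum_kerI_le_one (s : Finset ℤ) : ∑ d ∈ s, kerI d ≤ 1 := by
  rw [sum_eq_even_add_odd, Finset.sum_eq_zero, zero_add]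
  · exact sum_le_hasSum _ (fun j _ => kerI_nonneg _) hasSum_kerI_odd
  · intro j _
    exact if_neg (Int.not_odd_iff_even.2 (even_two_mul j))

theorem kernelBound_kerI {q : ℝ} (hq : 1 < q) : KernelBound kerI q 1 := fun s a => by
  have hq0 : 0 < q := by linarith
  rw [finNorm_le_mul_iff hq0 zero_le_one, Real.one_rpow, one_mul]
  have hrow : ∀ n : ℤ, ∑ m ∈ s, kerI (n - m) ≤ 1 := fun n => by
    classical
    rw [← Finset.sum_image (f := kerI) (g := fun m => n - m) fun i _ j _ h => sub_right_injective h]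
    exact sum_kerI_le_one _
  have hcol : ∀ m : ℤ, ∑ n ∈ s, kerI (n - m) ≤ 1 := fun m => by
    classical
    rw [← Finset.sum_image (f := kerI) (g := fun n => n - m) fun i _ j _ h => sub_left_injective h]
    exact sum_kerI_le_one _
  have hpt : ∀ n, ‖finConv kerI s a n‖ ^ q ≤ ∑ m ∈ s, kerI (n - m) * ‖a m‖ ^ q := fun n => by
    have hS0 : 0 ≤ ∑ m ∈ s, kerI (n - m) * ‖a m‖ ^ q := Finset.sum_nonneg fun m _ =>
      mul_nonneg (kerI_nonneg _) (Real.rpow_nonneg (norm_nonneg _) _)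
    have h1 : ‖finConv kerI s a n‖ ≤ ∑ m ∈ s, kerI (n - m) * ‖a m‖ := by
      refine (norm_sum_le _ _).trans_eq (Finset.sum_congr rfl fun m _ => ?_)
      rw [norm_mul, Complex.norm_real, Real.norm_of_nonneg (kerI_nonneg _), mul_comm]
    have h2 := Real.inner_le_weight_mul_Lp_of_nonneg s hq.le (fun m => kerI (n - m))
      (fun m => ‖a m‖) (fun m => kerI_nonneg _) fun m => norm_nonneg _
    have h3 : (∑ m ∈ s, kerI (n - m)) ^ (1 - q⁻¹) ≤ 1 :=
      Real.rpow_le_one (Finset.sum_nonneg fun m _ => kerI_nonneg _) (hrow n)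
        (by rw [sub_nonneg]; exact inv_le_one_of_one_le₀ hq.le)
    have h4 : ‖finConv kerI s a n‖ ≤ (∑ m ∈ s, kerI (n - m) * ‖a m‖ ^ q) ^ q⁻¹ :=
      h1.trans (h2.trans (mul_le_of_le_one_left (Real.rpow_nonneg hS0 _) h3))
    refine (Real.rpow_le_rpow (norm_nonneg _) h4 hq0.le).trans_eq ?_
    rw [← Real.rpow_mul hS0, inv_mul_cancel₀ hq0.ne', Real.rpow_one]
  refine (Finset.sum_le_sum fun n _ => hpt n).trans ?_
  rw [Finset.sum_comm]
  refine Finset.sum_le_sum fun m _ => ?_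
  rw [← Finset.sum_mul]
  exact mul_le_of_le_one_left (Real.rpow_nonneg (norm_nonneg _) _) (hcol m)

/-! ### The operator norm of `KT` on finite windows -/

theorem KT_eq_tsum (a : ℤ → ℂ) (n : ℤ) : KT a n = ∑' m : ℤ, a m * (kerK (n - m) : ℂ) := by
  have h1 : (∑' m : {m : ℤ // Odd m}, a (n - (m : ℤ)) / ((m : ℤ) : ℂ)) =
      ∑' m : ℤ, {m : ℤ | Odd m}.indicator (fun m : ℤ => a (n - m) / (m : ℂ)) m :=
    tsum_subtype {m : ℤ | Odd m} fun m : ℤ => a (n - m) / (m : ℂ)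
  rw [KT, h1, ← tsum_mul_left, ← (Equiv.subLeft n).tsum_eq]
  refine tsum_congr fun m => ?_
  simp only [Equiv.subLeft_apply, Set.indicator_apply, Set.mem_ofPred_eq, sub_sub_cancel, kerK]
  split_ifs
  · push_cast
    rw [mul_div_left_comm, div_div]
  · simp

theorem abs_kerK_le (d : ℤ) : |kerK d| ≤ |(d : ℝ)|⁻¹ := by
  rw [kerK]
  split_ifs
  · rw [abs_div, abs_mul, abs_two, abs_of_pos Real.pi_pos, ← div_div, ← one_div]
    gcongr
    rw [div_le_one Real.pi_pos]
    exact Real.two_le_pi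
  · rw [abs_zero]
    positivity

theorem summable_mul_kerK {q : ℝ} (hq : 1 < q) {a : ℤ → ℂ} (ha : MemLpZ q a) (n : ℤ) :
    Summable fun m : ℤ => a m * (kerK (n - m) : ℂ) := by
  have hpq := Real.HolderConjugate.conjExponent hq
  have hk : Summable fun d : ℤ => |kerK d| ^ q.conjExponent := by
    refine Summable.of_nonneg_of_le (fun d => Real.rpow_nonneg (abs_nonneg _) _) (fun d => ?_)
      (Real.summable_abs_int_rpow hpq.symm.lt)
    rw [Real.rpow_neg (abs_nonneg _), ← Real.inv_rpow (abs_nonneg _)]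
    exact Real.rpow_le_rpow (abs_nonneg _) (abs_kerK_le d) hpq.symm.nonneg
  refine Summable.of_norm ?_
  simp only [norm_mul, Complex.norm_real, Real.norm_eq_abs]
  exact Real.summable_mul_of_Lp_Lq_of_nonneg hpq (fun m => norm_nonneg _)
    (fun m => abs_nonneg _) ha ((Equiv.subLeft n).summable_iff.2 hk)

theorem lpNorm_nonneg (q : ℝ) (a : ℤ → ℂ) : 0 ≤ lpNorm q a :=
  Real.rpow_nonneg (tsum_nonneg fun _ => Real.rpow_nonneg (norm_nonneg _) _) _

theorem lpNorm_rpow {q : ℝ} (hq : 0 < q) (a : ℤ → ℂ) : lpNorm q a ^ q = ∑' n, ‖a n‖ ^ q := by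
  rw [_root_.lpNorm, ← Real.rpow_mul (tsum_nonneg fun _ => Real.rpow_nonneg (norm_nonneg _) _),
    one_div_mul_cancel hq.ne', Real.rpow_one]

/-- A bound on finite windows extends to all of `ℓ^q`. -/
theorem KernelBound.memLpZ_KT_and_lpNorm_le {q C : ℝ} (h : KernelBound kerK q C) (hq : 1 < q)
    (hC : 0 ≤ C) {a : ℤ → ℂ} (ha : MemLpZ q a) :
    MemLpZ q (KT a) ∧ lpNorm q (KT a) ≤ C * lpNorm q a := by
  have hq0 : 0 < q := by linarith
  have hfin : ∀ s : Finset ℤ, ∑ n ∈ s, ‖KT a n‖ ^ q ≤ C ^ q * ∑' n, ‖a n‖ ^ q := fun s => by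
    have hlim : Filter.Tendsto (fun t : Finset ℤ => ∑ n ∈ s, ‖finConv kerK t a n‖ ^ q)
        Filter.atTop (nhds (∑ n ∈ s, ‖KT a n‖ ^ q)) := by
      refine tendsto_finsetSum _ fun n _ => ?_
      have := (summable_mul_kerK hq ha n).hasSum
      rw [← KT_eq_tsum] at this
      exact (Filter.Tendsto.norm this).rpow_const (Or.inr hq0.le)
    refine le_of_tendsto hlim ?_
    filter_upwards [Filter.eventually_ge_atTop s] with t hst
    refine (Finset.sum_le_sum_of_subset_of_nonneg hst fun n _ _ =>
      Real.rpow_nonneg (norm_nonneg _) _).trans ?_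
    refine ((finNorm_le_mul_iff hq0 hC t _ _).1 (h t a)).trans ?_
    exact mul_le_mul_of_nonneg_left
      (ha.sum_le_tsum t fun n _ => Real.rpow_nonneg (norm_nonneg _) _) (Real.rpow_nonneg hC _)
  have hsum : MemLpZ q (KT a) :=
    summable_of_sum_le (fun n => Real.rpow_nonneg (norm_nonneg _) _) hfin
  refine ⟨hsum, ?_⟩
  rw [← Real.rpow_le_rpow_iff (lpNorm_nonneg _ _) (mul_nonneg hC (lpNorm_nonneg _ _)) hq0,
    Real.mul_rpow hC (lpNorm_nonneg _ _), lpNorm_rpow hq0, lpNorm_rpow hq0]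
  exact hsum.tsum_le_of_sum_le hfin

theorem opNormOn_nonneg (q : ℝ) (T : (ℤ → ℂ) → ℤ → ℂ) : 0 ≤ opNormOn q T :=
  Real.sInf_nonneg fun _ h => h.1

theorem KernelBound.opNormOn_KT_le {q C : ℝ} (h : KernelBound kerK q C) (hq : 1 < q)
    (hC : 0 ≤ C) : opNormOn q KT ≤ C :=
  csInf_le ⟨0, fun _ h => h.1⟩ ⟨hC, fun _ ha => (h.memLpZ_KT_and_lpNorm_le hq hC ha).2⟩

theorem lpNorm_KT_le {q : ℝ} (hq : 1 < q) {a : ℤ → ℂ} (ha : MemLpZ q a) :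
    lpNorm q (KT a) ≤ opNormOn q KT * lpNorm q a := by
  have hC := Cconst_nonneg hq
  have hmem : 3 * Cconst q ∈ {C : ℝ | 0 ≤ C ∧ ∀ a : ℤ → ℂ, MemLpZ q a →
      lpNorm q (KT a) ≤ C * lpNorm q a} :=
    ⟨by positivity, fun _ ha =>
      ((kernelBound_kerK hq).memLpZ_KT_and_lpNorm_le hq (by positivity) ha).2⟩
  rcases (lpNorm_nonneg q a).eq_or_lt with h0 | hpos
  · have := hmem.2 a ha
    rwa [← h0, mul_zero] at this ⊢
  · rw [← div_le_iff₀ hpos]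
    refine le_csInf ⟨_, hmem⟩ fun C hCm => ?_
    rw [div_le_iff₀ hpos]
    exact hCm.2 a ha

/-- The operator norm of `KT` bounds its finite windows. -/
theorem kernelBound_kerK_opNormOn {q : ℝ} (hq : 1 < q) :
    KernelBound kerK q (opNormOn q KT) := fun s a => by
  classical
  have hq0 : 0 < q := by linarith
  have hC := Cconst_nonneg hq
  obtain ⟨b, hb⟩ : ∃ b : ℤ → ℂ, b = fun n => if n ∈ s then a n else 0 := ⟨_, rfl⟩
  have hb0 : ∀ n ∉ s, ‖b n‖ ^ q = 0 := fun n hn => by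
    rw [hb]
    simp only [if_neg hn, norm_zero, Real.zero_rpow hq0.ne']
  have hbm : MemLpZ q b := summable_of_ne_finset_zero hb0
  have hnorm : lpNorm q b = finNorm q s a := by
    rw [_root_.lpNorm, tsum_eq_sum hb0, finNorm]
    congr 1
    refine Finset.sum_congr rfl fun n hn => ?_
    rw [hb]
    simp only [if_pos hn]
  have hKT : ∀ n, KT b n = finConv kerK s a n := fun n => by
    rw [KT_eq_tsum, tsum_eq_sum (s := s), finConv]
    · refine Finset.sum_congr rfl fun m hm => ?_
      rw [hb]
      simp only [if_pos hm]
    · intro m hm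
      rw [hb]
      simp only [if_neg hm, zero_mul]
  have hle : finNorm q s (finConv kerK s a) ≤ lpNorm q (KT b) := by
    have hK := ((kernelBound_kerK hq).memLpZ_KT_and_lpNorm_le hq (by positivity) hbm).1
    refine Real.rpow_le_rpow (sum_norm_rpow_nonneg _ _ _) ?_ (by positivity)
    refine le_trans (le_of_eq ?_)
      (hK.sum_le_tsum s fun n _ => Real.rpow_nonneg (norm_nonneg _) _)
    simp only [hKT]
  rw [← hnorm]
  exact hle.trans (lpNorm_KT_le hq hbm)

/-! ### Skeletons -/

namespace Frame

theorem size_set (l : List Frame) : (Frame.set l).size = (l.map size).sum := by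
  rw [size, List.attach_map_val (f := size)]

theorem frameNorm_set (p : ℝ) (l : List Frame) :
    frameNorm p (.set l) = Cconst (p / (Frame.set l).size) * setNorm p (.set l) := by
  rw [frameNorm, setNorm, List.attach_map_val (f := frameNorm p)]

end Frame

theorem eq_set_and_size_of_mem_skeletons (k : ℕ) :
    ∀ S ∈ skeletons (k + 1), (∃ l, S = Frame.set l) ∧ S.size = k + 1 := by
  induction k with
  | zero =>
    intro S hS
    rw [skeletons, List.mem_singleton] at hS
    subst hS
    exact ⟨⟨_, rfl⟩, by simp [Frame.size_set, Frame.size]⟩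
  | succ k ih =>
    intro S hS
    rw [skeletons, List.mem_append, List.mem_map, List.mem_map] at hS
    rcases hS with ⟨S', hS', rfl⟩ | ⟨S', hS', rfl⟩
    · exact ⟨⟨_, rfl⟩, by simp [Frame.size_set, Frame.size, (ih S' hS').2]⟩
    · obtain ⟨⟨l, rfl⟩, hsize⟩ := ih S' hS'
      refine ⟨⟨_, rfl⟩, ?_⟩
      rw [Frame.size_set] at hsize
      simp only [Frame.addElem, Frame.size_set, List.map_cons, List.sum_cons, hsize]
      simp [Frame.size, add_comm]

/-- The sum of the building norms over the skeletons of a given size. -/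
def skeletonSum (p : ℝ) (k : ℕ) : ℝ := ((skeletons k).map (Frame.setNorm p)).sum

theorem skeletonSum_one (p : ℝ) : skeletonSum p 1 = 1 := by
  simp [skeletonSum, skeletons, Frame.setNorm, Frame.frameNorm]

theorem skeletonSum_add_two (p : ℝ) (k : ℕ) :
    skeletonSum p (k + 2) =
      (Cconst (p / ((k + 1 : ℕ) : ℝ)) + Cconst p) * skeletonSum p (k + 1) := by
  rw [skeletonSum, skeletons, List.map_append, List.sum_append, List.map_map, List.map_map,
    add_mul, skeletonSum, ← List.sum_map_mul_left, ← List.sum_map_mul_left]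
  congr 2
  · refine List.map_congr_left fun S hS => ?_
    obtain ⟨⟨l, rfl⟩, hsize⟩ := eq_set_and_size_of_mem_skeletons k S hS
    have h : Frame.setNorm p (.set [.set l, .int ((k : ℤ) + 2)]) =
        Frame.frameNorm p (.set l) := by
      simp [Frame.setNorm, Frame.frameNorm]
    rw [Function.comp_apply, h, Frame.frameNorm_set, hsize]
  · refine List.map_congr_left fun S hS => ?_
    obtain ⟨⟨l, rfl⟩, -⟩ := eq_set_and_size_of_mem_skeletons k S hS
    simp [Frame.addElem, Frame.setNorm, Frame.frameNorm_set, Frame.size_set, Frame.size,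
      Frame.frameNorm]

theorem one_lt_div_natCast {p : ℝ} {k m : ℕ} (hm : 1 ≤ m) (hmk : m ≤ k) (hp : (k : ℝ) < p) :
    1 < p / m := by
  have h1 : (m : ℝ) ≤ k := by exact_mod_cast hmk
  rw [one_lt_div (by exact_mod_cast hm)]
  linarith

theorem skeletonSum_nonneg {p : ℝ} (k : ℕ) (hp : ((k + 1 : ℕ) : ℝ) < p) :
    0 ≤ skeletonSum p (k + 1) := by
  induction k with
  | zero =>
    rw [skeletonSum_one]
    exact zero_le_one
  | succ k ih =>
    have hp1 : 1 < p := by simpa using one_lt_div_natCast le_rfl (by omega) hp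
    have hk : ((k + 1 : ℕ) : ℝ) < p := lt_trans (by exact_mod_cast Nat.lt_succ_self _) hp
    rw [skeletonSum_add_two]
    exact mul_nonneg (add_nonneg (Cconst_nonneg (one_lt_div_natCast (by omega) le_rfl hk))
      (Cconst_nonneg hp1)) (ih hk)

/-! ### The product rule and the recursion -/

theorem kerK_mul_kerK (u v : ℤ) :
    kerK u * kerK v =
      kerH (v - u) * kerK u + kerH (u - v) * kerK v + if u = v then kerI u else 0 := by
  have hpi := Real.pi_ne_zero
  by_cases huv : u = v
  · subst huv
    have h0 : kerH 0 = 0 := by simp [kerH]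
    rw [sub_self, h0, zero_mul, zero_add, zero_add, if_pos rfl, kerK, kerI]
    split_ifs
    · rw [div_mul_div_comm]
      congr 1
      · norm_num
      · ring
    · rw [mul_zero]
  rw [if_neg huv, add_zero]
  by_cases hu : Odd u <;> by_cases hv : Odd v
  · have hu0 : (u : ℝ) ≠ 0 := by
      rintro h0
      rw [Int.cast_eq_zero] at h0
      simp [h0] at hu
    have hv0 : (v : ℝ) ≠ 0 := by
      rintro h0
      rw [Int.cast_eq_zero] at h0
      simp [h0] at hv
    have h1 : (u : ℝ) - v ≠ 0 := sub_ne_zero.2 (by exact_mod_cast huv)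
    have h2 : (v : ℝ) - u ≠ 0 := sub_ne_zero.2 (by exact_mod_cast Ne.symm huv)
    rw [kerK, kerK, kerH, kerH, if_pos hu, if_pos hv, if_pos (hv.sub_odd hu),
      if_pos (hu.sub_odd hv)]
    push_cast
    rw [← neg_sub (u : ℝ) v]
    field_simp
    ring
  · have hv' := Int.not_odd_iff_even.1 hv
    rw [kerH_of_odd (hv'.sub_odd hu), kerK, kerK, if_neg hv]
    ring
  · have hu' := Int.not_odd_iff_even.1 hu
    rw [kerH_of_odd (hu'.sub_odd hv), kerK, kerK, if_neg hu]
    ring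
  · rw [kerK, kerK, if_neg hu, if_neg hv]
    ring

/-- The product rule for the Kak–Hilbert transform on a finite window. -/
theorem finConv_kerK_mul (s : Finset ℤ) (x a : ℤ → ℂ) (n : ℤ) :
    finConv kerK s x n * finConv kerK s a n =
      finConv kerK s (fun m => x m * finConv kerH s a m + a m * finConv kerH s x m) n +
      finConv kerI s (fun m => x m * a m) n := by
  have hA : finConv kerK s x n * finConv kerK s a n =
      ∑ i ∈ s, ∑ j ∈ s, (x i * a j * (kerH (i - j) * kerK (n - i) : ℝ) +
        x i * a j * (kerH (j - i) * kerK (n - j) : ℝ) +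
        if i = j then x i * a j * (kerI (n - i) : ℂ) else 0) := by
    rw [finConv, finConv, Finset.sum_mul_sum]
    refine Finset.sum_congr rfl fun i _ => Finset.sum_congr rfl fun j _ => ?_
    have h := kerK_mul_kerK (n - i) (n - j)
    simp only [sub_sub_sub_cancel_left, sub_right_inj] at h
    have h' := congrArg (fun r : ℝ => x i * a j * (r : ℂ)) h
    split_ifs at h' ⊢ with hij
    · push_cast at h' ⊢
      linear_combination h'
    · push_cast at h' ⊢
      linear_combination h'
  have hB : finConv kerK s (fun m => x m * finConv kerH s a m + a m * finConv kerH s x m) n =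
      ∑ i ∈ s, ∑ j ∈ s, x i * a j * ((kerH (i - j) * kerK (n - i) : ℝ) : ℂ) +
      ∑ i ∈ s, ∑ j ∈ s, x i * a j * ((kerH (j - i) * kerK (n - j) : ℝ) : ℂ) := by
    rw [Finset.sum_comm (f := fun i j => x i * a j * ((kerH (j - i) * kerK (n - j) : ℝ) : ℂ)),
      ← Finset.sum_add_distrib]
    refine Finset.sum_congr rfl fun i _ => ?_
    simp only [finConv]
    rw [add_mul, Finset.mul_sum, Finset.mul_sum, Finset.sum_mul, Finset.sum_mul]
    congr 1
    · refine Finset.sum_congr rfl fun j _ => ?_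
      push_cast
      ring
    · refine Finset.sum_congr rfl fun j _ => ?_
      push_cast
      ring
  rw [hA, hB]
  simp only [Finset.sum_add_distrib]
  congr 1
  rw [finConv]
  refine Finset.sum_congr rfl fun i hi => ?_
  rw [Finset.sum_ite_eq, if_pos hi]

/-- The signed sums of buildings over skeletons, on a finite window. -/
def iterProd (s : Finset ℤ) (a : ℤ → ℂ) : ℕ → ℤ → ℂ
  | 0 => a
  | k + 1 => fun m =>
      iterProd s a k m * finConv kerH s a m + a m * finConv kerH s (iterProd s a k) m

theorem finConv_kerK_pow (s : Finset ℤ) (a : ℤ → ℂ) (k : ℕ) (n : ℤ) :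
    finConv kerK s a n ^ (k + 1) = finConv kerK s (iterProd s a k) n +
      ∑ j ∈ Finset.range k,
        finConv kerI s (fun m => iterProd s a j m * a m) n * finConv kerK s a n ^ (k - 1 - j) := by
  induction k with
  | zero => simp [iterProd]
  | succ k ih =>
    rw [pow_succ, ih, add_mul, finConv_kerK_mul, Finset.sum_range_succ, Nat.add_sub_cancel,
      Nat.sub_self, pow_zero, mul_one, Finset.sum_mul, add_assoc, add_comm (finConv kerI s _ n)]
    congr 2
    refine Finset.sum_congr rfl fun j hj => ?_
    have : k - j = k - 1 - j + 1 := by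
      have := Finset.mem_range.1 hj
      omega
    rw [this, pow_succ, mul_assoc]

theorem holderTriple_div {p : ℝ} (hp : 0 < p) (i : ℕ) :
    (p / ((i + 1 : ℕ) : ℝ)).HolderTriple p (p / ((i + 2 : ℕ) : ℝ)) where
  inv_add_inv_eq_inv := by
    rw [inv_div, inv_div]
    push_cast
    field_simp
    ring
  left_pos := by positivity
  right_pos := hp

theorem finNorm_mul_pow_le {p : ℝ} (hp : 0 < p) (s : Finset ℤ) (f g : ℤ → ℂ) (i m : ℕ) :
    finNorm (p / ((i + 1 + m : ℕ) : ℝ)) s (fun n => f n * g n ^ m) ≤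
      finNorm (p / ((i + 1 : ℕ) : ℝ)) s f * finNorm p s g ^ m := by
  induction m with
  | zero => simp
  | succ m ih =>
    have h := finNorm_mul_le (holderTriple_div hp (i + m)) s (fun n => f n * g n ^ m) g
    rw [show i + 1 + (m + 1) = i + m + 2 by ring]
    rw [show i + 1 + m = i + m + 1 by ring] at ih
    simp only [pow_succ, ← mul_assoc]
    exact h.trans (mul_le_mul_of_nonneg_right ih (finNorm_nonneg _ _ _))

theorem finNorm_iterProd_le {p : ℝ} (s : Finset ℤ) (a : ℤ → ℂ) (k : ℕ)
    (hp : ((k + 1 : ℕ) : ℝ) < p) :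
    finNorm (p / ((k + 1 : ℕ) : ℝ)) s (iterProd s a k) ≤
      skeletonSum p (k + 1) * finNorm p s a ^ (k + 1) := by
  induction k with
  | zero => simp [iterProd, skeletonSum_one]
  | succ k ih =>
    have hp1 : 1 < p := by simpa using one_lt_div_natCast le_rfl (by omega) hp
    have hp0 : 0 < p := by linarith
    have hk : ((k + 1 : ℕ) : ℝ) < p := lt_trans (by exact_mod_cast Nat.lt_succ_self _) hp
    have hq : 1 < p / ((k + 1 : ℕ) : ℝ) := one_lt_div_natCast (by omega) le_rfl hk
    have hy := ih hk
    obtain ⟨Y, hY⟩ : ∃ Y, Y = finNorm (p / ((k + 1 : ℕ) : ℝ)) s (iterProd s a k) := ⟨_, rfl⟩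
    obtain ⟨N, hN⟩ : ∃ N, N = finNorm p s a := ⟨_, rfl⟩
    have hY0 : 0 ≤ Y := hY ▸ finNorm_nonneg _ _ _
    have hN0 : 0 ≤ N := hN ▸ finNorm_nonneg _ _ _
    have hCp := Cconst_nonneg hp1
    have hCq := Cconst_nonneg hq
    have h1 := finNorm_mul_le (holderTriple_div hp0 k) s (iterProd s a k) (finConv kerH s a)
    have h2 := finNorm_mul_le (holderTriple_div hp0 k).symm s a
      (finConv kerH s (iterProd s a k))
    have h3 := kernelBound_kerH hp1 s a
    have h4 := kernelBound_kerH hq s (iterProd s a k)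
    have h5 := finNorm_add_le (one_lt_div_natCast (by omega) le_rfl hp).le s
      (fun m => iterProd s a k m * finConv kerH s a m)
      fun m => a m * finConv kerH s (iterProd s a k) m
    rw [← hY] at h1 h4 hy
    rw [← hN] at h2 h3 hy
    have h6 := mul_le_mul_of_nonneg_left h3 hY0
    have h7 := mul_le_mul_of_nonneg_left h4 hN0
    have h8 := mul_le_mul_of_nonneg_left hy
      (mul_nonneg (add_nonneg hCq hCp) hN0)
    rw [skeletonSum_add_two, ← hN, pow_succ]
    change finNorm _ s (fun m => iterProd s a k m * finConv kerH s a m +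
      a m * finConv kerH s (iterProd s a k) m) ≤ _
    linarith

theorem finNorm_finConv_kerK_pow_le {p : ℝ} (s : Finset ℤ) (a : ℤ → ℂ) (k : ℕ)
    (hp : ((k + 1 : ℕ) : ℝ) < p) :
    finNorm p s (finConv kerK s a) ^ (k + 1) ≤
      (skeletonSum p (k + 1) * opNormOn (p / ((k + 1 : ℕ) : ℝ)) KT +
        ∑ j ∈ Finset.range k, skeletonSum p (j + 1) * opNormOn p KT ^ (k - 1 - j)) *
      finNorm p s a ^ (k + 1) := by
  have hp1 : 1 < p := by simpa using one_lt_div_natCast le_rfl (by omega) hp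
  have hp0 : 0 < p := by linarith
  have hq : 1 < p / ((k + 1 : ℕ) : ℝ) := one_lt_div_natCast (by omega) le_rfl hp
  have hKq := opNormOn_nonneg (p / ((k + 1 : ℕ) : ℝ)) KT
  have hKp := opNormOn_nonneg p KT
  have hN0 := finNorm_nonneg p s a
  have hhead : finNorm (p / ((k + 1 : ℕ) : ℝ)) s (finConv kerK s (iterProd s a k)) ≤
      skeletonSum p (k + 1) * opNormOn (p / ((k + 1 : ℕ) : ℝ)) KT * finNorm p s a ^ (k + 1) := by
    refine (kernelBound_kerK_opNormOn hq s _).trans ?_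
    refine (mul_le_mul_of_nonneg_left (finNorm_iterProd_le s a k hp) hKq).trans_eq ?_
    ring
  have htail : ∀ j ∈ Finset.range k, finNorm (p / ((k + 1 : ℕ) : ℝ)) s (fun n =>
      finConv kerI s (fun m => iterProd s a j m * a m) n * finConv kerK s a n ^ (k - 1 - j)) ≤
      skeletonSum p (j + 1) * opNormOn p KT ^ (k - 1 - j) * finNorm p s a ^ (k + 1) := by
    intro j hj
    have hjk := Finset.mem_range.1 hj
    have hj1 : ((j + 1 : ℕ) : ℝ) < p := lt_trans (by exact_mod_cast Nat.succ_lt_succ hjk) hp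
    have hj2 : 1 < p / ((j + 2 : ℕ) : ℝ) := one_lt_div_natCast (by omega) (by omega) hp
    have h1 := finNorm_mul_pow_le hp0 s (finConv kerI s fun m => iterProd s a j m * a m)
      (finConv kerK s a) (j + 1) (k - 1 - j)
    rw [show j + 1 + 1 + (k - 1 - j) = k + 1 by omega, show j + 1 + 1 = j + 2 by rfl] at h1
    have h2 := kernelBound_kerI hj2 s fun m => iterProd s a j m * a m
    rw [one_mul] at h2
    have h3 := h2.trans (finNorm_mul_le (holderTriple_div hp0 j) s (iterProd s a j) a)
    have h4 := h3.trans (mul_le_mul_of_nonneg_right (finNorm_iterProd_le s a j hj1) hN0)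
    have h5 := pow_le_pow_left₀ (finNorm_nonneg _ _ _) (kernelBound_kerK_opNormOn hp1 s a)
      (k - 1 - j)
    refine h1.trans ((mul_le_mul h4 h5 (pow_nonneg (finNorm_nonneg _ _ _) _) ?_).trans_eq ?_)
    · exact (finNorm_nonneg _ _ _).trans h4
    · obtain ⟨N, hN⟩ : ∃ N, N = finNorm p s a := ⟨_, rfl⟩
      have e : N ^ (k + 1) = N ^ (j + 1) * N * N ^ (k - 1 - j) := by
        rw [← pow_succ, ← pow_add]
        congr 1
        omega
      rw [← hN, mul_pow, e]
      ring
  rw [← finNorm_pow s (finConv kerK s a) (Nat.le_add_left 1 k), add_mul, Finset.sum_mul]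
  simp only [finConv_kerK_pow]
  refine (finNorm_add_le hq.le s _ _).trans (add_le_add hhead ?_)
  exact (finNorm_sum_le hq.le s _ _).trans (Finset.sum_le_sum htail)

/-- The recursion inequality between the operator norms of 𝓚 on ℓ^p and ℓ^{p/k}. -/
theorem norm_recursion (k : ℕ) (hk : 1 ≤ k) (p : ℝ) (hp : (k : ℝ) < p) :
    opNormOn p KT ^ k ≤
      ((skeletons k).map (Frame.setNorm p)).sum * opNormOn (p / (k : ℝ)) KT +
      ∑ j ∈ Finset.Icc 1 (k - 1),
        ((skeletons j).map (Frame.setNorm p)).sum * opNormOn p KT ^ (k - j - 1) := by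
  obtain ⟨k, rfl⟩ := Nat.exists_eq_add_of_le' hk
  have hp1 : 1 < p := by simpa using one_lt_div_natCast le_rfl hk hp
  have hsum : ∑ j ∈ Finset.Icc 1 (k + 1 - 1),
      ((skeletons j).map (Frame.setNorm p)).sum * opNormOn p KT ^ (k + 1 - j - 1) =
      ∑ j ∈ Finset.range k, skeletonSum p (j + 1) * opNormOn p KT ^ (k - 1 - j) := by
    rw [Nat.add_sub_cancel, ← Finset.Ico_add_one_right_eq_Icc, Finset.sum_Ico_eq_sum_range,
      Nat.add_sub_cancel]
    refine Finset.sum_congr rfl fun j _ => ?_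
    rw [add_comm 1 j, skeletonSum, show k + 1 - (j + 1) - 1 = k - 1 - j by omega]
  rw [hsum]
  change _ ≤ skeletonSum p (k + 1) * _ + _
  obtain ⟨R, hR⟩ : ∃ R, R = skeletonSum p (k + 1) * opNormOn (p / ((k + 1 : ℕ) : ℝ)) KT +
      ∑ j ∈ Finset.range k, skeletonSum p (j + 1) * opNormOn p KT ^ (k - 1 - j) := ⟨_, rfl⟩
  rw [← hR]
  have hR0 : 0 ≤ R := by
    rw [hR]
    refine add_nonneg (mul_nonneg (skeletonSum_nonneg k hp) (opNormOn_nonneg _ _))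
      (Finset.sum_nonneg fun j hj => mul_nonneg (skeletonSum_nonneg j (lt_trans ?_ hp))
        (pow_nonneg (opNormOn_nonneg _ _) _))
    exact_mod_cast Nat.succ_lt_succ (Finset.mem_range.1 hj)
  have hroot : (R ^ (((k + 1 : ℕ) : ℝ)⁻¹)) ^ (k + 1) = R :=
    Real.rpow_inv_natCast_pow hR0 (Nat.succ_ne_zero k)
  have hR0' : 0 ≤ R ^ (((k + 1 : ℕ) : ℝ)⁻¹) := Real.rpow_nonneg hR0 _
  have hbound : KernelBound kerK p (R ^ (((k + 1 : ℕ) : ℝ)⁻¹)) := fun s a => by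
    have h := finNorm_finConv_kerK_pow_le s a k hp
    rw [← hR, ← hroot, ← mul_pow] at h
    exact le_of_pow_le_pow_left₀ (Nat.succ_ne_zero k)
      (mul_nonneg hR0' (finNorm_nonneg _ _ _)) h
  exact (pow_le_pow_left₀ (opNormOn_nonneg _ _) (hbound.opNormOn_KT_le hp1 hR0') _).trans_eq hroot

end
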